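/- Let W be an arbitrary finite Coxeter group. Then the 0-Hecke algebra H_0(W) over an algebraically closed field k is τ-tilting finite if and only if it is representation-finite. -/

import Mathlib

open MulOpposite CategoryTheory CategoryTheory.Limits

noncomputable section

/-- A submodule `N ≤ M` is superfluous if `N ⊔ K = ⊤` implies `K = ⊤`. -/
def SuperfluousSubmodule {R M : Type} [Ring R] [AddCommGroup M] [Module R M]
    (N : Submodule R M) : Prop :=
  ∀ K : Submodule R M, N ⊔ K = ⊤ → K = ⊤

section TauTilting

variable (k : Type) [Field k]
variable (B : Type) [Ring B] [Algebra k B]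

/-- A minimal projective presentation `P1 → P0 → M → 0` of a right `B`-module `M`. -/
def IsMinimalProjPresentation (M P1 P0 : ModuleCat.{0} Bᵐᵒᵖ)
    (f : P1 →ₗ[Bᵐᵒᵖ] P0) (g : P0 →ₗ[Bᵐᵒᵖ] M) : Prop :=
  Module.Projective Bᵐᵒᵖ P1 ∧ Module.Projective Bᵐᵒᵖ P0 ∧
    Function.Surjective g ∧ LinearMap.range f = LinearMap.ker g ∧
    SuperfluousSubmodule (LinearMap.ker g) ∧ SuperfluousSubmodule (LinearMap.ker f)

/-- Left multiplication by `b` on the left `B`-module `Hom_B(P, B)` of a right module `P`. -/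
def leftMulHom {P : Type} [AddCommGroup P] [Module Bᵐᵒᵖ P] (b : B)
    (h : P →ₗ[Bᵐᵒᵖ] B) : P →ₗ[Bᵐᵒᵖ] B where
  toFun p := b * h p
  map_add' x y := by simp [mul_add]
  map_smul' r p := by
    simp only [map_smul, RingHom.id_apply]
    rw [MulOpposite.smul_eq_mul_unop, MulOpposite.smul_eq_mul_unop, mul_assoc]

/-- `M` is τ-rigid:  `Hom_B(M, τM) = 0`, where `τM = D(Tr M)` is computed from a minimal
projective presentation `P1 --f--> P0 → M → 0`, `Tr M = coker(Hom(P0,B) → Hom(P1,B))`, and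
`D = Hom_k(-, k)`.  A right-module map `M → D(Tr M)` is encoded as an additive map
`β : M →+ Hom_k(Hom_B(P1, B), k)` which is balanced (`β (m·b) = β m (b·-)`) and vanishes on
the image of `Hom(P0,B)`, i.e. descends to the cokernel `Tr M`. -/
def IsTauRigid (M : ModuleCat.{0} Bᵐᵒᵖ) : Prop :=
  ∀ (P1 P0 : ModuleCat.{0} Bᵐᵒᵖ) (f : P1 →ₗ[Bᵐᵒᵖ] P0) (g : P0 →ₗ[Bᵐᵒᵖ] M),
    IsMinimalProjPresentation B M P1 P0 f g →
    ∀ β : M →+ ((P1 →ₗ[Bᵐᵒᵖ] B) →ₗ[k] k),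
      (∀ (m : M) (b : B) (h : P1 →ₗ[Bᵐᵒᵖ] B),
        β (op b • m) h = β m (leftMulHom B b h)) →
      (∀ (m : M) (g0 : P0 →ₗ[Bᵐᵒᵖ] B), β m (g0.comp f) = 0) →
      β = 0

/-- A module is indecomposable if it is nonzero and admits no nontrivial direct sum
decomposition. -/
def IndecomposableMod (M : ModuleCat.{0} Bᵐᵒᵖ) : Prop :=
  Nontrivial M ∧ ∀ (L L' : ModuleCat.{0} Bᵐᵒᵖ),
    Nonempty (M ≃ₗ[Bᵐᵒᵖ] (L × L')) → Subsingleton L ∨ Subsingleton L'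

/-- A module is basic (multiplicity-free) if it has no repeated direct summand. -/
def IsBasicMod (M : ModuleCat.{0} Bᵐᵒᵖ) : Prop :=
  ∀ (L C : ModuleCat.{0} Bᵐᵒᵖ),
    Nonempty (M ≃ₗ[Bᵐᵒᵖ] (L × L × C)) → Subsingleton L

/-- `L` is an indecomposable direct summand of `M`. -/
def IsIndecSummand (L M : ModuleCat.{0} Bᵐᵒᵖ) : Prop :=
  IndecomposableMod B L ∧ ∃ L' : ModuleCat.{0} Bᵐᵒᵖ, Nonempty (M ≃ₗ[Bᵐᵒᵖ] (L × L'))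

/-- The rank of the Grothendieck group `K_0(B)` is `n`, i.e. there are exactly `n`
isomorphism classes of simple right `B`-modules. -/
def RankK0Is (n : ℕ) : Prop :=
  ∃ S : Fin n → ModuleCat.{0} Bᵐᵒᵖ,
    (∀ i, IsSimpleModule Bᵐᵒᵖ (S i)) ∧
    (∀ i j, i ≠ j → IsEmpty ((S i) ≃ₗ[Bᵐᵒᵖ] (S j))) ∧
    (∀ T : ModuleCat.{0} Bᵐᵒᵖ, IsSimpleModule Bᵐᵒᵖ T → ∃ i, Nonempty (T ≃ₗ[Bᵐᵒᵖ] S i))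

/-- The number of isomorphism classes of indecomposable direct summands of `M` is `n`. -/
def NumIndecSummandsIs (M : ModuleCat.{0} Bᵐᵒᵖ) (n : ℕ) : Prop :=
  ∃ N : Fin n → ModuleCat.{0} Bᵐᵒᵖ,
    (∀ i, IsIndecSummand B (N i) M) ∧
    (∀ i j, i ≠ j → IsEmpty ((N i) ≃ₗ[Bᵐᵒᵖ] (N j))) ∧
    (∀ L, IsIndecSummand B L M → ∃ i, Nonempty (L ≃ₗ[Bᵐᵒᵖ] N i))

/-- `M` is a τ-tilting module over `B`: it is a finitely generated τ-rigid module whose number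
of non-isomorphic indecomposable direct summands equals the rank of `K_0(B)`. -/
def IsTauTiltingMod (M : ModuleCat.{0} Bᵐᵒᵖ) : Prop :=
  Module.Finite Bᵐᵒᵖ M ∧ IsTauRigid k B M ∧
    ∃ n : ℕ, NumIndecSummandsIs B M n ∧ RankK0Is B n

end TauTilting

section Support

variable (k : Type) [Field k]
variable (A : Type) [Ring A] [Algebra k A]

/-- The quotient of `A` by the two-sided ideal `AeA` generated by `e`. -/
def IdemQuot (e : A) : Type := ((TwoSidedIdeal.span {e}).ringCon).Quotient

instance (e : A) : Ring (IdemQuot A e) :=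
  inferInstanceAs (Ring ((TwoSidedIdeal.span {e}).ringCon).Quotient)

/-- The quotient map `A → A/AeA`. -/
def IdemQuot.mk (e : A) : A →+* IdemQuot A e := RingCon.mk' _

instance (e : A) : Algebra k (IdemQuot A e) :=
  RingHom.toAlgebra' ((IdemQuot.mk A e).comp (algebraMap k A)) (by
    intro c x
    induction x using Quotient.ind with
    | _ a =>
      show (IdemQuot.mk A e) (algebraMap k A c) * (IdemQuot.mk A e) a
          = (IdemQuot.mk A e) a * (IdemQuot.mk A e) (algebraMap k A c)
      rw [← map_mul, ← map_mul, Algebra.commutes])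

/-- `M` is a support τ-tilting module over `A`: there is an idempotent `e ∈ A` such that `M` is
(the restriction of) a τ-tilting module over `A/AeA`. -/
def IsSupportTauTilting (M : ModuleCat.{0} Aᵐᵒᵖ) : Prop :=
  ∃ e : A, IsIdempotentElem e ∧
    ∃ N : ModuleCat.{0} (IdemQuot A e)ᵐᵒᵖ,
      IsTauTiltingMod k (IdemQuot A e) N ∧
      letI : Module Aᵐᵒᵖ N := Module.compHom N (RingHom.op (IdemQuot.mk A e))
      Nonempty (M ≃ₛₗ[RingHom.id Aᵐᵒᵖ] N)

/-- `A` is τ-tilting finite: it admits only finitely many basic support τ-tilting modules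
up to isomorphism. -/
def TauTiltingFinite : Prop :=
  ∃ (n : ℕ) (R : Fin n → ModuleCat.{0} Aᵐᵒᵖ),
    ∀ M : ModuleCat.{0} Aᵐᵒᵖ, IsSupportTauTilting k A M → IsBasicMod A M →
      ∃ i, Nonempty (M ≃ₗ[Aᵐᵒᵖ] R i)

/-- `A` is representation-finite: it has only finitely many isomorphism classes of finitely
generated indecomposable right modules. -/
def RepresentationFinite : Prop :=
  ∃ (n : ℕ) (R : Fin n → ModuleCat.{0} Aᵐᵒᵖ),
    ∀ M : ModuleCat.{0} Aᵐᵒᵖ, Module.Finite Aᵐᵒᵖ M → IndecomposableMod A M →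
      ∃ i, Nonempty (M ≃ₗ[Aᵐᵒᵖ] R i)

end Support

section Hecke
variable (k : Type) [Field k]

/-- The alternating product `a b a b ⋯` with `m` factors. -/
def altProd {R : Type} [Monoid R] (a b : R) (m : ℕ) : R :=
  ((List.range m).map (fun t => if t % 2 = 0 then a else b)).prod

/-- The defining relations of the 0-Hecke algebra of the Coxeter matrix `M`:
quadratic relations `T_s² = -T_s` and the braid relations. -/
def heckeRel {B : Type} (M : CoxeterMatrix B) :
    FreeAlgebra k B → FreeAlgebra k B → Prop := fun x y =>
  (∃ i : B, x = FreeAlgebra.ι k i * FreeAlgebra.ι k i ∧ y = - FreeAlgebra.ι k i) ∨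
  (∃ i j : B, x = altProd (FreeAlgebra.ι k i) (FreeAlgebra.ι k j) (M i j) ∧
    y = altProd (FreeAlgebra.ι k j) (FreeAlgebra.ι k i) (M i j))

/-- The 0-Hecke algebra of a Coxeter matrix `M`, presented by the generators `T_s` subject to
`T_s² = -T_s` and the braid relations. -/
def Hecke0 {B : Type} (M : CoxeterMatrix B) : Type := RingQuot (heckeRel k M)

instance {B : Type} (M : CoxeterMatrix B) : Ring (Hecke0 k M) :=
  inferInstanceAs (Ring (RingQuot (heckeRel k M)))

instance {B : Type} (M : CoxeterMatrix B) : Algebra k (Hecke0 k M) :=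
  inferInstanceAs (Algebra k (RingQuot (heckeRel k M)))

/-- A Coxeter matrix is irreducible if its Coxeter diagram (vertices `B`, an edge between `i`
and `j` whenever `M i j ≥ 3`) is connected. -/
def CoxeterIrreducible {B : Type} (M : CoxeterMatrix B) : Prop :=
  (SimpleGraph.fromRel (fun i j => 3 ≤ M i j)).Connected

/-- Two Coxeter matrices agree up to a bijection on their index sets. -/
def CoxeterMatrixIsoTo {B C : Type} (M : CoxeterMatrix B) (N : CoxeterMatrix C) : Prop :=
  ∃ e : B ≃ C, ∀ a b : B, M a b = N (e a) (e b)

end Hecke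

section Sigma
/-- The Coxeter matrix of a product of Coxeter systems. -/
def sigmaCoxeterMatrix {ι : Type} [DecidableEq ι] {B : ι → Type}
    (M : ∀ i, CoxeterMatrix (B i)) : CoxeterMatrix (Σ i, B i) where
  M p q :=
    if h : p.1 = q.1 then (M q.1) (h ▸ p.2) q.2 else 2
  isSymm := by
    ext ⟨i, a⟩ ⟨j, b⟩
    dsimp [Matrix.transpose]
    by_cases h : i = j
    · subst h
      simp [CoxeterMatrix.symmetric]
    · rw [dif_neg h, dif_neg (Ne.symm h)]
  diagonal := by
    rintro ⟨i, a⟩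
    simp
  off_diagonal := by
    rintro ⟨i, a⟩ ⟨j, b⟩ hne
    dsimp only
    by_cases h : i = j
    · subst h
      rw [dif_pos rfl]
      exact (M i).off_diagonal a b (by simpa using hne)
    · rw [dif_neg h]; omega
end Sigma

/-- A finite-dimensional left module over a `k`-algebra `R`. -/
structure FinMod (k R : Type) [Field k] [Ring R] [Algebra k R] where
  carrier : Type
  [addCommGroup : AddCommGroup carrier]
  [moduleBase : Module k carrier]
  [module : Module R carrier]
  [isScalarTower : IsScalarTower k R carrier]
  [finite : Module.Finite k carrier]

namespace FinMod

attribute [instance] addCommGroup moduleBase module isScalarTower finite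

variable {k R : Type} [Field k] [Ring R] [Algebra k R]

instance : CoeSort (FinMod k R) Type := ⟨FinMod.carrier⟩

instance (M : FinMod k R) : IsNoetherian R M := isNoetherian_of_tower k inferInstance

instance (M : FinMod k R) : IsArtinian R M := isArtinian_of_tower k inferInstance

instance (M : FinMod k R) : Module.Finite R M := inferInstance

instance finite_submodule {M : FinMod k R} (N : Submodule R M) : Module.Finite k N :=
  Module.Finite.of_injective (N.subtype.restrictScalars k) N.injective_subtype

instance finite_quotient {M : FinMod k R} (N : Submodule R M) : Module.Finite k (M ⧸ N) :=
  Module.Finite.of_surjective (N.mkQ.restrictScalars k) N.mkQ_surjective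

/-- A submodule as a finite-dimensional module. -/
abbrev sub {M : FinMod k R} (N : Submodule R M) : FinMod k R := { carrier := N }

/-- A quotient as a finite-dimensional module. -/
abbrev quot {M : FinMod k R} (N : Submodule R M) : FinMod k R := { carrier := M ⧸ N }

/-- The binary product. -/
abbrev prod (M N : FinMod k R) : FinMod k R := { carrier := M × N }

/-- Finite products. -/
abbrev pi {ι : Type} [Finite ι] (M : ι → FinMod k R) : FinMod k R :=
  { carrier := ∀ i, M i }

/-- The regular module. -/
abbrev reg (k R : Type) [Field k] [Ring R] [Algebra k R] [Module.Finite k R] : FinMod k R :=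
  { carrier := R }

/-- The image of a map. -/
abbrev im {M N : FinMod k R} (f : M →ₗ[R] N) : FinMod k R := sub (LinearMap.range f)

/-- The kernel of a map. -/
abbrev ker {M N : FinMod k R} (f : M →ₗ[R] N) : FinMod k R := sub (LinearMap.ker f)

/-- The zero module. -/
abbrev zero (k R : Type) [Field k] [Ring R] [Algebra k R] : FinMod k R :=
  { carrier := PUnit }

/-- Postcomposition on Hom spaces. -/
def postc (M : FinMod k R) {N N' : FinMod k R} (g : N →ₗ[R] N') :
    (M →ₗ[R] N) →ₗ[k] (M →ₗ[R] N') where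
  toFun h := g ∘ₗ h
  map_add' _ _ := LinearMap.comp_add _ _ _
  map_smul' c h := by
    ext x
    simp only [LinearMap.comp_apply, LinearMap.smul_apply, RingHom.id_apply]
    rw [← algebraMap_smul R c, map_smul, algebraMap_smul]

/-- Precomposition on Hom spaces. -/
def prec {M M' : FinMod k R} (f : M →ₗ[R] M') (N : FinMod k R) :
    (M' →ₗ[R] N) →ₗ[k] (M →ₗ[R] N) where
  toFun h := h ∘ₗ f
  map_add' _ _ := LinearMap.add_comp _ _ _
  map_smul' _ _ := rfl

@[simp] lemma postc_apply (M : FinMod k R) {N N' : FinMod k R} (g : N →ₗ[R] N')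
    (h : M →ₗ[R] N) : postc M g h = g ∘ₗ h := rfl

@[simp] lemma prec_apply {M M' : FinMod k R} (f : M →ₗ[R] M') (N : FinMod k R)
    (h : M' →ₗ[R] N) : prec f N h = h ∘ₗ f := rfl

/-- Forgetting a Hom space to the base field. -/
def homToBase (M N : FinMod k R) : (M →ₗ[R] N) →ₗ[k] (M →ₗ[k] N) where
  toFun h := h.restrictScalars k
  map_add' _ _ := rfl
  map_smul' _ _ := rfl

instance (M N : FinMod k R) : Module.Finite k (M →ₗ[R] N) :=
  Module.Finite.of_injective (homToBase M N) (fun _ _ h => by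
    ext x; exact LinearMap.congr_fun h x)

/-- Dimension of the Hom space. -/
def hom (M N : FinMod k R) : ℤ := Module.finrank k (M →ₗ[R] N)

/-- Dimension of a module. -/
def dim (M : FinMod k R) : ℕ := Module.finrank k M

lemma hom_pos {M N : FinMod k R} {f : M →ₗ[R] N} (hf : f ≠ 0) : 0 < hom M N := by
  have : Nontrivial (M →ₗ[R] N) := ⟨f, 0, hf⟩
  have := Module.finrank_pos (R := k) (M := M →ₗ[R] N)
  simpa [hom] using this

lemma hom_eq_zero {M N : FinMod k R} (h : ∀ f : M →ₗ[R] N, f = 0) : hom M N = 0 := by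
  have : Subsingleton (M →ₗ[R] N) := ⟨fun a b => by rw [h a, h b]⟩
  have := Module.finrank_zero_of_subsingleton (R := k) (M := M →ₗ[R] N)
  simpa [hom] using this

lemma eq_zero_of_hom {M N : FinMod k R} (h : hom M N = 0) (f : M →ₗ[R] N) : f = 0 := by
  by_contra hf
  exact (hom_pos hf).ne' h

lemma hom_le_of_surjective {M M' : FinMod k R} (f : M →ₗ[R] M') (hf : Function.Surjective f)
    (N : FinMod k R) : hom M' N ≤ hom M N := by
  unfold hom
  refine Int.ofNat_le.2 (LinearMap.finrank_le_finrank_of_injective (f := prec f N) ?_)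
  intro a b h
  ext x
  obtain ⟨y, rfl⟩ := hf x
  exact LinearMap.congr_fun h y

/-- Left exactness of `Hom` in the first variable. -/
lemma hom_coker {P Q T : FinMod k R} (f : P →ₗ[R] Q) (g : Q →ₗ[R] T)
    (hg : Function.Surjective g) (hfg : LinearMap.range f = LinearMap.ker g) (N : FinMod k R) :
    hom T N + Module.finrank k (LinearMap.range (prec f N)) = hom Q N := by
  have h1 := LinearMap.finrank_range_add_finrank_ker (prec f N)
  have hinj : Function.Injective (prec g N) := by
    intro a b h
    ext x
    obtain ⟨y, rfl⟩ := hg x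
    exact LinearMap.congr_fun h y
  have h2 : LinearMap.ker (prec f N) = LinearMap.range (prec g N) := by
    ext h
    constructor
    · intro hh
      have hle : LinearMap.ker g ≤ LinearMap.ker h := by
        rw [← hfg]
        rintro _ ⟨x, rfl⟩
        exact LinearMap.congr_fun hh x
      let e := g.quotKerEquivOfSurjective hg
      refine ⟨(LinearMap.ker g).liftQ h hle ∘ₗ e.symm.toLinearMap, ?_⟩
      ext x
      simp only [prec_apply, LinearMap.comp_apply, LinearEquiv.coe_coe]
      have : e.symm (g x) = (LinearMap.ker g).mkQ x := by
        rw [LinearEquiv.symm_apply_eq]; rfl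
      rw [this]; rfl
    · rintro ⟨a, rfl⟩
      ext x
      have : g (f x) = 0 := by
        have : f x ∈ LinearMap.ker g := hfg ▸ LinearMap.mem_range_self f x
        exact this
      simp [this]
  have h3 := LinearMap.finrank_range_of_inj hinj
  rw [h2, h3] at h1
  unfold hom
  rw [← h1]; push_cast; ring

/-- Left exactness of `Hom` in the second variable. -/
lemma hom_ker (M : FinMod k R) {K N L : FinMod k R} (i : K →ₗ[R] N) (p : N →ₗ[R] L)
    (hi : Function.Injective i) (hip : LinearMap.range i = LinearMap.ker p) :
    hom M K + Module.finrank k (LinearMap.range (postc M p)) = hom M N := by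
  have h1 := LinearMap.finrank_range_add_finrank_ker (postc M p)
  have hinj : Function.Injective (postc M i) := by
    intro a b h
    ext x
    exact hi (LinearMap.congr_fun h x)
  have h2 : LinearMap.ker (postc M p) = LinearMap.range (postc M i) := by
    ext h
    constructor
    · intro hh
      have hle : ∀ x, h x ∈ LinearMap.range i := by
        intro x
        rw [hip]
        exact LinearMap.congr_fun hh x
      let e := LinearEquiv.ofInjective i hi
      refine ⟨e.symm.toLinearMap ∘ₗ h.codRestrict _ hle, ?_⟩
      ext x
      have : i (e.symm ⟨h x, hle x⟩) = h x := by
        have := LinearEquiv.apply_symm_apply e ⟨h x, hle x⟩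
        exact congrArg Subtype.val this
      exact this
    · rintro ⟨a, rfl⟩
      ext x
      have : i (a x) ∈ LinearMap.ker p := hip ▸ LinearMap.mem_range_self i (a x)
      simpa using this
  have h3 := LinearMap.finrank_range_of_inj hinj
  rw [h2, h3] at h1
  unfold hom
  rw [← h1]; push_cast; ring

/-- If all maps from `M` lift then `Hom(M, -)` is exact on the sequence. -/
lemma hom_exact_of_lift (M : FinMod k R) {K N L : FinMod k R} (i : K →ₗ[R] N) (p : N →ₗ[R] L)
    (hi : Function.Injective i) (hip : LinearMap.range i = LinearMap.ker p)
    (hl : ∀ h : M →ₗ[R] L, ∃ h' : M →ₗ[R] N, p ∘ₗ h' = h) :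
    hom M N = hom M K + hom M L := by
  have h1 := hom_ker M i p hi hip
  have h2 : LinearMap.range (postc M p) = ⊤ := by
    rw [LinearMap.range_eq_top]
    intro h
    exact hl h
  rw [h2, finrank_top] at h1
  exact h1.symm

/-- `Hom(P, -)` is exact for `P` projective. -/
lemma hom_exact_of_projective (P : FinMod k R) [Module.Projective R P] {K N L : FinMod k R}
    (i : K →ₗ[R] N) (p : N →ₗ[R] L)
    (hi : Function.Injective i) (hip : LinearMap.range i = LinearMap.ker p)
    (hp : Function.Surjective p) :
    hom P N = hom P K + hom P L :=
  hom_exact_of_lift P i p hi hip fun h => Module.projective_lifting_property p h hp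

lemma hom_prod_left (M M' N : FinMod k R) : hom (prod M M') N = hom M N + hom M' N := by
  unfold hom
  rw [← LinearEquiv.finrank_eq (LinearMap.coprodEquiv k (M := M) (M₂ := M') (M₃ := N) (R := R)),
    Module.finrank_prod]
  push_cast; rfl

lemma hom_pi_left {ι : Type} [Fintype ι] [DecidableEq ι] (M : ι → FinMod k R) (N : FinMod k R) :
    hom (pi M) N = ∑ i, hom (M i) N := by
  unfold hom
  rw [← LinearEquiv.finrank_eq (LinearMap.lsum R (fun i => M i) k (M := N)),
    Module.finrank_pi_fintype]
  push_cast; rfl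

lemma dim_sub_lt {M : FinMod k R} {N : Submodule R M} (h : N ≠ ⊤) : dim (sub N) < dim M := by
  have : N.restrictScalars k ≠ ⊤ := by
    intro h'
    apply h
    ext x
    have : x ∈ N.restrictScalars k := h' ▸ Submodule.mem_top
    simpa using this
  exact Submodule.finrank_lt this

lemma dim_quot_lt {M : FinMod k R} {N : Submodule R M} (h : N ≠ ⊥) : dim (quot N) < dim M := by
  have h1 : N.restrictScalars k ≠ ⊥ := by
    intro h'
    apply h
    rw [eq_bot_iff]
    intro x hx
    have : x ∈ N.restrictScalars k := hx
    rw [h'] at this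
    simpa using this
  have h2 := Submodule.finrank_quotient_add_finrank (N.restrictScalars k)
  have h3 : 0 < Module.finrank k (N.restrictScalars k) := by
    rw [Module.finrank_pos_iff]
    exact (Submodule.nontrivial_iff_ne_bot).2 h1
  have h4 : Module.finrank k (M ⧸ N) = Module.finrank k (M ⧸ N.restrictScalars k) :=
    rfl
  show Module.finrank k (M ⧸ N) < Module.finrank k M
  omega

lemma bijective_of_surjective {M : FinMod k R} {f : M →ₗ[R] M} (hf : Function.Surjective f) :
    Function.Bijective f :=
  ⟨IsNoetherian.injective_of_surjective_endomorphism f hf, hf⟩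

lemma bijective_of_injective {M : FinMod k R} {f : M →ₗ[R] M} (hf : Function.Injective f) :
    Function.Bijective f :=
  ⟨hf, IsArtinian.surjective_of_injective_endomorphism f hf⟩

/-- Fitting's lemma, as a splitting of the stable image. -/
lemma fitting (M : FinMod k R) (f : M →ₗ[R] M) :
    ∃ n : ℕ, 1 ≤ n ∧ IsCompl (LinearMap.ker (f ^ n)) (LinearMap.range (f ^ n)) := by
  have := LinearMap.eventually_isCompl_ker_pow_range_pow f
  obtain ⟨n, hn⟩ := Filter.eventually_atTop.1 this
  exact ⟨n + 1, by omega, hn _ (by omega)⟩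

lemma fitting_retract (M : FinMod k R) (f : M →ₗ[R] M) :
    ∃ (n : ℕ) (r : M →ₗ[R] LinearMap.range (f ^ n)), 1 ≤ n ∧ ∀ x : LinearMap.range (f ^ n),
      r x = x := by
  obtain ⟨n, hn, hc⟩ := fitting M f
  refine ⟨n, Submodule.projectionOnto _ _ hc.symm, hn, fun x => ?_⟩
  exact Submodule.projectionOnto_apply_left hc.symm x

end FinMod

namespace FinMod

variable {k R : Type} [Field k] [Ring R] [Algebra k R]

/-- Indecomposability, in the form given by Fitting's lemma. -/
def Indec (M : FinMod k R) : Prop :=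
  Nontrivial M ∧ ∀ f : M →ₗ[R] M, IsNilpotent f ∨ Function.Bijective f

lemma indec_of_forall_isCompl {M : FinMod k R} [Nontrivial M]
    (h : ∀ N N' : Submodule R M, IsCompl N N' → N = ⊥ ∨ N' = ⊥) : Indec M := by
  refine ⟨inferInstance, fun f => ?_⟩
  obtain ⟨n, hn, hc⟩ := fitting M f
  rcases h _ _ hc with h1 | h1
  · right
    apply bijective_of_injective
    have hinj := LinearMap.ker_eq_bot.1 h1
    obtain ⟨m, rfl⟩ : ∃ m, n = m + 1 := ⟨n - 1, by omega⟩
    rw [pow_succ] at hinj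
    exact Function.Injective.of_comp (f := ⇑(f ^ m)) hinj
  · left
    exact ⟨n, LinearMap.range_eq_bot.1 h1⟩

lemma Indec.congr {M N : FinMod k R} (e : M ≃ₗ[R] N) (h : Indec M) : Indec N := by
  obtain ⟨h1, h2⟩ := h
  refine ⟨e.symm.toEquiv.nontrivial, fun f => ?_⟩
  rcases h2 (e.symm.toLinearMap ∘ₗ f ∘ₗ e.toLinearMap) with ⟨n, hn⟩ | hb
  · left
    refine ⟨n, ?_⟩
    have : ∀ m : ℕ, (e.symm.toLinearMap ∘ₗ f ∘ₗ e.toLinearMap) ^ m =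
        e.symm.toLinearMap ∘ₗ (f ^ m) ∘ₗ e.toLinearMap := by
      intro m
      induction m with
      | zero => ext x; simp
      | succ m ih =>
        rw [pow_succ, ih, pow_succ]
        ext x; simp
    rw [this] at hn
    ext x
    have := LinearMap.congr_fun hn (e.symm x)
    simpa using this
  · right
    have : (f : N → N) = e ∘ (e.symm.toLinearMap ∘ₗ f ∘ₗ e.toLinearMap) ∘ e.symm := by
      funext x; simp
    rw [this]
    exact e.bijective.comp (hb.comp e.symm.bijective)

/-- A surjective split decomposition of an indecomposable module is trivial. -/
lemma Indec.bijective_or_of_add {L L' : FinMod k R} (hL : Indec L) {u v : L →ₗ[R] L'}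
    (h : Function.Bijective (u + v)) : Function.Bijective u ∨ Function.Bijective v := by
  let e := LinearEquiv.ofBijective _ h
  have key : e.symm.toLinearMap ∘ₗ u + e.symm.toLinearMap ∘ₗ v = 1 := by
    ext x
    have : e.symm ((u + v) x) = x := e.symm_apply_apply x
    simpa using this
  have hb : ∀ w : L →ₗ[R] L', Function.Bijective (e.symm.toLinearMap ∘ₗ w) →
      Function.Bijective w := by
    intro w hw
    have : (w : L → L') = e ∘ (e.symm.toLinearMap ∘ₗ w) := by funext x; simp
    rw [this]
    exact e.bijective.comp hw
  rcases hL.2 (e.symm.toLinearMap ∘ₗ u) with h1 | h1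
  · right
    apply hb
    have h2 := h1.isUnit_one_sub
    rw [← key, add_sub_cancel_left] at h2
    exact (Module.End.isUnit_iff _).1 h2
  · exact Or.inl (hb u h1)

lemma Indec.not_bijective_zero {L L' : FinMod k R} (hL : Indec L) :
    ¬ Function.Bijective (0 : L →ₗ[R] L') := by
  intro h
  obtain ⟨x, y, hxy⟩ := hL.1
  exact hxy (h.1 rfl)

lemma Indec.exists_bijective_of_sum {L L' : FinMod k R} (hL : Indec L) {ι : Type}
    (s : Finset ι) (u : ι → (L →ₗ[R] L')) (h : Function.Bijective (∑ i ∈ s, u i : L →ₗ[R] L')) :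
    ∃ i ∈ s, Function.Bijective (u i) := by
  classical
  induction s using Finset.induction_on with
  | empty => exact absurd h (by simpa using hL.not_bijective_zero)
  | insert a s ha ih =>
    rw [Finset.sum_insert ha] at h
    rcases hL.bijective_or_of_add h with h1 | h1
    · exact ⟨a, Finset.mem_insert_self _ _, h1⟩
    · obtain ⟨i, hi, hb⟩ := ih h1
      exact ⟨i, Finset.mem_insert_of_mem hi, hb⟩

/-- A map that factors bijectively through an indecomposable module does so by isomorphisms. -/
lemma Indec.bijective_of_comp {L X L' : FinMod k R} (hL : Nontrivial L) (hX : Indec X)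
    (a : L →ₗ[R] X) (b : X →ₗ[R] L') (h : Function.Bijective (b ∘ₗ a)) :
    Function.Bijective a ∧ Function.Bijective b := by
  let e := LinearEquiv.ofBijective _ h
  have he : ∀ x, e.symm (b (a x)) = x := fun x => e.symm_apply_apply x
  let c : X →ₗ[R] X := a ∘ₗ e.symm.toLinearMap ∘ₗ b
  have hc : ∀ x, c (a x) = a x := fun x => by simp [c, he]
  have ha : Function.Injective a := fun x y hxy => by
    rw [← he x, ← he y, hxy]
  rcases hX.2 c with ⟨n, hn⟩ | hb
  · exfalso
    obtain ⟨x, hx⟩ := exists_ne (0 : L)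
    have h1 : ∀ m : ℕ, (c ^ m) (a x) = a x := by
      intro m
      induction m with
      | zero => simp
      | succ m ih => rw [pow_succ, Module.End.mul_apply, hc, ih]
    have := h1 n
    rw [hn, LinearMap.zero_apply] at this
    exact hx (ha (by rw [← this, map_zero]))
  · have hs : Function.Surjective a := by
      intro y
      obtain ⟨z, hz⟩ := hb.2 y
      exact ⟨e.symm (b z), hz⟩
    have hab : Function.Bijective a := ⟨ha, hs⟩
    refine ⟨hab, ?_⟩
    exact (Function.Bijective.of_comp_iff (f := (b : X → L')) hab).1 h

/-- The non-isomorphisms from an indecomposable module form a subspace. -/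
def rad {L L' : FinMod k R} (hL : Indec L) : Submodule k (L →ₗ[R] L') where
  carrier := {f | ¬ Function.Bijective f}
  zero_mem' := hL.not_bijective_zero
  add_mem' ha hb h := (hL.bijective_or_of_add h).elim ha hb
  smul_mem' c f hf h := by
    by_cases hc : c = 0
    · subst hc
      rw [zero_smul] at h
      exact hL.not_bijective_zero h
    · apply hf
      constructor
      · intro x y hxy
        exact h.1 (by simp [LinearMap.smul_apply, hxy])
      · intro y
        obtain ⟨x, hx⟩ := h.2 (c • y)
        refine ⟨x, ?_⟩
        have : c • f x = c • y := hx
        exact (smul_right_injective _ hc) this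

lemma mem_rad {L L' : FinMod k R} (hL : Indec L) (f : L →ₗ[R] L') :
    f ∈ rad hL ↔ ¬ Function.Bijective f := Iff.rfl

lemma comp_eq_sum {ι : Type} [Fintype ι] [DecidableEq ι] {L L' : FinMod k R}
    (M : ι → FinMod k R) (i : L →ₗ[R] pi M) (p : pi M →ₗ[R] L') :
    p ∘ₗ i = ∑ x, (p ∘ₗ LinearMap.single R (fun x => M x) x) ∘ₗ (LinearMap.proj x ∘ₗ i) := by
  ext y
  simp only [LinearMap.comp_apply, LinearMap.sum_apply, LinearMap.proj_apply]
  rw [← map_sum]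
  congr 1
  exact (LinearMap.sum_single_apply (fun x => M x) (i y)).symm

/-- Krull–Schmidt: an indecomposable summand of a product of indecomposable modules is
isomorphic to a factor. -/
lemma Indec.exists_iso_of_retract {ι : Type} [Fintype ι] {L : FinMod k R} (hL : Indec L)
    (M : ι → FinMod k R) (hM : ∀ x, Indec (M x)) (i : L →ₗ[R] pi M) (p : pi M →ₗ[R] L)
    (h : Function.Bijective (p ∘ₗ i)) : ∃ x, Nonempty (L ≃ₗ[R] M x) := by
  classical
  rw [comp_eq_sum] at h
  obtain ⟨x, -, hx⟩ := hL.exists_bijective_of_sum _ _ h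
  exact ⟨x, ⟨LinearEquiv.ofBijective _ (Indec.bijective_of_comp hL.1 (hM x) _ _ hx).1⟩⟩

/-- A product of pairwise non-isomorphic indecomposables has no repeated summand. -/
lemma subsingleton_of_sq_retract {ι : Type} [Fintype ι] {L : FinMod k R} (hL : Indec L)
    (M : ι → FinMod k R) (hM : ∀ x, Indec (M x))
    (hne : ∀ x y, Nonempty (M x ≃ₗ[R] M y) → x = y)
    (i₁ i₂ : L →ₗ[R] pi M) (p₁ p₂ : pi M →ₗ[R] L)
    (h₁ : Function.Bijective (p₁ ∘ₗ i₁)) (h₂ : Function.Bijective (p₂ ∘ₗ i₂))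
    (h₁₂ : p₁ ∘ₗ i₂ = 0) : False := by
  classical
  rw [comp_eq_sum] at h₁ h₂ h₁₂
  obtain ⟨x, -, hx⟩ := hL.exists_bijective_of_sum _ _ h₁
  obtain ⟨y, -, hy⟩ := hL.exists_bijective_of_sum _ _ h₂
  have hx' := Indec.bijective_of_comp hL.1 (hM x) _ _ hx
  have hy' := Indec.bijective_of_comp hL.1 (hM y) _ _ hy
  obtain rfl : x = y := hne x y
    ⟨(LinearEquiv.ofBijective _ hx'.1).symm.trans (LinearEquiv.ofBijective _ hy'.1)⟩
  rw [← Finset.add_sum_erase _ _ (Finset.mem_univ x)] at h₁₂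
  have hb : Function.Bijective
      ((p₁ ∘ₗ LinearMap.single R (fun x => M x) x) ∘ₗ (LinearMap.proj x ∘ₗ i₂)) := by
    rw [LinearMap.coe_comp]
    exact hx'.2.comp hy'.1
  have hz := eq_neg_of_add_eq_zero_right h₁₂
  have hb' : Function.Bijective
      ((∑ z ∈ Finset.univ.erase x,
        (p₁ ∘ₗ LinearMap.single R (fun x => M x) z) ∘ₗ (LinearMap.proj z ∘ₗ i₂) :
          L →ₗ[R] L)) := by
    rw [hz]
    have : (⇑(-((p₁ ∘ₗ LinearMap.single R (fun x => M x) x) ∘ₗ (LinearMap.proj x ∘ₗ i₂))) :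
        L → L) = (LinearEquiv.neg R) ∘
          ((p₁ ∘ₗ LinearMap.single R (fun x => M x) x) ∘ₗ (LinearMap.proj x ∘ₗ i₂)) := by
      funext w; simp
    rw [this]
    exact (LinearEquiv.neg R (M := L)).bijective.comp hb
  obtain ⟨z, hzm, hzb⟩ := hL.exists_bijective_of_sum _ _ hb'
  have hz' := Indec.bijective_of_comp hL.1 (hM z) _ _ hzb
  have : x = z := hne x z
    ⟨(LinearEquiv.ofBijective _ hy'.1).symm.trans (LinearEquiv.ofBijective _ hz'.1)⟩
  exact (Finset.ne_of_mem_erase hzm) this.symm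

/-- Every finite-dimensional module is a finite product of indecomposables. -/
lemma exists_decomposition (M : FinMod k R) :
    ∃ (ι : Type) (_ : Fintype ι) (L : ι → FinMod k R), (∀ x, Indec (L x)) ∧
      Nonempty (M ≃ₗ[R] pi L) := by
  induction hd : dim M using Nat.strong_induction_on generalizing M with
  | _ d ih =>
  by_cases hs : Subsingleton M
  · refine ⟨Empty, inferInstance, fun x => x.elim, fun x => x.elim, ⟨?_⟩⟩
    exact LinearEquiv.ofBijective (0 : M →ₗ[R] (pi (fun x : Empty => x.elim)))
      ⟨fun x y _ => Subsingleton.elim _ _, fun y => ⟨0, funext fun x => x.elim⟩⟩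
  rw [not_subsingleton_iff_nontrivial] at hs
  by_cases h : ∀ N N' : Submodule R M, IsCompl N N' → N = ⊥ ∨ N' = ⊥
  · refine ⟨Unit, inferInstance, fun _ => M, fun _ => indec_of_forall_isCompl h, ⟨?_⟩⟩
    exact (LinearEquiv.funUnique Unit R M).symm
  · push Not at h
    obtain ⟨N, N', hc, hN, hN'⟩ := h
    have h1 : N ≠ ⊤ := fun h => hN' (by simpa [h] using hc.inf_eq_bot)
    have h2 : N' ≠ ⊤ := fun h => hN (by simpa [h] using hc.inf_eq_bot)
    obtain ⟨ι, _, L, hL, ⟨e⟩⟩ := ih _ (hd ▸ dim_sub_lt h1) (sub N) rfl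
    obtain ⟨ι', _, L', hL', ⟨e'⟩⟩ := ih _ (hd ▸ dim_sub_lt h2) (sub N') rfl
    refine ⟨ι ⊕ ι', inferInstance, Sum.elim L L', ?_, ⟨?_⟩⟩
    · rintro (x | x)
      · exact hL x
      · exact hL' x
    · let e₁ : M ≃ₗ[R] N × N' := (Submodule.prodEquivOfIsCompl N N' hc).symm
      let e₂ : (N × N') ≃ₗ[R] (pi L × pi L') := LinearEquiv.prodCongr e e'
      let e₃ : (pi L × pi L') ≃ₗ[R] pi (Sum.elim L L') :=
        (LinearEquiv.sumPiEquivProdPi R ι ι' (fun x => (Sum.elim L L' x : FinMod k R))).symm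
      exact (e₁.trans e₂).trans e₃

end FinMod

namespace FinMod

variable {k R : Type} [Field k] [Ring R] [Algebra k R]

/-- The modules generated by `X`. -/
def Fac (X N : FinMod k R) : Prop :=
  ∃ (r : ℕ) (f : pi (fun _ : Fin r => X) →ₗ[R] N), Function.Surjective f

/-- Torsion classes of finite-dimensional modules. -/
structure IsTors (U : FinMod k R → Prop) : Prop where
  quot : ∀ {M N : FinMod k R} (f : M →ₗ[R] N), Function.Surjective f → U M → U N
  ext : ∀ {M N : FinMod k R} (f : M →ₗ[R] N), Function.Surjective f → U (ker f) → U N → U M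
  zero : ∀ M : FinMod k R, Subsingleton M → U M

/-- A class is sincere if it sees every nonzero projective. -/
def Sincere (U : FinMod k R → Prop) : Prop :=
  ∀ P : FinMod k R, Module.Projective R P → Nontrivial P →
    ∃ (N : FinMod k R) (f : P →ₗ[R] N), U N ∧ f ≠ 0

/-- Ext-projectivity with respect to a class. -/
def ExtProj (U : FinMod k R → Prop) (T : FinMod k R) : Prop :=
  ∀ (E N : FinMod k R) (π : E →ₗ[R] N), Function.Surjective π → U (ker π) →
    ∀ g : T →ₗ[R] N, ∃ h : T →ₗ[R] E, π ∘ₗ h = g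

/-- A projective presentation along which all maps to modules of the class extend. -/
structure UPres (U : FinMod k R → Prop) {P Q T : FinMod k R} (f : P →ₗ[R] Q) (g : Q →ₗ[R] T) :
    Prop where
  projP : Module.Projective R P
  projQ : Module.Projective R Q
  surj : Function.Surjective g
  exact : LinearMap.range f = LinearMap.ker g
  extend : ∀ N, U N → ∀ h : P →ₗ[R] N, ∃ h' : Q →ₗ[R] N, h' ∘ₗ f = h

section tors

variable {U : FinMod k R → Prop}

lemma IsTors.congr (hU : IsTors U) {M N : FinMod k R} (e : M ≃ₗ[R] N) (h : U M) : U N :=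
  hU.quot e.toLinearMap e.surjective h

lemma IsTors.ext' (hU : IsTors U) {M N K : FinMod k R} (i : K →ₗ[R] M) (f : M →ₗ[R] N)
    (hf : Function.Surjective f) (hif : LinearMap.range i = LinearMap.ker f) (hK : U K)
    (hN : U N) : U M := by
  refine hU.ext f hf (hU.quot (M := K) (i.codRestrict _ fun x => ?_) ?_ hK) hN
  · exact hif ▸ LinearMap.mem_range_self i x
  · rintro ⟨y, hy⟩
    rw [← hif] at hy
    obtain ⟨x, rfl⟩ := hy
    exact ⟨x, rfl⟩

lemma IsTors.prod (hU : IsTors U) {M N : FinMod k R} (hM : U M) (hN : U N) : U (prod M N) :=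
  hU.ext' (LinearMap.inl R M N) (LinearMap.snd R M N) (fun y => ⟨(0, y), rfl⟩)
    (LinearMap.range_inl R M N) hM hN

lemma IsTors.pi (hU : IsTors U) {ι : Type} [Fintype ι] (M : ι → FinMod k R)
    (h : ∀ i, U (M i)) : U (pi M) := by
  classical
  have key : ∀ s : Finset ι, U (FinMod.pi (fun i : s => M i)) := by
    intro s
    induction s using Finset.induction_on with
    | empty => exact hU.zero _ ⟨fun a b => funext fun x => absurd x.2 (Finset.notMem_empty _)⟩
    | insert a s ha ih =>
      refine hU.quot (M := FinMod.prod (M a) (FinMod.pi (fun i : s => M i))) ?_ ?_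
        (hU.prod (h a) ih)
      · refine LinearMap.pi fun i =>
          if hi : (i : ι) = a then
            LinearMap.fst R (M a) (FinMod.pi (fun i : s => M i)) |>.comp LinearMap.id |> fun u =>
              (cast (by rw [hi]) u : _ →ₗ[R] M i)
          else (LinearMap.proj (⟨i, (Finset.mem_insert.1 i.2).resolve_left hi⟩ : s)) ∘ₗ
            LinearMap.snd R (M a) (FinMod.pi (fun i : s => M i))
      · intro y
        refine ⟨(y ⟨a, Finset.mem_insert_self _ _⟩,
          fun i => y ⟨i, Finset.mem_insert_of_mem i.2⟩), ?_⟩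
        funext ⟨i, hi⟩
        by_cases hia : i = a
        · subst hia
          simp
        · simp [hia]
  refine hU.quot (M := FinMod.pi (fun i : (Finset.univ : Finset ι) => M i))
    (LinearMap.pi fun i => LinearMap.proj (⟨i, Finset.mem_univ i⟩ : (Finset.univ : Finset ι))) ?_
    (key Finset.univ)
  intro y
  exact ⟨fun i => y i, rfl⟩

lemma IsTors.of_fac (hU : IsTors U) {X N : FinMod k R} (hX : U X) (h : Fac X N) : U N := by
  obtain ⟨r, f, hf⟩ := h
  exact hU.quot f hf (hU.pi _ fun _ => hX)

end tors

lemma fac_self (X : FinMod k R) : Fac X X :=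
  ⟨1, LinearMap.proj 0, fun y => ⟨fun _ => y, rfl⟩⟩

lemma Fac.quot {X M N : FinMod k R} (h : Fac X M) (f : M →ₗ[R] N) (hf : Function.Surjective f) :
    Fac X N := by
  obtain ⟨r, g, hg⟩ := h
  exact ⟨r, f ∘ₗ g, hf.comp hg⟩

/-- The universal map from powers of `X`. -/
lemma exists_universal_left (X N : FinMod k R) :
    ∃ (r : ℕ) (f : Fin r → (X →ₗ[R] N)), ∀ h : X →ₗ[R] N, ∃ c : Fin r → k, h = ∑ i, c i • f i := by
  let b := Module.finBasis k (X →ₗ[R] N)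
  exact ⟨_, b, fun h => ⟨fun i => b.repr h i, (b.sum_repr h).symm⟩⟩

/-- Scalar multiplication by an element of the base field as an endomorphism. -/
def smulHom (c : k) (X : FinMod k R) : X →ₗ[R] X := c • LinearMap.id

@[simp] lemma smulHom_apply (c : k) (X : FinMod k R) (x : X) : smulHom c X x = c • x := rfl

/-- `N` is generated by `X` iff all elements are sums of images. -/
lemma fac_of_iSup {X N : FinMod k R} (h : ⨆ f : X →ₗ[R] N, LinearMap.range f = ⊤) : Fac X N := by
  obtain ⟨r, f, hf⟩ := exists_universal_left X N
  refine ⟨r, LinearMap.lsum R (fun _ : Fin r => X) k (M := N) f, ?_⟩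
  rw [← LinearMap.range_eq_top, eq_top_iff, ← h]
  refine iSup_le fun g => ?_
  rintro _ ⟨x, rfl⟩
  obtain ⟨c, rfl⟩ := hf g
  refine ⟨fun i => c i • x, ?_⟩
  simp [LinearMap.lsum_apply, LinearMap.sum_apply]

section projective

lemma exists_projective_surjection [Module.Finite k R] (M : FinMod k R) :
    ∃ (P : FinMod k R) (g : P →ₗ[R] M), Module.Projective R P ∧ Function.Surjective g := by
  obtain ⟨n, g, hg⟩ := Module.Finite.exists_fin' R M
  refine ⟨pi (fun _ : Fin n => reg k R), g, ?_, hg⟩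
  show Module.Projective R (Fin n → R)
  infer_instance

/-- If `L + K = P` with `P` projective, then either `K = P` or `L` contains a nonzero projective
direct summand of `P`; moreover this summand surjects wherever `L` does modulo `K`. -/
lemma exists_summand_of_sup_eq_top {P : FinMod k R} [Module.Projective R P] (L K : Submodule R P)
    (h : L ⊔ K = ⊤) : ∃ (P' : FinMod k R) (i : P' →ₗ[R] P) (r : P →ₗ[R] P'), r ∘ₗ i = LinearMap.id ∧
      LinearMap.range i ≤ L ∧ LinearMap.range i ⊔ K = ⊤ := by
  have hs : Function.Surjective (K.mkQ ∘ₗ L.subtype) := by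
    rw [← LinearMap.range_eq_top, LinearMap.range_comp, Submodule.range_subtype, eq_top_iff]
    rintro x -
    obtain ⟨x, rfl⟩ := K.mkQ_surjective x
    have hx : x ∈ L ⊔ K := h ▸ Submodule.mem_top
    obtain ⟨l, hl, y, hy, rfl⟩ := Submodule.mem_sup.1 hx
    refine ⟨l, hl, ?_⟩
    rw [map_add, (Submodule.Quotient.mk_eq_zero K).2 hy |> fun h => (h : K.mkQ y = 0), add_zero]
  obtain ⟨θ, hθ⟩ := Module.projective_lifting_property (K.mkQ ∘ₗ L.subtype) K.mkQ hs
  let φ : P →ₗ[R] P := L.subtype ∘ₗ θ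
  have hφ : ∀ x, K.mkQ (φ x) = K.mkQ x := fun x => LinearMap.congr_fun hθ x
  have hφn : ∀ (n : ℕ) (x), K.mkQ ((φ ^ n) x) = K.mkQ x := by
    intro n
    induction n with
    | zero => intro x; rfl
    | succ n ih => intro x; rw [pow_succ, Module.End.mul_apply, ih, hφ]
  obtain ⟨n, r, hn, hr⟩ := fitting_retract P φ
  refine ⟨im (φ ^ n), (LinearMap.range (φ ^ n)).subtype, r, ?_, ?_, ?_⟩
  · ext x
    exact congrArg Subtype.val (hr x)
  · rw [Submodule.range_subtype]
    rintro _ ⟨x, rfl⟩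
    obtain ⟨m, rfl⟩ : ∃ m, n = m + 1 := ⟨n - 1, by omega⟩
    rw [pow_succ', Module.End.mul_apply]
    exact (θ _).2
  · rw [Submodule.range_subtype, eq_top_iff]
    rintro x -
    refine Submodule.mem_sup.2 ⟨(φ ^ n) x, ⟨x, rfl⟩, x - (φ ^ n) x, ?_, by abel⟩
    rw [← Submodule.Quotient.mk_eq_zero]
    have := hφn n x
    show K.mkQ (x - (φ ^ n) x) = 0
    rw [map_sub, this, sub_self]

lemma exists_projective_cover [Module.Finite k R] (M : FinMod k R) :
    ∃ (P : FinMod k R) (g : P →ₗ[R] M), Module.Projective R P ∧ Function.Surjective g ∧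
      SuperfluousSubmodule (LinearMap.ker g) := by
  have hex : ∃ d, ∃ (P : FinMod k R) (g : P →ₗ[R] M), Module.Projective R P ∧
      Function.Surjective g ∧ dim P = d := by
    obtain ⟨P, g, h1, h2⟩ := exists_projective_surjection M
    exact ⟨_, P, g, h1, h2, rfl⟩
  classical
  obtain ⟨P, g, h1, h2, h3⟩ := Nat.find_spec hex
  refine ⟨P, g, h1, h2, fun K hK => ?_⟩
  rw [sup_comm] at hK
  obtain ⟨P', i, r, hri, hi, hs⟩ := exists_summand_of_sup_eq_top K (LinearMap.ker g) hK
  have hproj : Module.Projective R P' := Module.Projective.of_split i r hri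
  have hsurj : Function.Surjective (g ∘ₗ i) := by
    intro y
    obtain ⟨x, rfl⟩ := h2 y
    have hx : x ∈ LinearMap.range i ⊔ LinearMap.ker g := hs ▸ Submodule.mem_top
    obtain ⟨_, ⟨z, rfl⟩, w, hw, rfl⟩ := Submodule.mem_sup.1 hx
    refine ⟨z, ?_⟩
    rw [map_add, LinearMap.mem_ker.1 hw, add_zero]; rfl
  have hle := Nat.find_min' hex ⟨P', _, hproj, hsurj, rfl⟩
  rw [← h3] at hle
  by_contra hne
  have hlt : dim P' < dim P := by
    refine lt_of_le_of_lt ?_ (dim_sub_lt hne)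
    refine LinearMap.finrank_le_finrank_of_injective
      (f := ((i.codRestrict K fun x => hi ⟨x, rfl⟩ : P' →ₗ[R] K)).restrictScalars k) ?_
    intro x y hxy
    have : i x = i y := congrArg Subtype.val hxy
    rw [← LinearMap.id_apply (R := R) x, ← LinearMap.id_apply (R := R) y, ← hri,
      LinearMap.comp_apply, LinearMap.comp_apply, this]
  omega

/-- Projective covers dominate projective surjections. -/
lemma surjective_lift_of_superfluous {X Y Z : FinMod k R} [Module.Projective R X]
    (u : X →ₗ[R] Z) (v : Y →ₗ[R] Z) (hu : Function.Surjective u) (hv : Function.Surjective v)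
    (hs : SuperfluousSubmodule (LinearMap.ker v)) :
    ∃ w : X →ₗ[R] Y, Function.Surjective w := by
  obtain ⟨w, hw⟩ := Module.projective_lifting_property v u hv
  refine ⟨w, LinearMap.range_eq_top.1 (hs _ ?_)⟩
  rw [eq_top_iff]
  rintro y -
  obtain ⟨x, hx⟩ := hu (v y)
  refine Submodule.mem_sup.2 ⟨y - w x, ?_, w x, ⟨x, rfl⟩, by abel⟩
  have : v (w x) = u x := LinearMap.congr_fun hw x
  rw [LinearMap.mem_ker, map_sub, this, hx, sub_self]

end projective

end FinMod

namespace FinMod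

variable {k R : Type} [Field k] [Ring R] [Algebra k R] {U : FinMod k R → Prop}

/-- A left `U`-approximation which is left minimal. -/
structure LeftApprox (U : FinMod k R → Prop) {P T : FinMod k R} (a : P →ₗ[R] T) : Prop where
  mem : U T
  extend : ∀ N, U N → ∀ h : P →ₗ[R] N, ∃ h' : T →ₗ[R] N, h' ∘ₗ a = h

lemma exists_leftApprox {X : FinMod k R} (hU : IsTors U) (hX : ∀ N, U N ↔ Fac X N)
    (P : FinMod k R) [Module.Projective R P] :
    ∃ (T : FinMod k R) (a : P →ₗ[R] T), LeftApprox U a ∧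
      ∀ c : T →ₗ[R] T, c ∘ₗ a = a → Function.Bijective c := by
  classical
  have hex : ∃ d, ∃ (T : FinMod k R) (a : P →ₗ[R] T), LeftApprox U a ∧ dim T = d := by
    obtain ⟨r, f, hf⟩ := exists_universal_left P X
    refine ⟨_, pi (fun _ : Fin r => X), LinearMap.pi f, ⟨?_, ?_⟩, rfl⟩
    · exact hU.pi _ fun _ => (hX X).2 (fac_self X)
    · intro N hN h
      obtain ⟨s, q, hq⟩ := (hX N).1 hN
      obtain ⟨h1, rfl⟩ := Module.projective_lifting_property q h hq
      choose c hc using fun i : Fin s => hf (LinearMap.proj i ∘ₗ h1)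
      let m : pi (fun _ : Fin r => X) →ₗ[R] pi (fun _ : Fin s => X) :=
        LinearMap.pi fun i => ∑ j, smulHom (c i j) X ∘ₗ LinearMap.proj j
      refine ⟨q ∘ₗ m, ?_⟩
      rw [LinearMap.comp_assoc]
      congr 1
      ext x i
      have := LinearMap.congr_fun (hc i) x
      simp only [LinearMap.comp_apply, LinearMap.proj_apply] at this
      rw [this]
      simp [m, LinearMap.sum_apply]
  obtain ⟨T, a, ha, hd⟩ := Nat.find_spec hex
  refine ⟨T, a, ha, fun c hc => bijective_of_surjective ?_⟩
  by_contra hne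
  rw [← LinearMap.range_eq_top] at hne
  have hlt := dim_sub_lt hne
  let a' : P →ₗ[R] im c := a.codRestrict _ fun x => ⟨a x, LinearMap.congr_fun hc x⟩
  have := Nat.find_min' hex ⟨im c, a', ⟨?_, fun N hN h => ?_⟩, rfl⟩
  · rw [← hd] at this
    exact absurd hlt (not_lt.2 this)
  · exact hU.quot (N := im c) c.rangeRestrict c.surjective_rangeRestrict ha.mem
  · obtain ⟨h', rfl⟩ := ha.extend N hN h
    exact ⟨h' ∘ₗ (LinearMap.range c).subtype, rfl⟩

lemma LeftApprox.extProj (hU : IsTors U) {P T : FinMod k R} [Module.Projective R P]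
    {a : P →ₗ[R] T} (ha : LeftApprox U a)
    (hmin : ∀ c : T →ₗ[R] T, c ∘ₗ a = a → Function.Bijective c) : ExtProj U T := by
  intro E N π hπ hK g
  let D : (prod E T) →ₗ[R] N := π ∘ₗ LinearMap.fst R E T - g ∘ₗ LinearMap.snd R E T
  let E' : FinMod k R := ker D
  let p : E' →ₗ[R] T := LinearMap.snd R E T ∘ₗ (LinearMap.ker D).subtype
  let q : E' →ₗ[R] E := LinearMap.fst R E T ∘ₗ (LinearMap.ker D).subtype
  have hpq : ∀ x, π (q x) = g (p x) := fun x => sub_eq_zero.1 x.2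
  have hp : Function.Surjective p := by
    intro t
    obtain ⟨e, he⟩ := hπ (g t)
    exact ⟨⟨(e, t), by simp [D, he]⟩, rfl⟩
  let j : ker π →ₗ[R] E' :=
    (LinearMap.inl R E T ∘ₗ (LinearMap.ker π).subtype).codRestrict _ fun x => by
      have := x.2
      simp only [LinearMap.mem_ker] at this
      simp [D, this]
  have hE' : U E' := by
    refine hU.ext' j p hp ?_ hK ha.mem
    ext x
    constructor
    · rintro ⟨y, rfl⟩
      rfl
    · intro hx
      have h0 : p x = 0 := hx
      refine ⟨⟨q x, ?_⟩, ?_⟩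
      · rw [LinearMap.mem_ker, hpq, h0, map_zero]
      · apply Subtype.ext
        exact Prod.ext rfl h0.symm
  obtain ⟨a', ha'⟩ := Module.projective_lifting_property p a hp
  obtain ⟨e, he⟩ := ha.extend E' hE' a'
  have hb := hmin (p ∘ₗ e) (by rw [LinearMap.comp_assoc, he, ha'])
  let i := LinearEquiv.ofBijective _ hb
  refine ⟨q ∘ₗ e ∘ₗ i.symm.toLinearMap, ?_⟩
  ext t
  simp only [LinearMap.comp_apply, LinearEquiv.coe_coe, hpq]
  congr 1
  exact i.apply_symm_apply t

lemma LeftApprox.extProj_coker {P T : FinMod k R}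
    {a : P →ₗ[R] T} (ha : LeftApprox U a) (hT : ExtProj U T) :
    ExtProj U (quot (LinearMap.range a)) := by
  intro E N π hπ hK g
  obtain ⟨h, hh⟩ := hT E N π hπ hK (g ∘ₗ (LinearMap.range a).mkQ)
  have hh' : ∀ t, π (h t) = g ((LinearMap.range a).mkQ t) := fun t => LinearMap.congr_fun hh t
  have hq : ∀ x, (LinearMap.range a).mkQ (a x) = 0 := fun x =>
    (Submodule.Quotient.mk_eq_zero _).2 ⟨x, rfl⟩
  obtain ⟨h', e⟩ := ha.extend _ hK ((h ∘ₗ a).codRestrict (LinearMap.ker π) fun x => by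
    rw [LinearMap.mem_ker, LinearMap.comp_apply, hh', hq, map_zero])
  have e' : ∀ x, (h' (a x) : E) = h (a x) := fun x => congrArg Subtype.val (LinearMap.congr_fun e x)
  refine ⟨(LinearMap.range a).liftQ (h - (LinearMap.ker π).subtype ∘ₗ h') ?_, ?_⟩
  · rintro _ ⟨x, rfl⟩
    rw [LinearMap.mem_ker, LinearMap.sub_apply, LinearMap.comp_apply, Submodule.subtype_apply, e',
      sub_self]
  · refine Submodule.linearMap_qext _ ?_
    ext t
    have := (h' t).2
    simp only [LinearMap.mem_ker] at this
    simp only [LinearMap.comp_apply, Submodule.mkQ_apply, Submodule.liftQ_apply,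
      LinearMap.sub_apply, map_sub, Submodule.subtype_apply, this, sub_zero]
    exact hh' t

lemma ExtProj.of_retract {T T' : FinMod k R} (hT : ExtProj U T) (i : T' →ₗ[R] T) (r : T →ₗ[R] T')
    (h : r ∘ₗ i = LinearMap.id) : ExtProj U T' := by
  intro E N π hπ hK g
  obtain ⟨u, hu⟩ := hT E N π hπ hK (g ∘ₗ r)
  exact ⟨u ∘ₗ i, by rw [← LinearMap.comp_assoc, hu, LinearMap.comp_assoc, h, LinearMap.comp_id]⟩

lemma ExtProj.pi {ι : Type} [Fintype ι] {T : ι → FinMod k R} (hT : ∀ i, ExtProj U (T i)) :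
    ExtProj U (pi T) := by
  classical
  intro E N π hπ hK g
  choose u hu using fun i => hT i E N π hπ hK (g ∘ₗ LinearMap.single R (fun i => T i) i)
  refine ⟨LinearMap.lsum R (fun i => T i) k (M := E) u, ?_⟩
  refine LinearMap.pi_ext' fun i => ?_
  rw [← hu]
  ext x
  simp only [LinearMap.comp_apply, LinearMap.coe_single, LinearMap.lsum_piSingle]

/-- The minimal projective presentation of an Ext-projective module is a `U`-presentation. -/
lemma uPres_of_superfluous (hU : IsTors U) {P Q T : FinMod k R} {f : P →ₗ[R] Q} {g : Q →ₗ[R] T}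
    (hP : Module.Projective R P) (hQ : Module.Projective R Q) (hg : Function.Surjective g)
    (hfg : LinearMap.range f = LinearMap.ker g) (hs : SuperfluousSubmodule (LinearMap.ker f))
    (hT : ExtProj U T) : UPres U f g := by
  refine ⟨hP, hQ, hg, hfg, fun N hN h => ?_⟩
  let N' : Submodule R N := (LinearMap.ker f).map h
  let D : Submodule R (prod (quot N') Q) := LinearMap.range ((N'.mkQ ∘ₗ h).prod (-f))
  have hgf : ∀ p, g (f p) = 0 := fun p => by
    have : f p ∈ LinearMap.ker g := hfg ▸ LinearMap.mem_range_self f p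
    exact this
  let π : quot D →ₗ[R] T := D.liftQ (g ∘ₗ LinearMap.snd R (quot N') Q) (by
    rintro _ ⟨p, rfl⟩
    simp [hgf])
  have hπ : Function.Surjective π := by
    intro t
    obtain ⟨q, rfl⟩ := hg t
    exact ⟨D.mkQ (0, q), rfl⟩
  let j : quot N' →ₗ[R] quot D := D.mkQ ∘ₗ LinearMap.inl R (quot N') Q
  have hD : ∀ p, D.mkQ (N'.mkQ (h p), -f p) = 0 := fun p =>
    (Submodule.Quotient.mk_eq_zero _).2 ⟨p, rfl⟩
  have hj : Function.Injective j := by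
    rw [← LinearMap.ker_eq_bot, eq_bot_iff]
    intro n hn
    have : (n, (0 : Q)) ∈ D := (Submodule.Quotient.mk_eq_zero _).1 hn
    obtain ⟨p, hp⟩ := this
    have h1 : N'.mkQ (h p) = n := congrArg Prod.fst hp
    have h2 : -f p = 0 := congrArg Prod.snd hp
    rw [Submodule.mem_bot, ← h1]
    exact (Submodule.Quotient.mk_eq_zero _).2 ⟨p, neg_eq_zero.1 h2, rfl⟩
  have hjk : LinearMap.range j = LinearMap.ker π := by
    ext x
    constructor
    · rintro ⟨n, rfl⟩
      simp [j, π]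
    · intro hx
      obtain ⟨⟨n, q⟩, rfl⟩ := D.mkQ_surjective x
      have hq : q ∈ LinearMap.ker g := hx
      rw [← hfg] at hq
      obtain ⟨p, rfl⟩ := hq
      refine ⟨n + N'.mkQ (h p), ?_⟩
      rw [← sub_eq_zero, ← hD p]
      show D.mkQ _ - D.mkQ _ = _
      rw [← map_sub]
      congr 1
      ext <;> simp
  have hNq : U (quot N') := hU.quot (N := quot N') N'.mkQ N'.mkQ_surjective hN
  have hK : U (ker π) := by
    refine hU.quot (M := quot N') (j.codRestrict _ fun x => hjk ▸ ⟨x, rfl⟩) ?_ hNq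
    rintro ⟨y, hy⟩
    rw [← hjk] at hy
    obtain ⟨x, rfl⟩ := hy
    exact ⟨x, rfl⟩
  obtain ⟨s, hs'⟩ := hT _ _ π hπ hK LinearMap.id
  have hs'' : ∀ t, π (s t) = t := fun t => LinearMap.congr_fun hs' t
  let t : Q →ₗ[R] LinearMap.range j :=
    (D.mkQ ∘ₗ LinearMap.inr R (quot N') Q - s ∘ₗ g).codRestrict _ fun q => by
      rw [hjk, LinearMap.mem_ker, LinearMap.sub_apply, map_sub, LinearMap.comp_apply,
        LinearMap.comp_apply, hs'']
      simp [π]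
  obtain ⟨h2, hh2⟩ := Module.projective_lifting_property (j.rangeRestrict ∘ₗ N'.mkQ) t
    (j.surjective_rangeRestrict.comp N'.mkQ_surjective)
  have h3 : ∀ q, j (N'.mkQ (h2 q)) = D.mkQ (0, q) - s (g q) := fun q =>
    congrArg Subtype.val (LinearMap.congr_fun hh2 q)
  have h4 : ∀ p, h p - h2 (f p) ∈ N' := by
    intro p
    have : N'.mkQ (h p) = N'.mkQ (h2 (f p)) := by
      apply hj
      rw [h3, hgf, map_zero, sub_zero, ← sub_eq_zero, ← hD p]
      show D.mkQ _ - D.mkQ _ = _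
      rw [← map_sub]
      congr 1
      ext <;> simp
    exact (Submodule.Quotient.eq N').1 this
  refine ⟨h2, ?_⟩
  have h5 : LinearMap.ker f ⊔ LinearMap.ker (h - h2 ∘ₗ f) = ⊤ := by
    rw [eq_top_iff]
    rintro p -
    obtain ⟨x, hx, hxp⟩ := h4 p
    have hx0 : f x = 0 := hx
    refine Submodule.mem_sup.2 ⟨x, hx, p - x, ?_, by abel⟩
    simp [hxp, hx0]
  have h6 := hs _ h5
  ext p
  have : p ∈ LinearMap.ker (h - h2 ∘ₗ f) := h6 ▸ Submodule.mem_top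
  exact (sub_eq_zero.1 this).symm

lemma exists_uPres [Module.Finite k R] (hU : IsTors U) {T : FinMod k R} (hT : ExtProj U T) :
    ∃ (P Q : FinMod k R) (f : P →ₗ[R] Q) (g : Q →ₗ[R] T), UPres U f g := by
  obtain ⟨Q, g, hQ, hg, -⟩ := exists_projective_cover T
  obtain ⟨P, f, hP, hf, hs⟩ := exists_projective_cover (ker g)
  refine ⟨P, Q, (LinearMap.ker g).subtype ∘ₗ f, g, uPres_of_superfluous hU hP hQ hg ?_ ?_ hT⟩
  · rw [LinearMap.range_comp, LinearMap.range_eq_top.2 hf, Submodule.map_top,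
      Submodule.range_subtype]
  · rwa [LinearMap.ker_comp_of_ker_eq_bot _ (LinearMap.ker_eq_bot.2 (Submodule.injective_subtype _))]

end FinMod

namespace FinMod

variable {k R : Type} [Field k] [Ring R] [Algebra k R] {U : FinMod k R → Prop}

lemma superfluous_map {P X : Type} [AddCommGroup P] [Module R P] [AddCommGroup X] [Module R X]
    {S : Submodule R P} (hS : SuperfluousSubmodule S) (j : P →ₗ[R] X) :
    SuperfluousSubmodule (S.map j) := by
  intro K hK
  have h1 : S ⊔ K.comap j = ⊤ := by
    rw [eq_top_iff]
    rintro p -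
    have hp : j p ∈ S.map j ⊔ K := hK ▸ Submodule.mem_top
    obtain ⟨_, ⟨s, hs, rfl⟩, y, hy, hsy⟩ := Submodule.mem_sup.1 hp
    refine Submodule.mem_sup.2 ⟨s, hs, p - s, ?_, by abel⟩
    rw [Submodule.mem_comap, map_sub, ← hsy, add_sub_cancel_left]
    exact hy
  have h2 := hS _ h1
  rw [eq_top_iff, ← hK]
  refine sup_le ?_ le_rfl
  rintro _ ⟨s, -, rfl⟩
  have : s ∈ K.comap j := h2 ▸ Submodule.mem_top
  exact this

lemma UPres.superfluous (hs : Sincere U) {P Q T : FinMod k R} {f : P →ₗ[R] Q} {g : Q →ₗ[R] T}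
    (h : UPres U f g) : SuperfluousSubmodule (LinearMap.ker f) := by
  intro K hK
  have := h.projP
  obtain ⟨P', i, r, hri, hi, hsup⟩ := exists_summand_of_sup_eq_top _ K hK
  rcases subsingleton_or_nontrivial P' with h1 | h1
  · have : LinearMap.range i = ⊥ := by
      rw [eq_bot_iff]
      rintro _ ⟨x, rfl⟩
      rw [Subsingleton.elim x 0, map_zero]
      exact Submodule.zero_mem _
    rwa [this, bot_sup_eq] at hsup
  · exfalso
    obtain ⟨N, φ, hN, hφ⟩ := hs P' (Module.Projective.of_split i r hri) h1
    obtain ⟨h', e⟩ := h.extend N hN (φ ∘ₗ r)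
    apply hφ
    ext x
    have h2 : f (i x) = 0 := hi ⟨x, rfl⟩
    have h3 : h' (f (i x)) = φ (r (i x)) := LinearMap.congr_fun e (i x)
    have h4 : r (i x) = x := LinearMap.congr_fun hri x
    rw [h2, map_zero, h4] at h3
    exact h3.symm

lemma exists_cover_pullback {P Q Q' T : FinMod k R} (f : P →ₗ[R] Q) (g : Q →ₗ[R] T)
    (g' : Q' →ₗ[R] T) [Module.Projective R Q'] (hg : Function.Surjective g)
    (hfg : LinearMap.range f = LinearMap.ker g) :
    ∃ u : prod P Q' →ₗ[R] prod Q Q', (∀ x, x ∈ LinearMap.range u ↔ g x.1 = g' x.2) ∧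
      LinearMap.ker u = (LinearMap.ker f).map (LinearMap.inl R P Q') := by
  obtain ⟨σ, hσ⟩ := Module.projective_lifting_property g g' hg
  have hσ' : ∀ x, g (σ x) = g' x := fun x => LinearMap.congr_fun hσ x
  have hgf : ∀ p, g (f p) = 0 := fun p => by
    have : f p ∈ LinearMap.ker g := hfg ▸ LinearMap.mem_range_self f p
    exact this
  refine ⟨(LinearMap.coprod f σ).prod (LinearMap.snd R P Q'), ?_, ?_⟩
  · rintro ⟨q, q'⟩
    constructor
    · rintro ⟨⟨p, y⟩, hpy⟩
      obtain rfl : f p + σ y = q := by simpa using congrArg Prod.fst hpy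
      obtain rfl : y = q' := congrArg Prod.snd hpy
      simp [hgf, hσ']
    · intro h
      have : q - σ q' ∈ LinearMap.ker g := by
        rw [LinearMap.mem_ker, map_sub, hσ', sub_eq_zero]
        exact h
      rw [← hfg] at this
      obtain ⟨p, hp⟩ := this
      exact ⟨(p, q'), Prod.ext (by simp [hp]) rfl⟩
  · ext ⟨p, q'⟩
    constructor
    · intro h
      have h2 : q' = 0 := congrArg Prod.snd h
      subst h2
      have h1 : f p + σ 0 = 0 := congrArg Prod.fst h
      rw [map_zero, add_zero] at h1
      exact ⟨p, h1, rfl⟩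
    · rintro ⟨y, hy, hyp⟩
      obtain rfl : y = p := congrArg Prod.fst hyp
      obtain rfl : 0 = q' := congrArg Prod.snd hyp
      have hy' : f y = 0 := hy
      simp [hy']

lemma UPres.le_of_sincere (hs : Sincere U) {P Q P' Q' T : FinMod k R} {f : P →ₗ[R] Q}
    {g : Q →ₗ[R] T} {f' : P' →ₗ[R] Q'} {g' : Q' →ₗ[R] T} (h : UPres U f g) (h' : UPres U f' g')
    (N : FinMod k R) : hom P N + hom Q' N ≤ hom P' N + hom Q N := by
  have := h.projQ
  have := h'.projQ
  have := h'.projP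
  obtain ⟨u, hu, hk⟩ := exists_cover_pullback f g g' h.surj h.exact
  obtain ⟨v, hv, -⟩ := exists_cover_pullback f' g' g h'.surj h'.exact
  have hsup : SuperfluousSubmodule (LinearMap.ker u.rangeRestrict) := by
    rw [LinearMap.ker_rangeRestrict, hk]
    exact superfluous_map (h.superfluous hs) _
  let v' : prod P' Q →ₗ[R] LinearMap.range u :=
    ((LinearEquiv.prodComm R Q' Q).toLinearMap ∘ₗ v).codRestrict _ fun x =>
      (hu _).2 ((hv (v x)).1 ⟨x, rfl⟩).symm
  have hv' : Function.Surjective v' := by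
    rintro ⟨⟨q, q'⟩, hq⟩
    obtain ⟨x, hx⟩ := (hv (q', q)).2 ((hu _).1 hq).symm
    refine ⟨x, Subtype.ext ?_⟩
    show (LinearEquiv.prodComm R Q' Q) (v x) = (q, q')
    rw [hx]; rfl
  have hproj : Module.Projective R (prod P' Q) := by
    show Module.Projective R (P' × Q)
    infer_instance
  obtain ⟨w, hw⟩ := surjective_lift_of_superfluous (X := prod P' Q) (Y := prod P Q')
    (Z := im u) v' u.rangeRestrict hv' u.surjective_rangeRestrict hsup
  have := hom_le_of_surjective w hw N
  rwa [hom_prod_left, hom_prod_left] at this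

lemma UPres.congr {P Q T T' : FinMod k R} {f : P →ₗ[R] Q} {g : Q →ₗ[R] T} (h : UPres U f g)
    (e : T ≃ₗ[R] T') : UPres U f (e.toLinearMap ∘ₗ g) where
  projP := h.projP
  projQ := h.projQ
  surj := e.surjective.comp h.surj
  exact := by rw [h.exact, LinearEquiv.ker_comp]
  extend := h.extend

lemma projective_pi {ι : Type} [Fintype ι] (P : ι → FinMod k R)
    (h : ∀ i, Module.Projective R (P i)) : Module.Projective R (pi P) := by
  classical
  exact Module.Projective.of_equiv (DFinsupp.linearEquivFunOnFintype (R := R) (M := fun i => P i))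

lemma UPres.pi {ι : Type} [Fintype ι] {P Q T : ι → FinMod k R} {f : ∀ i, P i →ₗ[R] Q i}
    {g : ∀ i, Q i →ₗ[R] T i} (h : ∀ i, UPres U (f i) (g i)) :
    UPres U (P := pi P) (Q := pi Q) (T := pi T) (LinearMap.pi fun i => f i ∘ₗ LinearMap.proj i)
      (LinearMap.pi fun i => g i ∘ₗ LinearMap.proj i) where
  projP := projective_pi _ fun i => (h i).projP
  projQ := projective_pi _ fun i => (h i).projQ
  surj y := by
    choose x hx using fun i => (h i).surj (y i)
    exact ⟨x, funext hx⟩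
  exact := by
    ext x
    constructor
    · rintro ⟨y, rfl⟩
      rw [LinearMap.mem_ker]
      funext i
      have : f i (y i) ∈ LinearMap.ker (g i) := (h i).exact ▸ LinearMap.mem_range_self _ _
      exact this
    · intro hx
      have : ∀ i, ∃ y, f i y = x i := fun i => by
        have : x i ∈ LinearMap.range (f i) := by
          rw [(h i).exact]
          exact congrFun (LinearMap.mem_ker.1 hx) i
        exact this
      choose y hy using this
      exact ⟨y, funext hy⟩
  extend N hN u := by
    classical
    choose u' hu' using fun i => (h i).extend N hN (u ∘ₗ LinearMap.single R (fun i => P i) i)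
    refine ⟨LinearMap.lsum R (fun i => Q i) k (M := N) u', LinearMap.pi_ext' fun i => ?_⟩
    rw [← hu']
    ext x
    simp only [LinearMap.comp_apply]
    rw [← LinearMap.lsum_piSingle R (fun i => Q i) k u' i (f i x)]
    congr 1
    funext j
    by_cases hij : j = i
    · subst hij; simp
    · simp [hij]

/-- The index of an Ext-projective module, paired with `N`. -/
def chi (U : FinMod k R → Prop) (T N : FinMod k R) : ℤ :=
  open Classical in
  if h : ∃ (P Q : FinMod k R) (f : P →ₗ[R] Q) (g : Q →ₗ[R] T), UPres U f g then
    hom h.choose_spec.choose N - hom h.choose N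
  else 0

lemma UPres.chi_eq (hs : Sincere U) {P Q T : FinMod k R} {f : P →ₗ[R] Q} {g : Q →ₗ[R] T}
    (h : UPres U f g) (N : FinMod k R) : chi U T N = hom Q N - hom P N := by
  have hex : ∃ (P Q : FinMod k R) (f : P →ₗ[R] Q) (g : Q →ₗ[R] T), UPres U f g := ⟨P, Q, f, g, h⟩
  unfold chi
  rw [dif_pos hex]
  obtain ⟨f', g', h'⟩ := hex.choose_spec.choose_spec
  have h1 := h.le_of_sincere hs h' N
  have h2 := h'.le_of_sincere hs h N
  linarith

/-- Additive functions on short exact sequences. -/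
def IsAdditive (lam : FinMod k R → ℤ) : Prop :=
  ∀ {K N L : FinMod k R} (i : K →ₗ[R] N) (p : N →ₗ[R] L), Function.Injective i →
    LinearMap.range i = LinearMap.ker p → Function.Surjective p → lam N = lam K + lam L

lemma isAdditive_hom (P : FinMod k R) [Module.Projective R P] : IsAdditive (hom P) :=
  fun i p hi hip hp => hom_exact_of_projective P i p hi hip hp

lemma IsAdditive.of_subsingleton {lam : FinMod k R → ℤ} (h : IsAdditive lam) (N : FinMod k R)
    [Subsingleton N] : lam N = 0 := by
  have := h (LinearMap.id : N →ₗ[R] N) (0 : N →ₗ[R] N) (fun _ _ h => h)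
    (by rw [LinearMap.range_id, LinearMap.ker_zero]) (fun y => ⟨0, Subsingleton.elim _ _⟩)
  linarith

lemma IsAdditive.congr {lam : FinMod k R → ℤ} (h : IsAdditive lam) {N N' : FinMod k R}
    (e : N ≃ₗ[R] N') : lam N = lam N' := by
  have := h e.toLinearMap (0 : N' →ₗ[R] zero k R) e.injective
    (by rw [LinearMap.ker_zero, LinearMap.range_eq_top.2 e.surjective])
    (fun y => ⟨0, rfl⟩)
  have h0 : lam (zero k R) = 0 := by
    have : Subsingleton (zero k R) := inferInstanceAs (Subsingleton PUnit)
    exact h.of_subsingleton _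
  linarith

section chi

variable [Module.Finite k R] (hU : IsTors U) (hs : Sincere U)
include hU hs

lemma isAdditive_chi {T : FinMod k R} (hT : ExtProj U T) : IsAdditive (chi U T) := by
  obtain ⟨P, Q, f, g, h⟩ := exists_uPres hU hT
  intro K N L i p hi hip hp
  have := h.projP
  have := h.projQ
  rw [h.chi_eq hs, h.chi_eq hs, h.chi_eq hs, isAdditive_hom P i p hi hip hp,
    isAdditive_hom Q i p hi hip hp]
  ring

lemma chi_eq_hom {T : FinMod k R} (hT : ExtProj U T) {N : FinMod k R} (hN : U N) :
    chi U T N = hom T N := by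
  obtain ⟨P, Q, f, g, h⟩ := exists_uPres hU hT
  rw [h.chi_eq hs]
  have h1 := hom_coker f g h.surj h.exact N
  have h2 : LinearMap.range (prec f N) = ⊤ := LinearMap.range_eq_top.2 fun u => h.extend N hN u
  rw [h2, finrank_top] at h1
  unfold hom at *
  linarith

lemma chi_congr {T T' : FinMod k R} (hT : ExtProj U T) (e : T ≃ₗ[R] T') (N : FinMod k R) :
    chi U T N = chi U T' N := by
  obtain ⟨P, Q, f, g, h⟩ := exists_uPres hU hT
  rw [h.chi_eq hs, (h.congr e).chi_eq hs]

lemma chi_pi {ι : Type} [Fintype ι] {T : ι → FinMod k R} (hT : ∀ i, ExtProj U (T i))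
    (N : FinMod k R) : chi U (pi T) N = ∑ i, chi U (T i) N := by
  classical
  choose P Q f g h using fun i => exists_uPres hU (hT i)
  rw [(UPres.pi h).chi_eq hs, hom_pi_left, hom_pi_left, ← Finset.sum_sub_distrib]
  exact Finset.sum_congr rfl fun i _ => ((h i).chi_eq hs N).symm

/-- The index of a projective is the difference of the indices of its coresolution. -/
lemma hom_eq_chi_sub {P T : FinMod k R} [Module.Projective R P] {a : P →ₗ[R] T}
    (ha : LeftApprox U a) (hT : ExtProj U T) (N : FinMod k R) :
    hom P N = chi U T N - chi U (quot (LinearMap.range a)) N := by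
  obtain ⟨P0, Q0, f, g, h⟩ := exists_uPres hU hT
  have := h.projP
  have := h.projQ
  obtain ⟨a', ha'⟩ := Module.projective_lifting_property g a h.surj
  have ha'' : ∀ p, g (a' p) = a p := fun p => LinearMap.congr_fun ha' p
  have hgf : ∀ p, g (f p) = 0 := fun p => by
    have : f p ∈ LinearMap.ker g := h.exact ▸ LinearMap.mem_range_self f p
    exact this
  have hcone : UPres U (P := prod P P0) (Q := Q0) (T := quot (LinearMap.range a))
      (LinearMap.coprod a' f) ((LinearMap.range a).mkQ ∘ₗ g) := by
    refine ⟨?_, h.projQ, (Submodule.mkQ_surjective _).comp h.surj, ?_, ?_⟩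
    · show Module.Projective R (P × P0)
      infer_instance
    · ext q
      constructor
      · rintro ⟨⟨p, x⟩, rfl⟩
        rw [LinearMap.mem_ker, LinearMap.comp_apply, LinearMap.coprod_apply, map_add, hgf,
          add_zero, ha'']
        exact (Submodule.Quotient.mk_eq_zero _).2 ⟨p, rfl⟩
      · intro hq
        obtain ⟨p, hp⟩ := (Submodule.Quotient.mk_eq_zero _).1 (LinearMap.mem_ker.1 hq)
        have : q - a' p ∈ LinearMap.ker g := by
          rw [LinearMap.mem_ker, map_sub, ha'', hp, sub_self]
        rw [← h.exact] at this
        obtain ⟨x, hx⟩ := this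
        exact ⟨(p, x), by simp [hx]⟩
    · intro N hN u
      obtain ⟨v, hv⟩ := h.extend N hN (u ∘ₗ LinearMap.inr R P P0)
      obtain ⟨w, hw⟩ := ha.extend N hN (u ∘ₗ LinearMap.inl R P P0 - v ∘ₗ a')
      refine ⟨v + w ∘ₗ g, ?_⟩
      refine LinearMap.prod_ext ?_ ?_
      · ext p
        have h1 : w (a p) = u (p, 0) - v (a' p) := LinearMap.congr_fun hw p
        simp [ha'', h1]
      · ext x
        have h1 : v (f x) = u (0, x) := LinearMap.congr_fun hv x
        simp [hgf, h1]
  rw [hcone.chi_eq hs, h.chi_eq hs, hom_prod_left]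
  ring

end chi

end FinMod

namespace FinMod

variable {k R : Type} [Field k] [Ring R] [Algebra k R] {U : FinMod k R → Prop}

section simples

lemma isAdditive_eq_sum_simples (N : FinMod k R) :
    ∃ (σ : Type) (_ : Fintype σ) (S : σ → FinMod k R), (∀ x, IsSimpleModule R (S x)) ∧
      ∀ lam : FinMod k R → ℤ, IsAdditive lam → lam N = ∑ x, lam (S x) := by
  induction hd : dim N using Nat.strong_induction_on generalizing N with
  | _ d ih =>
  rcases subsingleton_or_nontrivial N with h | h
  · exact ⟨Empty, inferInstance, fun x => x.elim, fun x => x.elim, fun lam hl => by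
      simpa using hl.of_subsingleton N⟩
  · obtain ⟨S, hS⟩ := IsAtomic.exists_atom (Submodule R N)
    obtain ⟨σ, _, S', hS', hsum⟩ := ih _ (hd ▸ dim_quot_lt hS.1) (quot S) rfl
    refine ⟨Option σ, inferInstance, fun x => x.elim (sub S) S', ?_, fun lam hl => ?_⟩
    · rintro (_ | x)
      · exact isSimpleModule_iff_isAtom.2 hS
      · exact hS' x
    · rw [Fintype.sum_option]
      have := hl (K := sub S) (N := N) (L := quot S) S.subtype S.mkQ S.injective_subtype
        (by rw [Submodule.range_subtype, Submodule.ker_mkQ]) S.mkQ_surjective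
      rw [this, hsum lam hl]
      rfl

lemma exists_cover_simple [Module.Finite k R] (S : FinMod k R) [IsSimpleModule R S] :
    ∃ P : FinMod k R, Module.Projective R P ∧ 0 < hom P S ∧
      ∀ S' : FinMod k R, IsSimpleModule R S' → IsEmpty (S ≃ₗ[R] S') → hom P S' = 0 := by
  obtain ⟨P, g, hP, hg, hs⟩ := exists_projective_cover S
  refine ⟨P, hP, hom_pos (f := g) ?_, fun S' hS' he => hom_eq_zero fun f => ?_⟩
  · rintro rfl
    have := IsSimpleModule.nontrivial R S
    obtain ⟨x, hx⟩ := exists_ne (0 : S)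
    obtain ⟨y, hy⟩ := hg x
    exact hx hy.symm
  · by_contra hf
    have hfs : Function.Surjective f := LinearMap.surjective_of_ne_zero hf
    have hne : LinearMap.ker f ≠ ⊤ := fun h => hf (LinearMap.ker_eq_top.1 h)
    have hcoatom : IsCoatom (LinearMap.ker g) := by
      rw [← isSimpleModule_iff_isCoatom]
      exact IsSimpleModule.congr (g.quotKerEquivOfSurjective hg)
    have hcoatom' : IsCoatom (LinearMap.ker f) := by
      rw [← isSimpleModule_iff_isCoatom]
      exact IsSimpleModule.congr (f.quotKerEquivOfSurjective hfs)
    have hle : LinearMap.ker g = LinearMap.ker f := by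
      by_contra hne'
      apply hne
      apply hs
      exact hcoatom.sup_eq_top_of_ne hcoatom' hne'
    exact he.false ((g.quotKerEquivOfSurjective hg).symm.trans
      ((Submodule.quotEquivOfEq _ _ hle).trans (f.quotKerEquivOfSurjective hfs)))

/-- A complete irredundant list of simple modules. -/
structure SimpleFam {σ : Type} (S : σ → FinMod k R) : Prop where
  simple : ∀ x, IsSimpleModule R (S x)
  inj : ∀ x y, Nonempty (S x ≃ₗ[R] S y) → x = y
  complete : ∀ T : FinMod k R, IsSimpleModule R T → ∃ x, Nonempty (T ≃ₗ[R] S x)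

lemma exists_simpleFam (k R : Type) [Field k] [Ring R] [Algebra k R] [Module.Finite k R] :
    ∃ (n : ℕ) (S : Fin n → FinMod k R), SimpleFam S := by
  classical
  obtain ⟨σ, _, S, hS, hsum⟩ := isAdditive_eq_sum_simples (reg k R)
  let r : Setoid σ := ⟨fun x y => Nonempty (S x ≃ₗ[R] S y), fun x => ⟨LinearEquiv.refl _ _⟩,
    fun ⟨e⟩ => ⟨e.symm⟩, fun ⟨e⟩ ⟨e'⟩ => ⟨e.trans e'⟩⟩
  have hfin : Finite (Quotient r) := inferInstance
  obtain ⟨n, ⟨e⟩⟩ := Finite.exists_equiv_fin (Quotient r)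
  refine ⟨n, fun i => S (e.symm i).out, fun i => hS _, fun i j h => ?_, fun T hT => ?_⟩
  · have : (⟦(e.symm i).out⟧ : Quotient r) = ⟦(e.symm j).out⟧ := Quotient.sound h
    rw [Quotient.out_eq, Quotient.out_eq] at this
    exact e.symm.injective this
  · obtain ⟨P, hP, hpos, hz⟩ := exists_cover_simple T
    have h0 : 0 < hom P (reg k R) := by
      obtain ⟨f, hf⟩ : ∃ f : P →ₗ[R] T, f ≠ 0 := by
        by_contra hne
        push Not at hne
        exact hpos.ne' (hom_eq_zero hne)
      have := IsSimpleModule.nontrivial R T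
      obtain ⟨t, ht⟩ := exists_ne (0 : T)
      have hs : Function.Surjective (LinearMap.toSpanSingleton R T t) := by
        rw [← LinearMap.range_eq_top, LinearMap.range_toSpanSingleton]
        exact IsSimpleModule.span_singleton_eq_top R ht
      obtain ⟨f', hf'⟩ := Module.projective_lifting_property
        (LinearMap.toSpanSingleton R T t) f hs
      refine hom_pos (N := reg k R) (f := f') ?_
      rintro rfl
      exact hf (by rw [← hf', LinearMap.comp_zero])
    rw [hsum _ (isAdditive_hom P)] at h0
    obtain ⟨x, -, hx⟩ := Finset.exists_ne_zero_of_sum_ne_zero h0.ne'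
    have hx' : Nonempty (T ≃ₗ[R] S x) := by
      by_contra hne
      exact hx (hz _ (hS x) (not_nonempty_iff.1 hne))
    refine ⟨e ⟦x⟧, ?_⟩
    rw [Equiv.symm_apply_apply]
    obtain ⟨e₁⟩ := hx'
    have : r (⟦x⟧ : Quotient r).out x := Quotient.exact (Quotient.out_eq _)
    obtain ⟨e₂⟩ := this
    exact ⟨e₁.trans e₂.symm⟩

lemma SimpleFam.exists_mult {σ : Type} [Fintype σ] {S : σ → FinMod k R} (hS : SimpleFam S)
    (N : FinMod k R) : ∃ m : σ → ℤ, ∀ lam : FinMod k R → ℤ, IsAdditive lam →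
      lam N = ∑ l, m l * lam (S l) := by
  classical
  obtain ⟨τ, _, S', hS', hsum⟩ := isAdditive_eq_sum_simples N
  choose c hc using fun x => hS.complete (S' x) (hS' x)
  refine ⟨fun l => ∑ x, if c x = l then 1 else 0, fun lam hl => ?_⟩
  rw [hsum lam hl]
  simp_rw [Finset.sum_mul]
  rw [Finset.sum_comm]
  refine Finset.sum_congr rfl fun x _ => ?_
  obtain ⟨e⟩ := hc x
  simp [hl.congr e]

end simples

section approx

/-- The trace of `X` in `K` is the largest submodule in the torsion class generated by `X`. -/
lemma exists_trace {X : FinMod k R} (hU : IsTors U) (hX : ∀ N, U N ↔ Fac X N)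
    (K : FinMod k R) :
    ∃ t : Submodule R K, U (sub t) ∧ ∀ N, U N → ∀ h : N →ₗ[R] K, LinearMap.range h ≤ t := by
  classical
  obtain ⟨r, f, hf⟩ := exists_universal_left X K
  let F : pi (fun _ : Fin r => X) →ₗ[R] K := LinearMap.lsum R (fun _ : Fin r => X) k (M := K) f
  have hF : ∀ h : X →ₗ[R] K, LinearMap.range h ≤ LinearMap.range F := by
    rintro h _ ⟨x, rfl⟩
    obtain ⟨c, rfl⟩ := hf h
    refine ⟨fun i => c i • x, ?_⟩
    simp [F, LinearMap.lsum_apply, LinearMap.sum_apply]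
  refine ⟨LinearMap.range F, ?_, fun N hN h => ?_⟩
  · exact hU.quot (N := im F) F.rangeRestrict F.surjective_rangeRestrict
      (hU.pi _ fun _ => (hX X).2 (fac_self X))
  · obtain ⟨s, q, hq⟩ := (hX N).1 hN
    rintro _ ⟨x, rfl⟩
    obtain ⟨y, rfl⟩ := hq x
    rw [← LinearMap.sum_single_apply (fun _ : Fin s => X) y, map_sum, map_sum]
    refine Submodule.sum_mem _ fun i _ => ?_
    exact hF (h ∘ₗ q ∘ₗ LinearMap.single R (fun _ : Fin s => X) i) ⟨y i, rfl⟩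

lemma hom_sub_eq {M K : FinMod k R} (t : Submodule R K)
    (h : ∀ f : M →ₗ[R] K, LinearMap.range f ≤ t) : hom M (sub t) = hom M K := by
  have h1 := hom_ker M (K := sub t) (N := K) (L := quot t) t.subtype t.mkQ t.injective_subtype
    (by rw [Submodule.range_subtype, Submodule.ker_mkQ])
  have h2 : LinearMap.range (postc M (N := K) (N' := quot t) t.mkQ) = ⊥ := by
    rw [eq_bot_iff]
    rintro _ ⟨f, rfl⟩
    rw [Submodule.mem_bot]
    ext x
    exact (Submodule.Quotient.mk_eq_zero _).2 (h f ⟨x, rfl⟩)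
  rw [h2, finrank_bot] at h1
  simpa using h1

/-- Approximation by a family with prescribed, composition-closed spaces of maps. -/
lemma exists_approx_ideal {ι : Type} [Fintype ι] {M : ι → FinMod k R} (hU : IsTors U)
    (hM : ∀ i, U (M i)) {N : FinMod k R} (W : ∀ i, Submodule k (M i →ₗ[R] N))
    (hW : ∀ i j (w : M i →ₗ[R] N) (h : M j →ₗ[R] M i), w ∈ W i → w ∘ₗ h ∈ W j) :
    ∃ (Y : FinMod k R) (φ : Y →ₗ[R] N), U Y ∧
      ∀ i, LinearMap.range (postc (M i) φ) = W i := by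
  classical
  let b := fun i => Module.finBasis k (W i)
  let I := Σ i, Fin (Module.finrank k (W i))
  let Y : FinMod k R := pi (fun x : I => M x.1)
  let φ : Y →ₗ[R] N := LinearMap.lsum R (fun x : I => M x.1) k (M := N) fun x => (b x.1 x.2 : _)
  refine ⟨Y, φ, hU.pi _ fun x => hM _, fun i => le_antisymm ?_ ?_⟩
  · rintro _ ⟨h, rfl⟩
    have : postc (M i) φ h = ∑ x : I, ((b x.1 x.2 : W x.1) : M x.1 →ₗ[R] N) ∘ₗ
        (LinearMap.proj x ∘ₗ h) := by
      ext y
      simp [φ, LinearMap.lsum_apply, LinearMap.sum_apply]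
    rw [this]
    exact Submodule.sum_mem _ fun x _ => hW _ _ _ _ (b x.1 x.2).2
  · intro w hw
    have hw' := (b i).sum_repr ⟨w, hw⟩
    have hf : ∃ f : ∀ x : I, M i →ₗ[R] M x.1,
        (∀ x, f ⟨i, x⟩ = smulHom ((b i).repr ⟨w, hw⟩ x) (M i)) ∧ ∀ x, x.1 ≠ i → f x = 0 := by
      refine ⟨fun x => if h : x.1 = i then ?_ else 0, fun x => ?_, fun x hx => dif_neg hx⟩
      · obtain ⟨j, x⟩ := x
        obtain rfl : i = j := h.symm
        exact smulHom ((b i).repr ⟨w, hw⟩ x) (M i)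
      · exact dif_pos rfl
    obtain ⟨f, hf, hf'⟩ := hf
    refine ⟨LinearMap.pi f, ?_⟩
    have hw'' := congrArg Subtype.val hw'
    refine Eq.trans ?_ hw''
    ext y
    simp only [postc_apply, LinearMap.comp_apply, φ, LinearMap.lsum_apply, LinearMap.sum_apply,
      Submodule.coe_sum]
    rw [Fintype.sum_sigma, Finset.sum_eq_single i]
    · refine Finset.sum_congr rfl fun x _ => ?_
      change (b i x).1 (f ⟨i, x⟩ y) = _
      rw [hf]
      simp [LinearMap.map_smul_of_tower]
    · intro j _ hj
      refine Finset.sum_eq_zero fun x _ => ?_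
      change (b j x).1 (f ⟨j, x⟩ y) = _
      rw [hf' _ hj]
      simp
    · simp

end approx

/-- A family of pairwise non-isomorphic indecomposable Ext-projectives of a torsion class. -/
structure ExtFam (U : FinMod k R → Prop) {ι : Type} (M : ι → FinMod k R) : Prop where
  indec : ∀ i, Indec (M i)
  mem : ∀ i, U (M i)
  ext : ∀ i, ExtProj U (M i)
  inj : ∀ i j, Nonempty (M i ≃ₗ[R] M j) → i = j

/-- The family exhausts the indecomposable Ext-projectives. -/
def ExtFam.Complete (U : FinMod k R → Prop) {ι : Type} (M : ι → FinMod k R) : Prop :=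
  ∀ L, Indec L → U L → ExtProj U L → ∃ i, Nonempty (L ≃ₗ[R] M i)

lemma card_le_of_mul_eq_diagonal {σ ι : Type} [Fintype σ] [Fintype ι] [DecidableEq σ]
    (A : Matrix σ ι ℤ) (X : Matrix ι σ ℤ) (d : σ → ℤ) (hd : ∀ l, d l ≠ 0)
    (h : A * X = Matrix.diagonal d) : Fintype.card σ ≤ Fintype.card ι := by
  have hinj : Function.Injective X.mulVecLin := by
    rw [← LinearMap.ker_eq_bot, eq_bot_iff]
    intro v hv
    have h1 : X.mulVec v = 0 := hv
    have h2 : (A * X).mulVec v = 0 := by rw [← Matrix.mulVec_mulVec, h1, Matrix.mulVec_zero]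
    rw [h] at h2
    rw [Submodule.mem_bot]
    funext l
    have := congrFun h2 l
    rw [Matrix.mulVec_diagonal] at this
    exact (mul_eq_zero.1 this).resolve_left (hd l)
  have := LinearMap.finrank_le_finrank_of_injective hinj
  simpa using this

section counting

variable [Module.Finite k R] (hU : IsTors U) (hs : Sincere U)
include hU hs

lemma ExtFam.card_le {X : FinMod k R} (hX : ∀ N, U N ↔ Fac X N) {ι σ : Type} [Fintype ι]
    [Fintype σ] {M : ι → FinMod k R} (hM : ExtFam U M) {S : σ → FinMod k R} (hS : SimpleFam S) :
    Fintype.card ι ≤ Fintype.card σ := by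
  classical
  have key : ∀ j, ∃ (c : σ → ℤ) (d : ℤ), d ≠ 0 ∧ ∀ i,
      ∑ l, c l * chi U (M i) (S l) = if j = i then d else 0 := by
    intro j
    let W : ∀ i, Submodule k (M i →ₗ[R] M j) := fun i => rad (hM.indec i)
    obtain ⟨Y, φ, hY, hφ⟩ := exists_approx_ideal hU hM.mem W (by
      intro i l w h hw hb
      exact hw (Indec.bijective_of_comp (hM.indec l).1 (hM.indec i) h w hb).2)
    obtain ⟨t, ht, htm⟩ := exists_trace hU hX (ker φ)
    obtain ⟨m₁, h₁⟩ := hS.exists_mult (M j)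
    obtain ⟨m₂, h₂⟩ := hS.exists_mult Y
    obtain ⟨m₃, h₃⟩ := hS.exists_mult (sub t)
    have hval : ∀ i, ∑ l, (m₁ l - m₂ l + m₃ l) * chi U (M i) (S l) =
        hom (M i) (M j) - Module.finrank k (W i) := by
      intro i
      have hadd : IsAdditive (chi U (M i)) := isAdditive_chi hU hs (hM.ext i)
      have e₁ := h₁ _ hadd
      have e₂ := h₂ _ hadd
      have e₃ := h₃ _ hadd
      rw [chi_eq_hom hU hs (hM.ext i) (hM.mem j)] at e₁
      rw [chi_eq_hom hU hs (hM.ext i) hY] at e₂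
      rw [chi_eq_hom hU hs (hM.ext i) ht, hom_sub_eq t (htm _ (hM.mem i))] at e₃
      have e₄ := hom_ker (M i) (K := ker φ) (LinearMap.ker φ).subtype φ
        (Submodule.injective_subtype _) (Submodule.range_subtype _)
      rw [hφ] at e₄
      simp_rw [add_mul, sub_mul]
      rw [Finset.sum_add_distrib, Finset.sum_sub_distrib, ← e₁, ← e₂, ← e₃]
      linarith
    refine ⟨fun l => m₁ l - m₂ l + m₃ l, hom (M j) (M j) - Module.finrank k (W j), ?_, ?_⟩
    · have : W j ≠ ⊤ := by
        intro h
        have : (LinearMap.id : M j →ₗ[R] M j) ∈ W j := h ▸ Submodule.mem_top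
        exact this Function.bijective_id
      have := Submodule.finrank_lt this
      unfold hom
      omega
    · intro i
      rw [hval]
      split_ifs with h
      · subst h; rfl
      · have : W i = ⊤ := by
          rw [eq_top_iff]
          intro f _ hf
          exact h (hM.inj i j ⟨LinearEquiv.ofBijective f hf⟩).symm
        rw [this, finrank_top]
        simp [hom]
  choose c d hd hc using key
  refine card_le_of_mul_eq_diagonal (Matrix.of c) (Matrix.of fun l i => chi U (M i) (S l)) d hd ?_
  ext j i
  rw [Matrix.mul_apply, Matrix.diagonal_apply]
  simpa using hc j i

lemma ExtFam.chi_eq_sum {ι : Type} [Fintype ι] {M : ι → FinMod k R} (_ : ExtFam U M)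
    (hc : ExtFam.Complete U M) {T : FinMod k R} (hT : ExtProj U T) (hTU : U T) :
    ∃ b : ι → ℤ, ∀ N, chi U T N = ∑ i, b i * chi U (M i) N := by
  classical
  obtain ⟨κ, _, L, hL, ⟨e⟩⟩ := exists_decomposition T
  have hLU : ∀ x, U (L x) := fun x =>
    hU.quot (N := L x) (LinearMap.proj x ∘ₗ e.toLinearMap)
      (fun z => ⟨e.symm (Pi.single x z), by simp⟩) hTU
  have hLE : ∀ x, ExtProj U (L x) := fun x =>
    hT.of_retract (e.symm.toLinearMap ∘ₗ LinearMap.single R (fun x => L x) x)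
      (LinearMap.proj x ∘ₗ e.toLinearMap) (by ext y; simp)
  choose c hc' using fun x => hc (L x) (hL x) (hLU x) (hLE x)
  refine ⟨fun l => ∑ x, if c x = l then 1 else 0, fun N => ?_⟩
  rw [chi_congr hU hs hT e, chi_pi hU hs hLE]
  simp_rw [Finset.sum_mul]
  rw [Finset.sum_comm]
  refine Finset.sum_congr rfl fun x _ => ?_
  obtain ⟨e'⟩ := hc' x
  simp [chi_congr hU hs (hLE x) e']

lemma ExtFam.hom_eq_sum {X : FinMod k R} (hX : ∀ N, U N ↔ Fac X N) {ι : Type} [Fintype ι]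
    {M : ι → FinMod k R} (hM : ExtFam U M) (hc : ExtFam.Complete U M) (P : FinMod k R)
    [Module.Projective R P] : ∃ b : ι → ℤ, ∀ N, hom P N = ∑ i, b i * chi U (M i) N := by
  obtain ⟨T, a, ha, hmin⟩ := exists_leftApprox hU hX P
  have hT := ha.extProj hU hmin
  have hT1 := ha.extProj_coker hT
  obtain ⟨b, hb⟩ := hM.chi_eq_sum hU hs hc hT ha.mem
  obtain ⟨b', hb'⟩ := hM.chi_eq_sum hU hs hc hT1
    (hU.quot (N := quot (LinearMap.range a)) _ (Submodule.mkQ_surjective _) ha.mem)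
  refine ⟨fun i => b i - b' i, fun N => ?_⟩
  rw [hom_eq_chi_sub hU hs ha hT, hb, hb', ← Finset.sum_sub_distrib]
  exact Finset.sum_congr rfl fun i _ => (sub_mul _ _ _).symm

lemma ExtFam.le_card {X : FinMod k R} (hX : ∀ N, U N ↔ Fac X N) {ι σ : Type} [Fintype ι]
    [Fintype σ] {M : ι → FinMod k R} (hM : ExtFam U M) (hc : ExtFam.Complete U M)
    {S : σ → FinMod k R} (hS : SimpleFam S) : Fintype.card σ ≤ Fintype.card ι := by
  classical
  choose P hP hpos hz using fun l => @exists_cover_simple k R _ _ _ _ (S l) (hS.simple l)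
  choose b hb using fun l => hM.hom_eq_sum hU hs hX hc (P l)
  refine card_le_of_mul_eq_diagonal (Matrix.of b) (Matrix.of fun i l => chi U (M i) (S l))
    (fun l => hom (P l) (S l)) (fun l => (hpos l).ne') ?_
  ext l m
  rw [Matrix.mul_apply, Matrix.diagonal_apply]
  simp only [Matrix.of_apply]
  rw [← hb]
  split_ifs with h
  · rw [h]
  · exact hz _ _ (hS.simple m) (not_nonempty_iff.1 fun h' => h (hS.inj _ _ h'))

/-- Modules on which all indices agree with zero vanish. -/
lemma ExtFam.subsingleton_of_chi {X : FinMod k R} (hX : ∀ N, U N ↔ Fac X N) {ι : Type} [Fintype ι]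
    {M : ι → FinMod k R} (hM : ExtFam U M) (hc : ExtFam.Complete U M) (N : FinMod k R)
    (hN : ∀ i, chi U (M i) N = 0) : Subsingleton N := by
  have : Module.Projective R (reg k R) := inferInstanceAs (Module.Projective R R)
  obtain ⟨b, hb⟩ := hM.hom_eq_sum hU hs hX hc (reg k R)
  have h0 : hom (reg k R) N = 0 := by rw [hb]; simp [hN]
  refine subsingleton_of_forall_eq 0 fun x => ?_
  have := eq_zero_of_hom h0 (LinearMap.toSpanSingleton R N x)
  simpa using LinearMap.congr_fun this (1 : R)

/-- Complete families of indecomposable Ext-projectives exist, and have as many members as there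
are simple modules. -/
lemma exists_extFam {X : FinMod k R} (hX : ∀ N, U N ↔ Fac X N) {n : ℕ} {S : Fin n → FinMod k R}
    (hS : SimpleFam S) : ∃ M : Fin n → FinMod k R, ExtFam U M ∧ ExtFam.Complete U M := by
  classical
  have hex : ∃ m, m ≤ n ∧ ∃ M : Fin m → FinMod k R, ExtFam U M := by
    exact ⟨0, Nat.zero_le _, fun i => i.elim0, fun i => i.elim0, fun i => i.elim0,
      fun i => i.elim0, fun i => i.elim0⟩
  let p : ℕ → Prop := fun m => ∃ M : Fin m → FinMod k R, ExtFam U M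
  obtain ⟨m₀, hm₀, hp₀⟩ := hex
  have hmax := Nat.findGreatest_spec (P := p) hm₀ hp₀
  have hle := Nat.findGreatest_le (P := p) n
  have hgr := fun j => Nat.findGreatest_is_greatest (P := p) (n := n) (k := j)
  generalize Nat.findGreatest p n = m at *
  obtain ⟨M, hM⟩ := hmax
  have hcomp : ExtFam.Complete U M := by
    intro L hL hLU hLE
    by_contra hne
    have hfam : ExtFam U (Fin.cons L M : Fin (m + 1) → FinMod k R) := by
      refine ⟨fun i => ?_, fun i => ?_, fun i => ?_, fun i j => ?_⟩
      · refine Fin.cases hL hM.indec i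
      · refine Fin.cases hLU hM.mem i
      · refine Fin.cases hLE hM.ext i
      · refine Fin.cases ?_ (fun i => ?_) i <;> refine Fin.cases ?_ (fun j => ?_) j
        · exact fun _ => rfl
        · intro h
          exact absurd ⟨j, h⟩ hne
        · rintro ⟨e⟩
          exact absurd ⟨i, ⟨e.symm⟩⟩ hne
        · intro h
          exact congrArg Fin.succ (hM.inj i j h)
    have h1 := hfam.card_le hU hs hX hS
    simp only [Fintype.card_fin] at h1
    exact hgr (m + 1) (Nat.lt_succ_self m) h1 ⟨_, hfam⟩
  have h2 := hM.le_card hU hs hX hcomp hS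
  simp only [Fintype.card_fin] at h2
  obtain rfl : m = n := le_antisymm hle h2
  exact ⟨M, hM, hcomp⟩

/-- The complete family generates the torsion class. -/
lemma ExtFam.fac_iff {X : FinMod k R} (hX : ∀ N, U N ↔ Fac X N) {ι : Type} [Fintype ι]
    {M : ι → FinMod k R} (hM : ExtFam U M) (hc : ExtFam.Complete U M) (N : FinMod k R) :
    U N ↔ Fac (pi M) N := by
  classical
  refine ⟨fun hN => ?_, fun h => hU.of_fac (hU.pi _ hM.mem) h⟩
  have : Module.Projective R (reg k R) := inferInstanceAs (Module.Projective R R)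
  obtain ⟨T, a, ha, hmin⟩ := exists_leftApprox hU hX (reg k R)
  obtain ⟨κ, _, L, hL, ⟨e⟩⟩ := exists_decomposition T
  refine fac_of_iSup ?_
  rw [eq_top_iff]
  rintro x -
  obtain ⟨h', hh'⟩ := ha.extend N hN (LinearMap.toSpanSingleton R N x)
  have hx : h' (a (1 : R)) = x := by simpa using LinearMap.congr_fun hh' (1 : R)
  have hsum := LinearMap.sum_single_apply (fun y => L y) (e (a (1 : R)))
  rw [← hx, ← e.symm_apply_apply (a (1 : R)), ← hsum, map_sum, map_sum]
  refine Submodule.sum_mem _ fun y _ => ?_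
  have hLU : U (L y) := hU.quot (N := L y) (LinearMap.proj y ∘ₗ e.toLinearMap)
      (fun z => ⟨e.symm (Pi.single y z), by simp⟩) ha.mem
  have hLE : ExtProj U (L y) := (ha.extProj hU hmin).of_retract
    (e.symm.toLinearMap ∘ₗ LinearMap.single R (fun x => L x) y)
      (LinearMap.proj y ∘ₗ e.toLinearMap) (by ext y; simp)
  obtain ⟨i, ⟨ei⟩⟩ := hc _ (hL y) hLU hLE
  refine Submodule.mem_iSup_of_mem (h' ∘ₗ e.symm.toLinearMap ∘ₗ
    LinearMap.single R (fun x => L x) y ∘ₗ ei.symm.toLinearMap ∘ₗ LinearMap.proj i) ?_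
  refine ⟨Pi.single i (ei (e (a (1 : R)) y)), ?_⟩
  simp

end counting

end FinMod

namespace FinMod

variable {k R : Type} [Field k] [Ring R] [Algebra k R] {U : FinMod k R → Prop}

lemma Fac.exists_comp_ne {ι : Type} [Fintype ι] {M : ι → FinMod k R} {N L : FinMod k R}
    (h : Fac (FinMod.pi M) N) {f : N →ₗ[R] L} (hf : f ≠ 0) :
    ∃ (i : ι) (g : M i →ₗ[R] N), f ∘ₗ g ≠ 0 := by
  classical
  by_contra! hne
  obtain ⟨s, q, hq⟩ := h
  have h0 : f ∘ₗ q = 0 := by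
    refine LinearMap.pi_ext' fun a => ?_
    exact LinearMap.pi_ext' (φ := fun i => M i) fun i =>
      hne i (q ∘ₗ LinearMap.single R (fun _ : Fin s => FinMod.pi M) a ∘ₗ
        LinearMap.single R (fun i => M i) i)
  refine hf (LinearMap.ext fun x => ?_)
  obtain ⟨y, rfl⟩ := hq x
  exact LinearMap.congr_fun h0 y

/-- Right approximations by a single module exist. -/
lemma exists_rightApprox (X N : FinMod k R) :
    ∃ (r : ℕ) (F : pi (fun _ : Fin r => X) →ₗ[R] N), ∀ h : X →ₗ[R] N,
      ∃ h' : X →ₗ[R] pi (fun _ : Fin r => X), F ∘ₗ h' = h := by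
  classical
  obtain ⟨r, f, hf⟩ := exists_universal_left X N
  refine ⟨r, LinearMap.lsum R (fun _ : Fin r => X) k (M := N) f, fun h => ?_⟩
  obtain ⟨c, rfl⟩ := hf h
  refine ⟨LinearMap.pi fun i => smulHom (c i) X, ?_⟩
  ext x
  simp [LinearMap.lsum_apply, LinearMap.sum_apply, LinearMap.map_smul_of_tower]

/-- Every module has a largest submodule in a given torsion class. -/
lemma exists_max_torsion (hU : IsTors U) (N : FinMod k R) :
    ∃ t : Submodule R N, U (sub t) ∧ (∀ L, U L → ∀ h : L →ₗ[R] N, LinearMap.range h ≤ t) ∧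
      ∀ L, U L → ∀ h : L →ₗ[R] quot t, h = 0 := by
  obtain ⟨t, ht, hmax⟩ := set_has_maximal_iff_noetherian.2 (inferInstance : IsNoetherian R N)
    {t : Submodule R N | U (sub t)} ⟨⊥, hU.zero _ inferInstance⟩
  have hle : ∀ L, U L → ∀ h : L →ₗ[R] N, LinearMap.range h ≤ t := by
    intro L hL h
    have hsup : U (sub (LinearMap.range h ⊔ t)) := by
      let F : prod L (sub t) →ₗ[R] N := LinearMap.coprod h t.subtype
      have hF : LinearMap.range F = LinearMap.range h ⊔ t := by
        rw [LinearMap.range_coprod, Submodule.range_subtype]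
      rw [← hF]
      exact hU.quot (N := im F) F.rangeRestrict F.surjective_rangeRestrict (hU.prod hL ht)
    have h1 := hmax _ hsup
    exact le_sup_left.trans (not_lt_iff_le_imp_ge.1 h1 le_sup_right)
  refine ⟨t, ht, hle, fun L hL h => ?_⟩
  let P : Submodule R N := (LinearMap.range h).comap t.mkQ
  have hP : U (sub P) := by
    have htP : t ≤ P := fun x hx => by
      refine ⟨0, ?_⟩
      rw [map_zero]
      exact ((Submodule.Quotient.mk_eq_zero t).2 hx).symm
    refine hU.ext' (M := sub P) (N := im h) (K := sub t) (Submodule.inclusion htP)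
      ((t.mkQ ∘ₗ P.subtype).codRestrict _ fun x => x.2) ?_ ?_ ht
      (hU.quot (N := im h) h.rangeRestrict h.surjective_rangeRestrict hL)
    · rintro ⟨y, hy⟩
      obtain ⟨x, rfl⟩ := t.mkQ_surjective y
      exact ⟨⟨x, hy⟩, rfl⟩
    · rw [Submodule.range_inclusion]
      ext x
      rw [LinearMap.mem_ker, Subtype.ext_iff]
      exact (Submodule.Quotient.mk_eq_zero t).symm
  have hPt : P ≤ t := by simpa using hle _ hP P.subtype
  refine LinearMap.ext fun y => ?_
  obtain ⟨x, hx⟩ := t.mkQ_surjective (h y)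
  have : x ∈ P := ⟨y, hx.symm⟩
  rw [← hx]
  exact (Submodule.Quotient.mk_eq_zero t).2 (hPt this)

section below

variable [Module.Finite k R] (hU : IsTors U) (hs : Sincere U)
include hU

/-- Data of the quotients of the generators by the images of their radical maps. -/
lemma exists_radical_images {ι : Type} [Fintype ι] {M : ι → FinMod k R} (hM : ExtFam U M) :
    ∀ j, ∃ (Y : FinMod k R) (φ : Y →ₗ[R] M j), U Y ∧
      ∀ i (h : M i →ₗ[R] M j), ¬ Function.Bijective h ↔ ∃ g, φ ∘ₗ g = h := by
  intro j
  obtain ⟨Y, φ, hY, hφ⟩ := exists_approx_ideal hU hM.mem (N := M j)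
    (fun i => rad (hM.indec i)) (by
      intro i l w h hw hb
      exact hw (Indec.bijective_of_comp (hM.indec l).1 (hM.indec i) h w hb).2)
  refine ⟨Y, φ, hY, fun i h => ?_⟩
  rw [← mem_rad (hM.indec i), ← hφ i]
  rfl

include hs in
/-- Some radical quotient lies outside a given smaller torsion class. -/
lemma exists_radical_quotient_notMem {X : FinMod k R} (hX : ∀ N, U N ↔ Fac X N) {ι : Type}
    [Fintype ι] {M : ι → FinMod k R} (hM : ExtFam U M) (hc : ExtFam.Complete U M)
    {Y : ι → FinMod k R} {φ : ∀ j, Y j →ₗ[R] M j} (hY : ∀ j, U (Y j))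
    (hφ : ∀ j i (h : M i →ₗ[R] M j), ¬ Function.Bijective h ↔ ∃ g, φ j ∘ₗ g = h)
    {T : FinMod k R → Prop} (hT : IsTors T) (hne : ∃ N, U N ∧ ¬ T N) :
    ∃ j, ¬ T (quot (LinearMap.range (φ j))) := by
  classical
  by_contra! hall
  obtain ⟨N', hN', hTN'⟩ := hne
  obtain ⟨t, ht, -, hzero⟩ := exists_max_torsion hT N'
  let N := quot t
  have hN : U N := hU.quot (N := N) t.mkQ t.mkQ_surjective hN'
  have hid : (LinearMap.id : N →ₗ[R] N) ≠ 0 := by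
    intro h0
    refine hTN' ?_
    have htop : t = ⊤ := by
      rw [eq_top_iff]
      intro x _
      exact (Submodule.Quotient.mk_eq_zero t).1 (LinearMap.congr_fun h0 (t.mkQ x))
    subst htop
    exact hT.quot (M := sub (⊤ : Submodule R N')) (N := N') (⊤ : Submodule R N').subtype (fun x => ⟨⟨x, trivial⟩, rfl⟩) ht
  let m : (Σ i, {g : M i →ₗ[R] N // g ≠ 0}) → ℕ := fun x =>
    Module.finrank k (LinearMap.range (postc (pi M) x.2.1))
  have hfac := fun L hL => (hM.fac_iff hU hs hX hc L).1 hL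
  obtain ⟨i₀, g₀, hg₀⟩ := (hfac N hN).exists_comp_ne hid
  have hg₀' : g₀ ≠ 0 := by simpa using hg₀
  obtain ⟨⟨i, g, hg⟩, hmin⟩ := (measure m).wf.has_min Set.univ ⟨⟨i₀, g₀, hg₀'⟩, trivial⟩
  have hgφ : g ∘ₗ φ i ≠ 0 := by
    intro h0
    have hle : LinearMap.range (φ i) ≤ LinearMap.ker g := by
      rintro _ ⟨y, rfl⟩
      exact LinearMap.congr_fun h0 y
    have hz := hzero _ (hall i) ((LinearMap.range (φ i)).liftQ g hle)
    refine hg (LinearMap.ext fun x => ?_)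
    exact LinearMap.congr_fun hz ((LinearMap.range (φ i)).mkQ x)
  obtain ⟨l, h₀, hh₀⟩ := (hfac _ (hY i)).exists_comp_ne hgφ
  let h := φ i ∘ₗ h₀
  have hh : ¬ Function.Bijective h := (hφ i l h).2 ⟨h₀, rfl⟩
  have hle : LinearMap.range (postc (pi M) (g ∘ₗ h)) ≤ LinearMap.range (postc (pi M) g) := by
    rintro _ ⟨f, rfl⟩
    exact ⟨h ∘ₗ f, rfl⟩
  have hfin : ¬ m ⟨l, g ∘ₗ h, hh₀⟩ < m ⟨i, g, hg⟩ := hmin.2 _ trivial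
  have heq := Submodule.eq_of_le_of_finrank_le hle (not_lt.1 hfin)
  have hmem : g ∘ₗ LinearMap.proj i ∈ LinearMap.range (postc (pi M) g) := ⟨LinearMap.proj i, rfl⟩
  rw [← heq] at hmem
  obtain ⟨u', hu'⟩ := hmem
  let u : M i →ₗ[R] M l := u' ∘ₗ LinearMap.single R (fun x => M x) i
  have hgu : g ∘ₗ (h ∘ₗ u) = g := by
    ext x
    have : g (h (u' (Pi.single i x))) = g ((Pi.single i x : ∀ a, M a) i) :=
      LinearMap.congr_fun hu' (Pi.single i x)
    simpa [u] using this
  rcases (hM.indec i).2 (h ∘ₗ u) with ⟨n, hn⟩ | hb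
  · have hpow : ∀ n, g ∘ₗ ((h ∘ₗ u : M i →ₗ[R] M i) ^ n) = g := by
      intro n
      induction n with
      | zero => rfl
      | succ n ih =>
        rw [pow_succ, Module.End.mul_eq_comp, ← LinearMap.comp_assoc, ih, hgu]
    refine hg ?_
    rw [← hpow n, hn, LinearMap.comp_zero]
  · exact hh (Indec.bijective_of_comp (hM.indec i).1 (hM.indec l) u h hb).2

/-- Maps to a radical quotient from members of the torsion class are zero or surjective. -/
lemma radical_quotient_brick {ι : Type} {M : ι → FinMod k R} (hM : ExtFam U M)
    {Y : ι → FinMod k R} {φ : ∀ j, Y j →ₗ[R] M j} (hY : ∀ j, U (Y j))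
    (hφ : ∀ j i (h : M i →ₗ[R] M j), ¬ Function.Bijective h ↔ ∃ g, φ j ∘ₗ g = h)
    {i j : ι} (f : M i →ₗ[R] quot (LinearMap.range (φ j))) (hf : f ≠ 0) :
    i = j ∧ Function.Surjective f := by
  have hker : U (ker (M := M j) (N := quot (LinearMap.range (φ j)))
      (LinearMap.range (φ j)).mkQ) := by
    refine hU.quot (M := Y j) ((φ j).codRestrict _ fun x => ?_) ?_ (hY j)
    · rw [Submodule.ker_mkQ]
      exact ⟨x, rfl⟩
    · rintro ⟨y, hy⟩
      rw [Submodule.ker_mkQ] at hy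
      obtain ⟨x, rfl⟩ := hy
      exact ⟨x, rfl⟩
  obtain ⟨f', hf'⟩ := hM.ext i _ _ (LinearMap.range (φ j)).mkQ (Submodule.mkQ_surjective _) hker f
  have hb : Function.Bijective f' := by
    by_contra hb
    obtain ⟨g, rfl⟩ := (hφ j i f').1 hb
    refine hf ?_
    rw [← hf']
    ext x
    exact (Submodule.Quotient.mk_eq_zero _).2 ⟨g x, rfl⟩
  refine ⟨hM.inj i j ⟨LinearEquiv.ofBijective f' hb⟩, ?_⟩
  rw [← hf']
  exact (Submodule.mkQ_surjective _).comp hb.2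

include hs in
lemma ExtFam.ker_mem {X : FinMod k R} (hX : ∀ N, U N ↔ Fac X N) {n : ℕ}
    {M : Fin n → FinMod k R} (hM : ExtFam U M) (hc : ExtFam.Complete U M) {Y N : FinMod k R}
    (hY : U Y) (hN : U N) (p : Y →ₗ[R] N) (hp : Function.Surjective p)
    (hl : ∀ i (g : M i →ₗ[R] N), ∃ g', p ∘ₗ g' = g) : U (FinMod.ker p) := by
  obtain ⟨t, ht, htm⟩ := exists_trace hU hX (FinMod.ker p)
  have hsub : Subsingleton (FinMod.quot t) := by
    refine hM.subsingleton_of_chi hU hs hX hc _ fun i => ?_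
    have hadd : IsAdditive (chi U (M i)) := isAdditive_chi hU hs (hM.ext i)
    have h1 := hadd (K := FinMod.sub t) (N := FinMod.ker p) (L := FinMod.quot t) t.subtype t.mkQ
      t.injective_subtype (by rw [Submodule.range_subtype, Submodule.ker_mkQ]) t.mkQ_surjective
    have h2 := hadd (K := FinMod.ker p) (LinearMap.ker p).subtype p (Submodule.injective_subtype _)
      (Submodule.range_subtype _) hp
    have h3 := hom_exact_of_lift (M i) (K := FinMod.ker p) (LinearMap.ker p).subtype p
      (Submodule.injective_subtype _) (Submodule.range_subtype _) (hl i)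
    rw [chi_eq_hom hU hs (hM.ext i) hY, chi_eq_hom hU hs (hM.ext i) hN] at h2
    rw [chi_eq_hom hU hs (hM.ext i) ht, hom_sub_eq t (htm _ (hM.mem i))] at h1
    linarith
  refine hU.quot (M := FinMod.sub t) (N := FinMod.ker p) t.subtype (fun x => ?_) ht
  have hx : x ∈ t := (Submodule.Quotient.mk_eq_zero t).1 (Subsingleton.elim _ _)
  exact ⟨⟨x, hx⟩, rfl⟩

include hs in
/-- Between a functorially finite sincere torsion class and a smaller torsion class there is
another one that is generated by a single module. -/
lemma exists_torsion_below {X : FinMod k R} (hX : ∀ N, U N ↔ Fac X N) {n : ℕ}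
    {M : Fin n → FinMod k R} (hM : ExtFam U M) (hc : ExtFam.Complete U M)
    {T : FinMod k R → Prop} (hT : IsTors T) (hTU : ∀ N, T N → U N) (hne : ∃ N, U N ∧ ¬ T N) :
    ∃ X' : FinMod k R, IsTors (Fac X') ∧ (∀ N, T N → Fac X' N) ∧ (∀ N, Fac X' N → U N) ∧
      ∃ N, U N ∧ ¬ Fac X' N := by
  classical
  choose Y φ hY hφ using exists_radical_images hU hM
  obtain ⟨j, hj⟩ := exists_radical_quotient_notMem hU hs hX hM hc hY hφ hT hne
  have hfac := fun L hL => (hM.fac_iff hU hs hX hc L).1 hL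
  let S := quot (LinearMap.range (φ j))
  let U' : FinMod k R → Prop := fun N => U N ∧ ∀ f : N →ₗ[R] S, f = 0
  have hU' : IsTors U' := by
    refine ⟨fun {K N} f hf hK => ⟨hU.quot f hf hK.1, fun g => ?_⟩,
      fun {K N} f hf hK hN => ⟨hU.ext f hf hK.1 hN.1, fun g => ?_⟩,
      fun N hN => ⟨hU.zero N hN, fun g => ?_⟩⟩
    · ext x
      obtain ⟨y, rfl⟩ := hf x
      exact LinearMap.congr_fun (hK.2 (g ∘ₗ f)) y
    · have h1 := hK.2 (g ∘ₗ (LinearMap.ker f).subtype)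
      have hle : LinearMap.ker f ≤ LinearMap.ker g := fun x hx => LinearMap.congr_fun h1 ⟨x, hx⟩
      let e := f.quotKerEquivOfSurjective hf
      have h2 := hN.2 ((LinearMap.ker f).liftQ g hle ∘ₗ e.symm.toLinearMap)
      ext x
      have h3 := LinearMap.congr_fun h2 (e ((LinearMap.ker f).mkQ x))
      simpa using h3
    · ext x
      rw [Subsingleton.elim x 0, map_zero, map_zero]
  have hTU' : ∀ N, T N → U' N := by
    refine fun N hN => ⟨hTU N hN, fun f => ?_⟩
    by_contra hf
    obtain ⟨i, g, hg⟩ := (hfac N (hTU N hN)).exists_comp_ne hf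
    obtain ⟨-, hsurj⟩ := radical_quotient_brick hU hM hY hφ (f ∘ₗ g) hg
    exact hj (hT.quot f (fun y => (hsurj y).imp' g fun _ h => h) hN)
  have hq0 : ((LinearMap.range (φ j)).mkQ : M j →ₗ[R] S) ≠ 0 := by
    intro h0
    refine hj (hT.zero _ (subsingleton_of_forall_eq 0 fun y => ?_))
    obtain ⟨x, rfl⟩ := (LinearMap.range (φ j)).mkQ_surjective y
    exact LinearMap.congr_fun h0 x
  let X' : FinMod k R := pi (fun i : {i // i ≠ j} => M i)
  have hmem : ∀ i, i ≠ j → U' (M i) := by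
    refine fun i hi => ⟨hM.mem i, fun f => ?_⟩
    by_contra hf
    exact hi (radical_quotient_brick hU hM hY hφ f hf).1
  have hX'U : U' X' := hU'.pi _ fun i => hmem i i.2
  have key : ∀ N, U' N → Fac X' N := by
    intro N hN
    obtain ⟨r, F, hF⟩ := exists_rightApprox X' N
    let N' := quot (LinearMap.range F)
    let q : N →ₗ[R] N' := (LinearMap.range F).mkQ
    have hN' : U' N' := hU'.quot (N := N') q (Submodule.mkQ_surjective _) hN
    have hkerF : U (ker q) := by
      refine hU.quot (M := pi fun _ : Fin r => X') (F.codRestrict _ fun x => ?_) ?_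
        (hU.pi _ fun _ => hX'U.1)
      · rw [Submodule.ker_mkQ]
        exact ⟨x, rfl⟩
      · rintro ⟨y, hy⟩
        rw [Submodule.ker_mkQ] at hy
        obtain ⟨x, rfl⟩ := hy
        exact ⟨x, rfl⟩
    have hz : ∀ i, i ≠ j → ∀ g : M i →ₗ[R] N', g = 0 := by
      intro i hi g
      obtain ⟨g', rfl⟩ := hM.ext i N N' q (Submodule.mkQ_surjective _) hkerF g
      let a : {i // i ≠ j} := ⟨i, hi⟩
      obtain ⟨h, hh⟩ := hF (g' ∘ₗ LinearMap.proj a)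
      ext x
      refine (Submodule.Quotient.mk_eq_zero _).2 ⟨h (Pi.single a x), ?_⟩
      have : F (h (Pi.single a x)) = g' ((Pi.single a x : ∀ a : {i // i ≠ j}, M a) a) :=
        LinearMap.congr_fun hh (Pi.single a x)
      rw [this, Pi.single_eq_same]
    have hex : ∃ (a : ℕ) (p : pi (fun _ : Fin a => M j) →ₗ[R] N'),
        ∀ g : M j →ₗ[R] N', ∃ g', p ∘ₗ g' = g := exists_rightApprox (M j) N'
    obtain ⟨p, hp⟩ := Nat.find_spec hex
    have hmin := fun b => Nat.find_min hex (m := b)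
    generalize Nat.find hex = a at p hp hmin
    let Z := pi (fun _ : Fin a => M j)
    have hl : ∀ i (g : M i →ₗ[R] N'), ∃ g' : M i →ₗ[R] Z, p ∘ₗ g' = g := by
      intro i g
      by_cases hi : i = j
      · subst hi
        exact hp g
      · exact ⟨0, by rw [hz i hi g, LinearMap.comp_zero]⟩
    have hps : Function.Surjective p := by
      rw [← LinearMap.range_eq_top]
      by_contra hne
      have : (LinearMap.range p).mkQ ≠ 0 := by
        intro h0
        refine hne ?_
        rw [← Submodule.ker_mkQ (LinearMap.range p), h0, LinearMap.ker_zero]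
      obtain ⟨i, g, hg⟩ := (hfac N' hN'.1).exists_comp_ne (L := quot (LinearMap.range p)) this
      obtain ⟨g', rfl⟩ := hl i g
      refine hg ?_
      ext x
      exact (Submodule.Quotient.mk_eq_zero _).2 ⟨g' x, rfl⟩
    have hZU : U Z := hU.pi _ fun _ => hM.mem j
    have hK : U (ker p) := hM.ker_mem hU hs hX hc hZU hN'.1 p hps hl
    have ha : a = 0 := by
      obtain _ | a := a
      · rfl
      exfalso
      let π : Z →ₗ[R] M j := LinearMap.proj 0
      have hne : ((LinearMap.range (φ j)).mkQ ∘ₗ π) ∘ₗ (LinearMap.ker p).subtype ≠ 0 := by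
        intro h0
        have hle : LinearMap.ker p ≤ LinearMap.ker ((LinearMap.range (φ j)).mkQ ∘ₗ π) :=
          fun x hx => LinearMap.congr_fun h0 ⟨x, hx⟩
        have h2 := hN'.2 ((LinearMap.ker p).liftQ _ hle ∘ₗ
          (p.quotKerEquivOfSurjective hps).symm.toLinearMap)
        refine hq0 (LinearMap.ext fun x => ?_)
        have h3 := LinearMap.congr_fun h2
          (p.quotKerEquivOfSurjective hps ((LinearMap.ker p).mkQ (fun _ => x)))
        simp only [LinearMap.comp_apply, LinearEquiv.coe_coe, LinearEquiv.symm_apply_apply] at h3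
        exact h3
      obtain ⟨i, κ, hκ⟩ := (hfac _ hK).exists_comp_ne (L := S) hne
      obtain ⟨rfl, -⟩ := radical_quotient_brick hU hM hY hφ _ hκ
      let θ := π ∘ₗ (LinearMap.ker p).subtype ∘ₗ κ
      have hθ : Function.Bijective θ := by
        by_contra hb
        obtain ⟨g, hg⟩ := (hφ _ _ θ).1 hb
        refine hκ (LinearMap.ext fun x => ?_)
        exact (Submodule.Quotient.mk_eq_zero _).2 ⟨g x, LinearMap.congr_fun hg x⟩
      let e := LinearEquiv.ofBijective θ hθ
      refine hmin a (Nat.lt_succ_self a) ⟨p ∘ₗ LinearMap.pi (Fin.cons 0 fun b =>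
        LinearMap.proj b), fun g => ?_⟩
      obtain ⟨y, rfl⟩ := hp g
      let y' : M i →ₗ[R] Z := y - (LinearMap.ker p).subtype ∘ₗ κ ∘ₗ e.symm.toLinearMap ∘ₗ π ∘ₗ y
      refine ⟨LinearMap.pi fun b => LinearMap.proj b.succ ∘ₗ y', LinearMap.ext fun x => ?_⟩
      have hp' : p (y' x) = p (y x) := by
        have : p ((LinearMap.ker p).subtype (κ (e.symm (π (y x))))) = 0 :=
          (κ (e.symm (π (y x)))).2
        simp only [y', LinearMap.sub_apply, LinearMap.comp_apply, map_sub]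
        exact (congrArg _ this).trans (sub_zero _)
      have hπ : π (y' x) = 0 := by
        have : θ (e.symm (π (y x))) = π (y x) := e.apply_symm_apply _
        simp only [y', LinearMap.sub_apply, LinearMap.comp_apply, map_sub]
        exact (congrArg _ this).trans (sub_self _)
      refine Eq.trans (congrArg p (funext fun b => ?_)) hp'
      refine Fin.cases hπ.symm (fun b => rfl) b
    subst ha
    refine ⟨r, F, LinearMap.range_eq_top.1 ?_⟩
    rw [eq_top_iff]
    intro x _
    refine (Submodule.Quotient.mk_eq_zero (LinearMap.range F)).1 ?_
    obtain ⟨z, hz⟩ := hps (q x)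
    exact hz.symm.trans (by rw [Subsingleton.elim z 0, map_zero])
  have hiff : ∀ N, Fac X' N ↔ U' N := fun N => ⟨fun h => hU'.of_fac hX'U h, key N⟩
  have heq : Fac X' = U' := funext fun N => propext (hiff N)
  refine ⟨X', heq ▸ hU', fun N hN => key N (hTU' N hN), fun N hN => ((hiff N).1 hN).1,
    M j, hM.mem j, fun h => ?_⟩
  exact hq0 (((hiff _).1 h).2 _)

end below

end FinMod

namespace FinMod

section convert

variable {k R : Type} [Field k] [Ring R] [Algebra k R]

/-- A finite-dimensional module as an object of the module category. -/
abbrev toCat (M : FinMod k R) : ModuleCat.{0} R := ModuleCat.of R M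

/-- A finitely generated module over a finite-dimensional algebra is finite-dimensional. -/
@[reducible] def ofFinite (k : Type) {R : Type} [Field k] [Ring R] [Algebra k R] [Module.Finite k R]
    (M : Type) [AddCommGroup M] [Module R M] [Module.Finite R M] : FinMod k R :=
  letI : Module k M := Module.compHom M (algebraMap k R)
  haveI : IsScalarTower k R M := ⟨fun c r x => by
    rw [Algebra.smul_def, mul_smul]; rfl⟩
  { carrier := M
    finite := Module.Finite.trans R M }

lemma exists_complement {M L : Type} [AddCommGroup M] [Module R M] [AddCommGroup L] [Module R L]
    (i : L →ₗ[R] M) (r : M →ₗ[R] L) (h : r ∘ₗ i = LinearMap.id) :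
    Nonempty (M ≃ₗ[R] (L × LinearMap.ker r)) := by
  have h' : ∀ x, r (i x) = x := LinearMap.congr_fun h
  refine ⟨LinearEquiv.ofLinearMap
    (r.prod ((LinearMap.id - i ∘ₗ r).codRestrict _ fun x => by simp [h']))
    (i.coprod (LinearMap.ker r).subtype) ?_ ?_⟩
  · ext x <;> simp [h']
  · ext x
    simp

lemma Indec.indecomposable {B : Type} [Ring B] [Algebra k B] {M : FinMod k Bᵐᵒᵖ} (h : Indec M) :
    IndecomposableMod B (toCat M) := by
  refine ⟨h.1, ?_⟩
  rintro L L' ⟨e⟩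
  let p : M →ₗ[Bᵐᵒᵖ] M := e.symm.toLinearMap ∘ₗ LinearMap.inl _ L L' ∘ₗ LinearMap.fst _ L L' ∘ₗ
    e.toLinearMap
  have hp : ∀ x, p (p x) = p x := fun x => by simp [p]
  rcases h.2 p with ⟨n, hn⟩ | hb
  · left
    have hpow : ∀ n x, (p ^ (n + 1)) x = p x := by
      intro n x
      induction n with
      | zero => simp
      | succ n ih => rw [pow_succ', Module.End.mul_apply, ih, hp]
    have h0 : ∀ x, p x = 0 := fun x => by rw [← hpow n x, pow_succ', hn, mul_zero]; rfl
    refine subsingleton_of_forall_eq 0 fun l => ?_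
    have := congrArg e (h0 (e.symm (l, 0)))
    simpa [p] using this
  · right
    refine subsingleton_of_forall_eq 0 fun l => ?_
    have h1 : p (e.symm (0, l)) = p 0 := by simp [p]
    have h2 := congrArg e (hb.1 h1)
    simpa using h2

lemma indec_of_indecomposable {B : Type} [Ring B] [Algebra k B] {M : FinMod k Bᵐᵒᵖ}
    (h : IndecomposableMod B (toCat M)) : Indec M := by
  have := h.1
  refine indec_of_forall_isCompl fun N N' hN => ?_
  rcases h.2 (toCat (sub N)) (toCat (sub N')) ⟨(Submodule.prodEquivOfIsCompl N N' hN).symm⟩ with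
    h | h
  · exact Or.inl (Submodule.subsingleton_iff_eq_bot.1 h)
  · exact Or.inr (Submodule.subsingleton_iff_eq_bot.1 h)

end convert

section link

variable {k B : Type} [Field k] [Ring B] [Algebra k B]

lemma rankK0Is [Module.Finite k Bᵐᵒᵖ] {n : ℕ} {S : Fin n → FinMod k Bᵐᵒᵖ} (hS : SimpleFam S) :
    RankK0Is B n := by
  refine ⟨fun i => toCat (S i), hS.simple, fun i j hij => ⟨fun e => hij (hS.inj i j ⟨e⟩)⟩, ?_⟩
  intro T hT
  have : Module.Finite Bᵐᵒᵖ T := inferInstance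
  exact hS.complete (ofFinite k (R := Bᵐᵒᵖ) T) hT

lemma numIndecSummandsIs [Module.Finite k Bᵐᵒᵖ] {n : ℕ} {M : Fin n → FinMod k Bᵐᵒᵖ}
    (hM : ∀ i, Indec (M i)) (hne : ∀ i j, Nonempty (M i ≃ₗ[Bᵐᵒᵖ] M j) → i = j) :
    NumIndecSummandsIs B (toCat (pi M)) n := by
  classical
  refine ⟨fun i => toCat (M i), fun i => ⟨(hM i).indecomposable, ?_⟩,
    fun i j hij => ⟨fun e => hij (hne i j ⟨e⟩)⟩, ?_⟩
  · let r : pi M →ₗ[Bᵐᵒᵖ] M i := LinearMap.proj i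
    obtain ⟨e⟩ := exists_complement (LinearMap.single Bᵐᵒᵖ (fun i => M i) i) r
      (by ext x; simp [r])
    exact ⟨toCat (ker r), ⟨e⟩⟩
  · rintro L ⟨hL, L', ⟨e⟩⟩
    let r : pi M →ₗ[Bᵐᵒᵖ] L := LinearMap.fst _ L L' ∘ₗ e.toLinearMap
    let i : L →ₗ[Bᵐᵒᵖ] pi M := e.symm.toLinearMap ∘ₗ LinearMap.inl _ L L'
    have hri : r ∘ₗ i = LinearMap.id := by ext x; simp [r, i]
    have : Module.Finite Bᵐᵒᵖ L := Module.Finite.of_surjective r fun x =>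
      ⟨i x, LinearMap.congr_fun hri x⟩
    have hL' : Indec (ofFinite k (R := Bᵐᵒᵖ) L) := indec_of_indecomposable hL
    refine hL'.exists_iso_of_retract M hM i r ?_
    exact hri ▸ Function.bijective_id

lemma isBasicMod [Module.Finite k Bᵐᵒᵖ] {n : ℕ} {M : Fin n → FinMod k Bᵐᵒᵖ}
    (hM : ∀ i, Indec (M i)) (hne : ∀ i j, Nonempty (M i ≃ₗ[Bᵐᵒᵖ] M j) → i = j) :
    IsBasicMod B (toCat (pi M)) := by
  classical
  rintro L C ⟨e⟩
  let r : pi M →ₗ[Bᵐᵒᵖ] L := LinearMap.fst _ L (L × C) ∘ₗ e.toLinearMap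
  let r' : pi M →ₗ[Bᵐᵒᵖ] L := LinearMap.fst _ L C ∘ₗ LinearMap.snd _ L (L × C) ∘ₗ e.toLinearMap
  let i : L →ₗ[Bᵐᵒᵖ] pi M := e.symm.toLinearMap ∘ₗ LinearMap.inl _ L (L × C)
  let i' : L →ₗ[Bᵐᵒᵖ] pi M := e.symm.toLinearMap ∘ₗ LinearMap.inr _ L (L × C) ∘ₗ
    LinearMap.inl _ L C
  have h1 : ∀ x, r (i x) = x := fun x => by simp [r, i]
  have h2 : ∀ x, r' (i' x) = x := fun x => by simp [r', i']
  have h3 : ∀ x, r (i' x) = 0 := fun x => by simp [r, i']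
  have : Module.Finite Bᵐᵒᵖ L := Module.Finite.of_surjective r fun x => ⟨i x, h1 x⟩
  obtain ⟨ι, _, K, hK, ⟨e'⟩⟩ := exists_decomposition (ofFinite k (R := Bᵐᵒᵖ) L)
  by_contra hns
  have hι : Nonempty ι := by
    by_contra hι
    have := not_nonempty_iff.1 hι
    exact hns (e'.toEquiv.subsingleton)
  obtain ⟨x⟩ := hι
  let s : K x →ₗ[Bᵐᵒᵖ] ofFinite k (R := Bᵐᵒᵖ) L := e'.symm.toLinearMap ∘ₗ LinearMap.single _ (fun x => K x) x
  let t : ofFinite k (R := Bᵐᵒᵖ) L →ₗ[Bᵐᵒᵖ] K x := LinearMap.proj x ∘ₗ e'.toLinearMap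
  have hts : ∀ y, t (s y) = y := fun y => by simp [s, t]
  refine subsingleton_of_sq_retract (hK x) M hM hne (i ∘ₗ s) (i' ∘ₗ s) (t ∘ₗ r) (t ∘ₗ r') ?_ ?_ ?_
  · have : (t ∘ₗ r) ∘ₗ (i ∘ₗ s) = LinearMap.id := LinearMap.ext fun y =>
      (congrArg t (h1 (s y))).trans (hts y)
    exact this ▸ Function.bijective_id
  · have : (t ∘ₗ r') ∘ₗ (i' ∘ₗ s) = LinearMap.id := LinearMap.ext fun y =>
      (congrArg t (h2 (s y))).trans (hts y)
    exact this ▸ Function.bijective_id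
  · exact LinearMap.ext fun y => (congrArg t (h3 (s y))).trans (map_zero t)

end link

end FinMod

namespace FinMod

section tauRigid

lemma finite_of_superfluous {R Q M : Type} [Ring R] [AddCommGroup Q] [Module R Q] [AddCommGroup M]
    [Module R M] [Module.Finite R M] (g : Q →ₗ[R] M) (hg : Function.Surjective g)
    (hs : SuperfluousSubmodule (LinearMap.ker g)) : Module.Finite R Q := by
  obtain ⟨n, s, hspan⟩ := Module.Finite.exists_fin (R := R) (M := M)
  choose t ht using fun i => hg (s i)
  have htop : Submodule.span R (Set.range t) = ⊤ := by
    refine hs _ ?_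
    rw [sup_comm, ← Submodule.comap_map_eq, Submodule.map_span, ← Set.range_comp]
    have : (g ∘ t) = s := funext ht
    rw [this, hspan, Submodule.comap_top]
  exact Module.finite_def.2 ⟨Set.finite_range t |>.toFinset, by simpa using htop⟩

variable {B : Type} [Ring B]

/-- The right module structures on `B` given by left multiplication and by `Bᵐᵒᵖ` agree. -/
def unopHom : Bᵐᵒᵖ →ₗ[Bᵐᵒᵖ] B where
  toFun := unop
  map_add' _ _ := rfl
  map_smul' _ _ := rfl

lemma exists_dual_basis (P : Type) [AddCommGroup P] [Module Bᵐᵒᵖ P] [Module.Finite Bᵐᵒᵖ P]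
    [Module.Projective Bᵐᵒᵖ P] : ∃ (n : ℕ) (x : Fin n → P) (h : Fin n → (P →ₗ[Bᵐᵒᵖ] B)),
      ∀ p, p = ∑ i, op (h i p) • x i := by
  obtain ⟨n, g, hg⟩ := Module.Finite.exists_fin' Bᵐᵒᵖ P
  obtain ⟨s, hs⟩ := Module.projective_lifting_property g LinearMap.id hg
  refine ⟨n, fun i => g (Pi.single i 1), fun i => unopHom ∘ₗ LinearMap.proj i ∘ₗ s, fun p => ?_⟩
  have h1 : g (s p) = p := LinearMap.congr_fun hs p
  conv_lhs => rw [← h1, ← Finset.univ_sum_single (s p), map_sum]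
  refine Finset.sum_congr rfl fun i _ => ?_
  rw [← map_smul]
  congr 1
  ext j
  by_cases h : j = i
  · subst h; simp [unopHom]
  · simp [h]

lemma sum_leftMulHom {P : Type} [AddCommGroup P] [Module Bᵐᵒᵖ P] {n : ℕ} {x : Fin n → P}
    {h : Fin n → (P →ₗ[Bᵐᵒᵖ] B)} (hx : ∀ p, p = ∑ i, op (h i p) • x i) (u : P →ₗ[Bᵐᵒᵖ] B) :
    ∑ i, leftMulHom B (u (x i)) (h i) = u := by
  ext p
  conv_rhs => rw [hx p]
  simp [leftMulHom]

/-- The map `p ↦ m · u(p)`. -/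
def smulRight {P M : Type} [AddCommGroup P] [Module Bᵐᵒᵖ P] [AddCommGroup M] [Module Bᵐᵒᵖ M]
    (u : P →ₗ[Bᵐᵒᵖ] B) (m : M) : P →ₗ[Bᵐᵒᵖ] M where
  toFun p := op (u p) • m
  map_add' x y := by rw [map_add, MulOpposite.op_add, add_smul]
  map_smul' r x := by
    rw [map_smul, MulOpposite.smul_eq_mul_unop, op_mul, op_unop, mul_smul, RingHom.id_apply]

/-- Ext-projective objects of torsion classes are τ-rigid. -/
lemma ExtProj.isTauRigid {k : Type} [Field k] [Algebra k B] [Module.Finite k Bᵐᵒᵖ]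
    {U : FinMod k Bᵐᵒᵖ → Prop} (hU : IsTors U) {M : FinMod k Bᵐᵒᵖ} (hM : ExtProj U M)
    (hMU : U M) : IsTauRigid k B (toCat M) := by
  intro P1 P0 f g ⟨hP1, hP0, hg, hfg, hsg, hsf⟩ β hb hv
  have : IsNoetherianRing Bᵐᵒᵖ := isNoetherian_of_tower k inferInstance
  have hf0 : Module.Finite Bᵐᵒᵖ P0 := finite_of_superfluous g hg hsg
  have hf1 : Module.Finite Bᵐᵒᵖ P1 := by
    refine finite_of_superfluous f.rangeRestrict f.surjective_rangeRestrict ?_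
    rwa [LinearMap.ker_rangeRestrict]
  have hpres : UPres U (P := ofFinite k (R := Bᵐᵒᵖ) P1) (Q := ofFinite k (R := Bᵐᵒᵖ) P0) f g :=
    uPres_of_superfluous hU hP1 hP0 hg hfg hsf hM
  obtain ⟨n, x, h, hx⟩ := exists_dual_basis (B := B) P1
  obtain ⟨n', y, l, hy⟩ := exists_dual_basis (B := B) P0
  ext m u
  obtain ⟨h', hh'⟩ := hpres.extend M hMU (smulRight u m)
  have e1 : ∑ i, β (smulRight u m (x i)) (h i) = β m u := by
    conv_rhs => rw [← sum_leftMulHom hx u, map_sum]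
    exact Finset.sum_congr rfl fun i _ => hb _ _ _
  have e2 : ∀ p : P1, h' (f p) = smulRight u m p := fun p => LinearMap.congr_fun hh' p
  have e3 : ∀ i, β (smulRight u m (x i)) (h i) =
      ∑ j, β (h' (y j)) (leftMulHom B (((l j) ∘ₗ f) (x i)) (h i)) := by
    intro i
    rw [← e2]
    have : h' (f (x i)) = ∑ j, op (l j (f (x i))) • h' (y j) := by
      conv_lhs => rw [hy (f (x i))]
      rw [map_sum]
      exact Finset.sum_congr rfl fun j _ => map_smul h' _ _
    rw [this, map_sum, LinearMap.sum_apply]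
    exact Finset.sum_congr rfl fun j _ => hb _ _ _
  rw [← e1, Finset.sum_congr rfl fun i _ => e3 i, Finset.sum_comm]
  simp only [AddMonoidHom.zero_apply, LinearMap.zero_apply]
  refine Finset.sum_eq_zero fun j _ => ?_
  rw [← map_sum, sum_leftMulHom hx]
  exact hv _ _

end tauRigid

section tilting

variable {k B : Type} [Field k] [Ring B] [Algebra k B] [Module.Finite k Bᵐᵒᵖ]

lemma ExtFam.isTauTiltingMod {U : FinMod k Bᵐᵒᵖ → Prop} (hU : IsTors U) {n : ℕ}
    {S : Fin n → FinMod k Bᵐᵒᵖ} (hS : SimpleFam S) {M : Fin n → FinMod k Bᵐᵒᵖ} (hM : ExtFam U M) :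
    IsTauTiltingMod k B (toCat (FinMod.pi M)) :=
  ⟨inferInstanceAs (Module.Finite Bᵐᵒᵖ (FinMod.pi M)),
    (ExtProj.pi hM.ext).isTauRigid hU (hU.pi M hM.mem),
    n, numIndecSummandsIs hM.indec hM.inj, rankK0Is hS⟩

end tilting

end FinMod

namespace FinMod

section res

variable {k R R' : Type} [Field k] [Ring R] [Algebra k R] [Ring R'] [Algebra k R']

/-- Restriction of scalars along a map of algebras. -/
def res (ψ : R →ₐ[k] R') (N : FinMod k R') : FinMod k R :=
  letI : Module R N := Module.compHom N ψ.toRingHom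
  haveI : IsScalarTower k R N := ⟨fun c r x => by
    show ψ (c • r) • x = c • (ψ r • x)
    rw [map_smul, smul_assoc]⟩
  { carrier := N }

/-- Restriction of scalars on maps. -/
def resMap (ψ : R →ₐ[k] R') {M N : FinMod k R'} (f : M →ₗ[R'] N) : res ψ M →ₗ[R] res ψ N where
  toFun := f
  map_add' := f.map_add
  map_smul' r x := f.map_smul (ψ r) x

/-- Restriction along a surjection is full. -/
def unresMap {ψ : R →ₐ[k] R'} (hψ : Function.Surjective ψ) {M N : FinMod k R'}
    (f : res ψ M →ₗ[R] res ψ N) : M →ₗ[R'] N where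
  toFun := f
  map_add' := f.map_add
  map_smul' r x := by
    obtain ⟨r, rfl⟩ := hψ r
    exact f.map_smul r x

/-- The modules factoring through `ψ`. -/
def Killed (ψ : R →ₐ[k] R') (N : FinMod k R) : Prop := ∀ r, ψ r = 0 → ∀ x : N, r • x = 0

/-- A module factoring through a surjection. -/
def descend {ψ : R →ₐ[k] R'} (hψ : Function.Surjective ψ) (N : FinMod k R)
    (hN : Killed ψ N) : FinMod k R' :=
  have key : ∀ (r s : R), ψ r = ψ s → ∀ x : N, r • x = s • x := fun r s h x => by
    rw [← sub_eq_zero, ← sub_smul]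
    exact hN _ (by rw [map_sub, h, sub_self]) x
  have hs := Function.surjInv_eq hψ
  letI : Module R' N :=
    { smul := fun r x => Function.surjInv hψ r • x
      one_smul := fun x => (key _ 1 (by rw [hs, map_one]) x).trans (one_smul _ _)
      mul_smul := fun r s x => (key _ (Function.surjInv hψ r * Function.surjInv hψ s)
        (by rw [map_mul, hs, hs, hs]) x).trans (mul_smul _ _ _)
      smul_zero := fun r => smul_zero _
      smul_add := fun r x y => smul_add _ _ _
      add_smul := fun r s x => (key _ (Function.surjInv hψ r + Function.surjInv hψ s)
        (by rw [map_add, hs, hs, hs]) x).trans (add_smul _ _ _)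
      zero_smul := fun x => (key _ 0 (by rw [hs, map_zero]) x).trans (zero_smul _ _) }
  haveI : IsScalarTower k R' N := ⟨fun c r x =>
    (key _ (c • Function.surjInv hψ r) (by rw [map_smul, hs, hs]) x).trans (smul_assoc _ _ _)⟩
  { carrier := N }

/-- Restricting a descended module recovers it. -/
def resDescend {ψ : R →ₐ[k] R'} (hψ : Function.Surjective ψ) (N : FinMod k R) (hN : Killed ψ N) :
    res ψ (descend hψ N hN) ≃ₗ[R] N where
  toFun x := x
  invFun x := x
  left_inv _ := rfl
  right_inv _ := rfl
  map_add' _ _ := rfl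
  map_smul' r x := by
    show Function.surjInv hψ (ψ r) • (show N from x) = r • (show N from x)
    rw [← sub_eq_zero, ← sub_smul]
    exact hN _ (by rw [map_sub, Function.surjInv_eq hψ, sub_self]) _

variable {ψ : R →ₐ[k] R'}

lemma Killed.of_surjective {M N : FinMod k R} (h : Killed ψ M) (f : M →ₗ[R] N)
    (hf : Function.Surjective f) : Killed ψ N := fun r hr x => by
  obtain ⟨y, rfl⟩ := hf x
  rw [← map_smul, h r hr, map_zero]

lemma fac_res_iff (hψ : Function.Surjective ψ) (X N : FinMod k R') :
    Fac (res ψ X) (res ψ N) ↔ Fac X N := by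
  constructor
  · rintro ⟨r, f, hf⟩
    exact ⟨r, unresMap (M := pi fun _ => X) hψ f, hf⟩
  · rintro ⟨r, f, hf⟩
    exact ⟨r, resMap ψ f, hf⟩

lemma Fac.congr_left {X Y N : FinMod k R} (h : Fac X N) (e : Y ≃ₗ[R] X) : Fac Y N := by
  obtain ⟨r, f, hf⟩ := h
  refine ⟨r, f ∘ₗ (LinearEquiv.piCongrRight fun _ => e).toLinearMap, hf.comp ?_⟩
  exact (LinearEquiv.piCongrRight fun _ : Fin r => e).surjective

lemma IsTors.res {U : FinMod k R → Prop} (hU : IsTors U) :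
    IsTors (fun N : FinMod k R' => U (res ψ N)) where
  quot f hf h := hU.quot (resMap ψ f) hf h
  ext {M N} f hf hK hN := by
    refine hU.ext' (K := FinMod.res ψ (FinMod.ker f)) (resMap ψ (LinearMap.ker f).subtype)
      (resMap ψ f) hf ?_ hK hN
    ext x
    constructor
    · rintro ⟨y, rfl⟩
      exact y.2
    · intro hx
      exact ⟨⟨x, hx⟩, rfl⟩
  zero M hM := hU.zero _ hM

/-- Torsion classes of `R'`-modules inside a torsion class of `R`-modules factoring through a
surjection `R → R'` are torsion classes of `R`-modules. -/
lemma isTors_fac_res (hψ : Function.Surjective ψ) {U : FinMod k R → Prop} (hU : IsTors U)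
    (hk : ∀ N, U N → Killed ψ N) {X : FinMod k R'} (hX : IsTors (Fac X)) (hXU : U (res ψ X)) :
    IsTors (Fac (res ψ X)) := by
  have hsub : ∀ N, Fac (res ψ X) N → U N := fun N h => hU.of_fac hXU h
  refine ⟨fun f hf h => h.quot f hf, fun {M N} f hf hK hN => ?_, fun M hM => ?_⟩
  · have hM : U M := hU.ext f hf (hsub _ hK) (hsub _ hN)
    let f' : descend hψ M (hk M hM) →ₗ[R'] descend hψ N (hk N (hsub _ hN)) :=
      unresMap hψ ((resDescend hψ N (hk N (hsub _ hN))).symm.toLinearMap ∘ₗ f ∘ₗ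
        (resDescend hψ M (hk M hM)).toLinearMap)
    have hf' : Function.Surjective f' := hf
    have h1 : Fac X (descend hψ N (hk N (hsub _ hN))) := (fac_res_iff hψ _ _).1
      (hN.quot (resDescend hψ N (hk N (hsub _ hN))).symm.toLinearMap (LinearEquiv.surjective _))
    have h2 : Fac X (ker f') := by
      let g : ker f →ₗ[R] FinMod.res ψ (ker f') :=
        { toFun := fun x => ⟨x.1, x.2⟩
          map_add' := fun _ _ => rfl
          map_smul' := fun r x =>
            Subtype.ext ((resDescend hψ M (hk M hM)).symm.map_smul r x.1) }
      exact (fac_res_iff hψ _ _).1 (hK.quot g fun ⟨x, hx⟩ => ⟨⟨x, hx⟩, rfl⟩)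
    have h3 := (fac_res_iff hψ _ _).2 (hX.ext f' hf' h2 h1)
    exact h3.quot (resDescend hψ M (hk M hM)).toLinearMap (LinearEquiv.surjective _)
  · exact ⟨0, 0, fun x => ⟨0, Subsingleton.elim _ _⟩⟩

lemma Indec.res (hψ : Function.Surjective ψ) {M : FinMod k R'} (h : Indec M) :
    Indec (res ψ M) := by
  refine ⟨h.1, fun f => ?_⟩
  rcases h.2 (unresMap hψ f) with ⟨n, hn⟩ | hb
  · left
    refine ⟨n, ?_⟩
    ext x
    have : ∀ n (x : M), (f ^ n) x = ((unresMap hψ f) ^ n) x := by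
      intro n
      induction n with
      | zero => exact fun _ => rfl
      | succ n ih => exact fun x => ih (f x)
    exact (this n x).trans (LinearMap.congr_fun hn x)
  · exact Or.inr hb

/-- A linear equivalence of restrictions comes from one of the modules. -/
def unresEquiv (hψ : Function.Surjective ψ) {M N : FinMod k R'}
    (e : FinMod.res ψ M ≃ₗ[R] FinMod.res ψ N) : M ≃ₗ[R'] N :=
  LinearEquiv.ofBijective (unresMap hψ e.toLinearMap) e.bijective

end res

end FinMod

namespace FinMod

section idempotents

variable {k A : Type} [Field k] [Ring A] [Algebra k A]

/-- Fitting's lemma for elements of a finite-dimensional algebra. -/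
lemma exists_pow_eq [Module.Finite k A] (a : A) :
    ∃ (n : ℕ) (c : A), Commute a c ∧ a ^ n = a ^ (n + 1) * c := by
  have h0 : minpoly k a ≠ 0 := minpoly.ne_zero (Algebra.IsIntegral.isIntegral a)
  obtain ⟨q, hq, hnd⟩ := Polynomial.exists_eq_pow_rootMultiplicity_mul_and_not_dvd _ h0 0
  set n := (minpoly k a).rootMultiplicity 0
  simp only [map_zero, sub_zero] at hq hnd
  have hc : q.coeff 0 ≠ 0 := fun h => hnd (Polynomial.X_dvd_iff.2 h)
  have h1 := minpoly.aeval k a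
  rw [hq, ← Polynomial.divX_mul_X_add q] at h1
  have hcomm : ∀ p : Polynomial k, Commute a (Polynomial.aeval a p) := fun p => by
    have := (Polynomial.commute_X p).map (Polynomial.aeval a)
    simpa using this
  refine ⟨n, -((q.coeff 0)⁻¹ • Polynomial.aeval a q.divX),
    ((hcomm _).smul_right _).neg_right, ?_⟩
  simp only [map_mul, map_add, map_pow, Polynomial.aeval_X, Polynomial.aeval_C] at h1
  have h2 : a ^ n * algebraMap k A (q.coeff 0) = - (a ^ (n + 1) * Polynomial.aeval a q.divX) := by
    rw [eq_neg_iff_add_eq_zero, ← h1, mul_add, add_comm, pow_succ, mul_assoc,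
      (hcomm q.divX).eq]
  have h3 : a ^ n = (q.coeff 0)⁻¹ • (a ^ n * algebraMap k A (q.coeff 0)) := by
    rw [← Algebra.commutes, ← Algebra.smul_def, smul_smul, inv_mul_cancel₀ hc, one_smul]
  rw [h3, h2, mul_neg, mul_smul_comm, smul_neg]

/-- Every element has an idempotent multiple with the same stable image. -/
lemma exists_idempotent_of_pow [Module.Finite k A] (a : A) :
    ∃ (n : ℕ) (b : A), Commute a b ∧ IsIdempotentElem (a ^ (n + 1) * b) ∧
      a ^ (n + 1) = a ^ (n + 1) * (a ^ (n + 1) * b) := by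
  obtain ⟨n, c, hc, h⟩ := exists_pow_eq (k := k) a
  have h1 : a ^ (n + 1) = a ^ (n + 2) * c := by
    rw [pow_succ', h, ← mul_assoc, ← pow_succ']
  have h2 : ∀ m, a ^ (n + 1) = a ^ (n + 1 + m) * c ^ m := by
    intro m
    induction m with
    | zero => simp
    | succ m ih =>
      have : a ^ (n + 1 + (m + 1)) = a ^ m * a ^ (n + 2) := by rw [← pow_add]; congr 1; ring
      rw [this, pow_succ' c, mul_assoc, ← mul_assoc _ c, ← h1, ← mul_assoc, ← pow_add,
        add_comm m, ← ih]
  have hs := h2 (n + 1)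
  rw [pow_add a (n + 1), mul_assoc] at hs
  refine ⟨n, c ^ (n + 1), hc.pow_right _, ?_, hs⟩
  have hcc : Commute (a ^ (n + 1)) (c ^ (n + 1)) := hc.pow_pow _ _
  unfold IsIdempotentElem
  rw [mul_assoc, ← mul_assoc (c ^ (n + 1)), ← hcc.eq, mul_assoc (a ^ (n + 1)), ← mul_assoc,
    ← mul_assoc]
  conv_rhs => rw [hs]
  simp only [mul_assoc]

/-- A nonzero projective without maps to a class yields a nonzero idempotent annihilating the
class. -/
lemma exists_idempotent_killing {R : Type} [Ring R] [Algebra k R] [Module.Finite k R]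
    {U : FinMod k R → Prop} (h : ¬ Sincere U) :
    ∃ f : R, IsIdempotentElem f ∧ f ≠ 0 ∧ ∀ N, U N → ∀ x : N, f • x = 0 := by
  classical
  unfold Sincere at h
  push Not at h
  obtain ⟨P, hP, hne, h0⟩ := h
  obtain ⟨ι, _, L, hL, ⟨e⟩⟩ := exists_decomposition P
  have hι : Nonempty ι := by
    by_contra hι
    have := not_nonempty_iff.1 hι
    exact not_subsingleton_iff_nontrivial.2 hne e.toEquiv.subsingleton
  obtain ⟨x⟩ := hι
  let i : L x →ₗ[R] P := e.symm.toLinearMap ∘ₗ LinearMap.single R (fun x => L x) x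
  let r : P →ₗ[R] L x := LinearMap.proj x ∘ₗ e.toLinearMap
  have hri : r ∘ₗ i = LinearMap.id := by ext y; simp [r, i]
  have hproj : Module.Projective R (L x) := Module.Projective.of_split i r hri
  have hL0 : ∀ N, U N → ∀ g : L x →ₗ[R] N, g = 0 := fun N hN g => by
    have := h0 N (g ∘ₗ r) hN
    rw [← LinearMap.comp_id g, ← hri, ← LinearMap.comp_assoc, this, LinearMap.zero_comp]
  obtain ⟨n, g, hg⟩ := Module.Finite.exists_fin' R (L x)
  obtain ⟨s, hs⟩ := Module.projective_lifting_property g LinearMap.id hg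
  have hsum := comp_eq_sum (fun _ : Fin n => reg k R) (L' := L x) s g
  rw [hs] at hsum
  obtain ⟨j, -, hj⟩ := (hL x).exists_bijective_of_sum _ _ (by
    rw [← hsum]
    exact Function.bijective_id)
  let E := LinearEquiv.ofBijective _ hj
  let α : L x →ₗ[R] R := LinearMap.proj j ∘ₗ s
  let γ : R →ₗ[R] L x := E.symm.toLinearMap ∘ₗ g ∘ₗ LinearMap.single R (fun _ => R) j
  have hγα : ∀ y, γ (α y) = y := fun y => E.symm_apply_eq.2 rfl
  have hmul : ∀ z, α (γ z) = z * α (γ 1) := fun z => by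
    rw [← smul_eq_mul, ← map_smul, ← map_smul, smul_eq_mul, mul_one]
  refine ⟨α (γ 1), ?_, fun h => ?_, fun N hN y => ?_⟩
  · unfold IsIdempotentElem
    rw [← hmul, hγα]
  · obtain ⟨y, hy⟩ := @exists_ne _ (hL x).1 (0 : L x)
    refine hy ?_
    rw [← hγα y, ← hγα y, hmul, h, mul_zero, map_zero]
  · exact LinearMap.congr_fun (hL0 N hN ((LinearMap.toSpanSingleton R N y) ∘ₗ α)) (γ 1)

/-- The quotient map onto `A/AeA`, for right modules. -/
def idemQuotMap (k : Type) {A : Type} [Field k] [Ring A] [Algebra k A] (e : A) :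
    Aᵐᵒᵖ →ₐ[k] (IdemQuot A e)ᵐᵒᵖ :=
  { RingHom.op (IdemQuot.mk A e) with
    commutes' := fun _ => rfl }

lemma mk_surjective (e : A) : Function.Surjective (IdemQuot.mk A e) :=
  fun x => Quotient.inductionOn x fun a => ⟨a, rfl⟩

lemma mk_eq_zero (e a : A) : IdemQuot.mk A e a = 0 ↔ a ∈ TwoSidedIdeal.span {e} := by
  rw [← map_zero (IdemQuot.mk A e), ← sub_zero a, ← TwoSidedIdeal.rel_iff, sub_zero]
  exact RingCon.eq _

lemma idemQuotMap_surjective (e : A) : Function.Surjective (idemQuotMap k (A := A) e) := fun x => by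
  obtain ⟨a, ha⟩ := mk_surjective e (unop x)
  exact ⟨op a, congrArg op ha⟩

instance (e : A) [Module.Finite k A] : Module.Finite k (IdemQuot A e)ᵐᵒᵖ :=
  Module.Finite.of_surjective (idemQuotMap k e).toLinearMap (idemQuotMap_surjective (k := k) e)

lemma killed_idemQuotMap {e : A} {N : FinMod k Aᵐᵒᵖ} (h : ∀ x : N, op e • x = 0) :
    Killed (idemQuotMap k e) N := by
  intro r hr
  have h1 : unop r ∈ TwoSidedIdeal.span {e} := (mk_eq_zero e _).1 (congrArg unop hr)
  let I : TwoSidedIdeal A := TwoSidedIdeal.mk' {a | ∀ x : N, op a • x = 0}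
    (fun x => by simp) (fun {a b} ha hb x => by
      rw [MulOpposite.op_add, add_smul, ha x, hb x, add_zero])
    (fun {a} ha x => by rw [MulOpposite.op_neg, neg_smul, ha x, neg_zero])
    (fun {a b} hb x => by rw [op_mul, mul_smul, hb])
    (fun {a b} ha x => by rw [op_mul, mul_smul, ha, smul_zero])
  have h2 := (TwoSidedIdeal.mem_span_iff.1 h1) I (by
    rw [Set.singleton_subset_iff]
    exact (TwoSidedIdeal.mem_mk' _ _ _ _ _ _ _).2 h)
  exact (TwoSidedIdeal.mem_mk' _ _ _ _ _ _ _).1 h2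

/-- Every torsion class is sincere over a quotient by an idempotent. -/
lemma exists_sincere_quotient [Module.Finite k A] {U : FinMod k Aᵐᵒᵖ → Prop} (hU : IsTors U) :
    ∃ e : A, IsIdempotentElem e ∧ (∀ N, U N → Killed (idemQuotMap k e) N) ∧
      Sincere (fun N => U (res (idemQuotMap k e) N)) := by
  have : IsNoetherianRing A := isNoetherian_of_tower k inferInstance
  let s : Set (Ideal A) := {I | ∃ e : A, IsIdempotentElem e ∧ (∀ N, U N → ∀ x : N, op e • x = 0) ∧
    I = Ideal.span {e}}
  obtain ⟨I, ⟨e, he, hk, rfl⟩, hmax⟩ := set_has_maximal_iff_noetherian.2 this s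
    ⟨_, 0, IsIdempotentElem.zero, fun N _ x => by simp, rfl⟩
  have hkill : ∀ N, U N → Killed (idemQuotMap k e) N := fun N hN => killed_idemQuotMap (hk N hN)
  refine ⟨e, he, hkill, ?_⟩
  by_contra hs
  obtain ⟨f, hf, hf0, hfk⟩ := exists_idempotent_killing hs
  obtain ⟨a₀, ha₀⟩ := mk_surjective e (unop f)
  have hme : IdemQuot.mk A e e = 0 := (mk_eq_zero e e).2 (TwoSidedIdeal.subset_span rfl)
  let a := (1 - e) * a₀ * (1 - e)
  have hma : IdemQuot.mk A e a = unop f := by simp [a, hme, ha₀]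
  have hee : e * e = e := he
  have hea : e * a = 0 := by
    have : e * (1 - e) = 0 := by rw [mul_sub, mul_one, hee, sub_self]
    simp only [a, ← mul_assoc, this, zero_mul]
  have hae : a * e = 0 := by
    have : (1 - e) * e = 0 := by rw [sub_mul, one_mul, hee, sub_self]
    simp only [a, mul_assoc, this, mul_zero]
  have hak : ∀ N, U N → ∀ x : N, op a • x = 0 := fun N hN x => by
    have h1 : U (res (idemQuotMap k e) (descend (idemQuotMap_surjective e) N (hkill N hN))) :=
      hU.congr (resDescend _ N (hkill N hN)).symm hN
    have h2 := hfk _ h1 x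
    have h3 : idemQuotMap k e (op a) = f := congrArg op hma
    have h4 := (resDescend (idemQuotMap_surjective (k := k) e) N (hkill N hN)).map_smul (op a) x
    refine h4.symm.trans ?_
    refine Eq.trans (congrArg (resDescend (idemQuotMap_surjective (k := k) e) N (hkill N hN)) ?_)
      (map_zero _)
    rw [← h3] at h2
    exact h2
  obtain ⟨n, b, hab, hε, hpow⟩ := exists_idempotent_of_pow (k := k) a
  set ε := a ^ (n + 1) * b with hεdef
  have hfpow : ∀ m, unop f ^ (m + 1) = unop f := by
    have : unop f * unop f = unop f := congrArg unop hf
    intro m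
    induction m with
    | zero => simp
    | succ m ih => rw [pow_succ, ih, this]
  have hε0 : ε ≠ 0 := fun h => by
    rw [h, mul_zero] at hpow
    have := congrArg (IdemQuot.mk A e) hpow
    rw [map_pow, hma, hfpow, map_zero] at this
    exact hf0 (unop_injective this)
  have heε : e * ε = 0 := by rw [hεdef, pow_succ', ← mul_assoc, ← mul_assoc, hea]; simp
  have hεe : ε * e = 0 := by
    rw [hεdef, (hab.pow_left (n + 1)).eq, pow_succ, mul_assoc, mul_assoc, hae]; simp
  have hεk : ∀ N, U N → ∀ x : N, op ε • x = 0 := fun N hN x => by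
    rw [hεdef, pow_succ', mul_assoc, op_mul, mul_smul, hak N hN, smul_zero]
  refine hmax (Ideal.span {e + ε}) ⟨e + ε, ?_, fun N hN x => ?_, rfl⟩ ?_
  · unfold IsIdempotentElem
    rw [add_mul, mul_add, mul_add, heε, hεe, hee, hε.eq]; simp
  · rw [MulOpposite.op_add, add_smul, hk N hN, hεk N hN, add_zero]
  · refine lt_of_le_of_ne ?_ fun h => ?_
    · rw [Ideal.span_singleton_le_iff_mem, Ideal.mem_span_singleton']
      exact ⟨e, by rw [mul_add, heε, hee, add_zero]⟩
    · have : ε ∈ Ideal.span {e} := by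
        rw [h, Ideal.mem_span_singleton']
        exact ⟨ε, by rw [mul_add, hεe, hε.eq, zero_add]⟩
      obtain ⟨c, hc⟩ := Ideal.mem_span_singleton'.1 this
      apply hε0
      rw [← hc, ← hee, ← mul_assoc, hc, hεe]

end idempotents

end FinMod

namespace FinMod

section finiteness

variable {k A : Type} [Field k] [Ring A] [Algebra k A] [Module.Finite k A]

lemma fac_descend_iff {R R' : Type} [Ring R] [Algebra k R] [Ring R'] [Algebra k R']
    {ψ : R →ₐ[k] R'} (hψ : Function.Surjective ψ) {U : FinMod k R → Prop} {X : FinMod k R}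
    (hX : ∀ N, U N ↔ Fac X N) (hk : Killed ψ X) (N : FinMod k R') :
    U (res ψ N) ↔ Fac (descend hψ X hk) N := by
  rw [hX, ← fac_res_iff hψ]
  exact ⟨fun h => h.congr_left (resDescend hψ X hk),
    fun h => h.congr_left (resDescend hψ X hk).symm⟩

/-- Functorially finite torsion classes are generated by basic support τ-tilting modules. -/
lemma exists_supportTauTilting {U : FinMod k Aᵐᵒᵖ → Prop} (hU : IsTors U) {X : FinMod k Aᵐᵒᵖ}
    (hX : ∀ N, U N ↔ Fac X N) : ∃ M : FinMod k Aᵐᵒᵖ, IsSupportTauTilting k A (toCat M) ∧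
      IsBasicMod A (toCat M) ∧ ∀ N, U N ↔ Fac M N := by
  obtain ⟨e, he, hk, hs⟩ := exists_sincere_quotient hU
  have hψ := idemQuotMap_surjective (k := k) e
  have hU' := hU.res (ψ := idemQuotMap k e)
  have hX' := fac_descend_iff hψ hX (hk X ((hX X).2 (fac_self X)))
  obtain ⟨n, S, hS⟩ := exists_simpleFam k (IdemQuot A e)ᵐᵒᵖ
  obtain ⟨M, hM, hc⟩ := exists_extFam hU' hs hX' hS
  let E : pi (fun i => res (idemQuotMap k e) (M i)) ≃ₗ[Aᵐᵒᵖ] res (idemQuotMap k e) (pi M) :=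
    { toFun := fun x => x
      invFun := fun x => x
      left_inv := fun _ => rfl
      right_inv := fun _ => rfl
      map_add' := fun _ _ => rfl
      map_smul' := fun _ _ => rfl }
  refine ⟨pi (fun i => res (idemQuotMap k e) (M i)),
    ⟨e, he, toCat (pi M), hM.isTauTiltingMod hU' hS, ⟨E⟩⟩,
    isBasicMod (fun i => (hM.indec i).res hψ)
      fun i j ⟨e⟩ => hM.inj i j ⟨unresEquiv hψ e⟩, fun N => ⟨fun hN => ?_, fun hN => ?_⟩⟩
  · have h1 := hU.congr (resDescend hψ N (hk N hN)).symm hN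
    have h2 := (fac_res_iff hψ _ _).2 ((hM.fac_iff hU' hs hX' hc _).1 h1)
    exact (h2.congr_left E).quot (resDescend hψ N (hk N hN)).toLinearMap
      (LinearEquiv.surjective _)
  · exact hU.of_fac (hU'.pi M hM.mem) (hN.congr_left E.symm)

/-- Between a torsion class and a larger functorially finite one there is a functorially finite
one strictly below the latter. -/
lemma exists_isTors_fac_lt {U T : FinMod k Aᵐᵒᵖ → Prop} (hU : IsTors U) {X : FinMod k Aᵐᵒᵖ}
    (hX : ∀ N, U N ↔ Fac X N) (hT : IsTors T) (hTU : ∀ N, T N → U N) (hne : ∃ N, U N ∧ ¬ T N) :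
    ∃ X' : FinMod k Aᵐᵒᵖ, IsTors (Fac X') ∧ (∀ N, T N → Fac X' N) ∧ (∀ N, Fac X' N → U N) ∧
      ∃ N, U N ∧ ¬ Fac X' N := by
  obtain ⟨e, he, hk, hs⟩ := exists_sincere_quotient hU
  have hψ := idemQuotMap_surjective (k := k) e
  have hU' := hU.res (ψ := idemQuotMap k e)
  have hX' := fac_descend_iff hψ hX (hk X ((hX X).2 (fac_self X)))
  obtain ⟨n, S, hS⟩ := exists_simpleFam k (IdemQuot A e)ᵐᵒᵖ
  obtain ⟨M, hM, hc⟩ := exists_extFam hU' hs hX' hS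
  obtain ⟨N₀, hN₀, hN₀'⟩ := hne
  obtain ⟨X', h1, h2, h3, N, h4, h5⟩ := exists_torsion_below hU' hs hX' hM hc
    (hT.res (ψ := idemQuotMap k e)) (fun N => hTU _)
    ⟨descend hψ N₀ (hk N₀ hN₀), hU.congr (resDescend hψ _ _).symm hN₀,
      fun h => hN₀' (hT.congr (resDescend hψ N₀ (hk N₀ hN₀)) h)⟩
  have h6 : U (res (idemQuotMap k e) X') := h3 X' (fac_self X')
  refine ⟨res (idemQuotMap k e) X', isTors_fac_res hψ hU hk h1 h6, fun L hL => ?_,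
    fun L hL => hU.of_fac h6 hL, res (idemQuotMap k e) N, h4, fun h => h5 ((fac_res_iff hψ _ _).1 h)⟩
  have h7 := h2 _ (hT.congr (resDescend hψ L (hk L (hTU L hL))).symm hL)
  exact ((fac_res_iff hψ _ _).2 h7).quot (resDescend hψ L (hk L (hTU L hL))).toLinearMap
    (LinearEquiv.surjective _)

lemma finite_isTors_fac (h : TauTiltingFinite k A) :
    {U : FinMod k Aᵐᵒᵖ → Prop | IsTors U ∧ ∃ X, U = Fac X}.Finite := by
  obtain ⟨n, R, hR⟩ := h
  have key : ∀ U : {U : FinMod k Aᵐᵒᵖ → Prop | IsTors U ∧ ∃ X, U = Fac X}, ∃ (i : Fin n)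
      (M : FinMod k Aᵐᵒᵖ), Nonempty (M ≃ₗ[Aᵐᵒᵖ] R i) ∧ ∀ N, U.1 N ↔ Fac M N := by
    rintro ⟨U, hU, X, rfl⟩
    obtain ⟨M, h1, h2, h3⟩ := exists_supportTauTilting hU (X := X) fun N => Iff.rfl
    obtain ⟨i, hi⟩ := hR _ h1 h2
    exact ⟨i, M, hi, h3⟩
  choose i M hM hF using key
  refine Set.finite_coe_iff.1 (Finite.of_injective i fun U V hUV => ?_)
  obtain ⟨e⟩ := hM U
  obtain ⟨e'⟩ := hM V
  rw [← hUV] at e'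
  refine Subtype.ext (funext fun N => propext ?_)
  rw [hF, hF]
  exact ⟨fun h => h.congr_left (e'.trans e.symm), fun h => h.congr_left (e.trans e'.symm)⟩

lemma IsTors.exists_fac (h : TauTiltingFinite k A) {T : FinMod k Aᵐᵒᵖ → Prop} (hT : IsTors T) :
    ∃ X, T = Fac X := by
  have hfin : {U : FinMod k Aᵐᵒᵖ → Prop | (IsTors U ∧ ∃ X, U = Fac X) ∧ ∀ N, T N → U N}.Finite :=
    (finite_isTors_fac h).subset fun U hU => hU.1
  have hall : ∀ N : FinMod k Aᵐᵒᵖ, Fac (reg k Aᵐᵒᵖ) N := fun N => by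
    obtain ⟨n, g, hg⟩ := Module.Finite.exists_fin' Aᵐᵒᵖ N
    exact ⟨n, g, hg⟩
  obtain ⟨U, ⟨⟨hU, X, rfl⟩, hTU⟩, hmin⟩ := hfin.exists_minimal
    ⟨fun _ => True, ⟨⟨fun _ _ _ => trivial, fun _ _ _ _ => trivial, fun _ _ => trivial⟩,
      reg k Aᵐᵒᵖ, funext fun N => (eq_true (hall N)).symm⟩, fun _ _ => trivial⟩
  refine ⟨X, ?_⟩
  by_contra hne
  have hne' : ∃ N, Fac X N ∧ ¬ T N := by
    by_contra hcon
    push Not at hcon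
    exact hne (funext fun N => propext ⟨hTU N, hcon N⟩)
  obtain ⟨X', h1, h2, h3, N, h4, h5⟩ := exists_isTors_fac_lt hU (fun N => Iff.rfl) hT hTU hne'
  exact h5 (hmin ⟨⟨h1, X', rfl⟩, h2⟩ h3 N h4)

/-- A τ-tilting finite algebra has no infinite families of Hom-orthogonal modules. -/
lemma not_tauTiltingFinite {Λ : Type} [Infinite Λ] (S : Λ → FinMod k Aᵐᵒᵖ)
    (hS : ∀ l, Nontrivial (S l)) (horth : ∀ l m, l ≠ m → ∀ f : S l →ₗ[Aᵐᵒᵖ] S m, f = 0) :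
    ¬ TauTiltingFinite k A := by
  intro h
  let T : Λ → FinMod k Aᵐᵒᵖ → Prop := fun l N => ∀ f : N →ₗ[Aᵐᵒᵖ] S l, f = 0
  have hT : ∀ l, IsTors (T l) := fun l => by
    refine ⟨fun {M N} f hf hM g => ?_, fun {M N} f hf hK hN g => ?_, fun M hM f => ?_⟩
    · ext x
      obtain ⟨y, rfl⟩ := hf x
      exact LinearMap.congr_fun (hM (g ∘ₗ f)) y
    · have h1 : LinearMap.ker f ≤ LinearMap.ker g := fun x hx =>
        LinearMap.congr_fun (hK (g ∘ₗ (LinearMap.ker f).subtype)) ⟨x, hx⟩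
      let g' : N →ₗ[Aᵐᵒᵖ] S l := (LinearMap.ker f).liftQ g h1 ∘ₗ
        (f.quotKerEquivOfSurjective hf).symm.toLinearMap
      ext x
      have h2 : g' (f x) = g x := by
        have : (f.quotKerEquivOfSurjective hf).symm (f x) = (LinearMap.ker f).mkQ x := by
          rw [LinearEquiv.symm_apply_eq]; rfl
        show (LinearMap.ker f).liftQ g h1 ((f.quotKerEquivOfSurjective hf).symm (f x)) = _
        rw [this]
        rfl
      rw [← h2, hN g']
      rfl
    · ext x
      rw [Subsingleton.elim x 0, map_zero, map_zero]
  have hinj : Function.Injective T := fun l m hlm => by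
    by_contra hne
    have h1 : T m (S l) := horth l m hne
    rw [← hlm] at h1
    obtain ⟨x, hx⟩ := @exists_ne _ (hS l) (0 : S l)
    exact hx (LinearMap.congr_fun (h1 LinearMap.id) x)
  refine Set.infinite_range_of_injective hinj ((finite_isTors_fac h).subset ?_)
  rintro _ ⟨l, rfl⟩
  exact ⟨hT l, (hT l).exists_fac h⟩

end finiteness

end FinMod

namespace FinMod

section repFinite

variable {k A : Type} [Field k] [Ring A] [Algebra k A]

lemma finite_of_isSupportTauTilting {M : ModuleCat.{0} Aᵐᵒᵖ} (h : IsSupportTauTilting k A M) :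
    Module.Finite Aᵐᵒᵖ M := by
  obtain ⟨e, -, N, ⟨hN, -⟩, ⟨E⟩⟩ := h
  let σ := RingHom.op (IdemQuot.mk A e)
  have hσ : Function.Surjective σ := idemQuotMap_surjective (k := k) e
  let _ : Module Aᵐᵒᵖ N := Module.compHom N σ
  obtain ⟨n, s, hs⟩ := Module.Finite.exists_fin (R := (IdemQuot A e)ᵐᵒᵖ) (M := N)
  have hfin : Module.Finite Aᵐᵒᵖ N := by
    refine Module.finite_def.2 ((Submodule.fg_iff_exists_finite_generating_family).2
      ⟨Fin n, inferInstance, s, ?_⟩)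
    rw [eq_top_iff]
    rintro x -
    have hx : x ∈ Submodule.span (IdemQuot A e)ᵐᵒᵖ (Set.range s) := hs ▸ Submodule.mem_top
    induction hx using Submodule.span_induction with
    | mem x hx => exact Submodule.subset_span hx
    | zero => exact Submodule.zero_mem _
    | add x y _ _ hx hy => exact Submodule.add_mem _ hx hy
    | smul a x _ hx =>
      obtain ⟨a, rfl⟩ := hσ a
      exact Submodule.smul_mem _ a hx
  exact Module.Finite.equiv E.symm

lemma eq_of_isBasicMod {ι : Type} {L : ι → ModuleCat.{0} Aᵐᵒᵖ} {M : ModuleCat.{0} Aᵐᵒᵖ}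
    (hM : IsBasicMod A M) (e : M ≃ₗ[Aᵐᵒᵖ] (∀ x, L x)) (hL : ∀ x, Nontrivial (L x)) {x y : ι}
    (f : L x ≃ₗ[Aᵐᵒᵖ] L y) : x = y := by
  classical
  by_contra hxy
  let r : (∀ x, L x) →ₗ[Aᵐᵒᵖ] L x := LinearMap.proj x
  obtain ⟨e₁⟩ := exists_complement (LinearMap.single Aᵐᵒᵖ (fun x => L x) x) r (by ext z; simp [r])
  let i' : L y →ₗ[Aᵐᵒᵖ] LinearMap.ker r :=
    (LinearMap.single Aᵐᵒᵖ (fun x => L x) y).codRestrict _ fun z => by simp [r, hxy]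
  let r' : LinearMap.ker r →ₗ[Aᵐᵒᵖ] L y := LinearMap.proj y ∘ₗ (LinearMap.ker r).subtype
  obtain ⟨e₂⟩ := exists_complement i' r' (LinearMap.ext fun z =>
    Pi.single_eq_same (M := fun x => L x) y z)
  have := hM (L x) (ModuleCat.of _ (LinearMap.ker r')) ⟨e.trans (e₁.trans
    (LinearEquiv.prodCongr (LinearEquiv.refl _ _) (e₂.trans
      (LinearEquiv.prodCongr f.symm (LinearEquiv.refl _ _)))))⟩
  exact not_subsingleton_iff_nontrivial.2 (hL x) this

/-- Representation-finite algebras are τ-tilting finite. -/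
theorem tauTiltingFinite_of_representationFinite [Module.Finite k A]
    (h : RepresentationFinite A) : TauTiltingFinite k A := by
  classical
  obtain ⟨n, R, hR⟩ := h
  let E := Fintype.equivFin (Finset (Fin n))
  refine ⟨Fintype.card (Finset (Fin n)), fun j => ModuleCat.of _ (∀ i : E.symm j, R i),
    fun M hM hb => ?_⟩
  have hfin := finite_of_isSupportTauTilting hM
  obtain ⟨ι, _, L, hL, ⟨e⟩⟩ := exists_decomposition (ofFinite k (R := Aᵐᵒᵖ) M)
  choose j hj using fun x => hR (toCat (L x)) (inferInstanceAs (Module.Finite Aᵐᵒᵖ (L x)))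
    (hL x).indecomposable
  have hinj : Function.Injective j := fun x y hxy => by
    obtain ⟨f⟩ := hj x
    obtain ⟨g⟩ := hj y
    have g' : toCat (L y) ≃ₗ[Aᵐᵒᵖ] R (j x) := by
      rw [hxy]
      exact g
    exact eq_of_isBasicMod (L := fun x => toCat (L x)) hb e (fun x => (hL x).1) (f.trans g'.symm)
  let s : Finset (Fin n) := Finset.univ.image j
  have hmem : ∀ x, j x ∈ s := fun x => Finset.mem_image_of_mem j (Finset.mem_univ x)
  let φ : ι ≃ s := Equiv.ofBijective (fun x => ⟨j x, hmem x⟩)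
    ⟨fun x y hxy => hinj (congrArg Subtype.val hxy), fun ⟨i, hi⟩ => by
      obtain ⟨x, -, rfl⟩ := Finset.mem_image.1 hi
      exact ⟨x, rfl⟩⟩
  refine ⟨E s, ?_⟩
  have key : Nonempty (M ≃ₗ[Aᵐᵒᵖ] (∀ i : s, R i)) :=
    ⟨e.trans ((LinearEquiv.piCongrRight fun x => (hj x).some).trans
      (LinearEquiv.piCongrLeft Aᵐᵒᵖ (fun i : s => R i) φ))⟩
  show Nonempty (M ≃ₗ[Aᵐᵒᵖ] (∀ i : E.symm (E s), R i))
  rw [E.symm_apply_apply]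
  exact key

end repFinite

end FinMod

section altProd

lemma altProd_succ {R : Type} [Monoid R] (a b : R) (m : ℕ) :
    altProd a b (m + 1) = altProd a b m * if m % 2 = 0 then a else b := by
  simp [altProd, List.range_succ]

@[simp] lemma altProd_zero {R : Type} [Monoid R] (a b : R) : altProd a b 0 = 1 := rfl

lemma map_altProd {R S : Type} [Monoid R] [Monoid S] (f : R →* S) (a b : R) (m : ℕ) :
    f (altProd a b m) = altProd (f a) (f b) m := by
  induction m with
  | zero => simp
  | succ m ih => rw [altProd_succ, altProd_succ, map_mul, ih]; split_ifs <;> rfl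

lemma altProd_eq_of_braid {R : Type} [Ring R] {a b : R} (ha : a * a = -a) (hb : b * b = -b)
    (h : a * b * a = b * a * b) (m : ℕ) :
    altProd a b (m + 3) = (-1) ^ m * (a * b * a) := by
  induction m with
  | zero => simp [altProd, List.range_succ, mul_assoc]
  | succ m ih =>
    rw [show m + 1 + 3 = m + 3 + 1 by ring, altProd_succ, ih, pow_succ]
    split_ifs
    · simp [mul_assoc, ha]
    · rw [h]; simp [mul_assoc, hb]

lemma altProd_comm_of_braid {R : Type} [Ring R] {a b : R} (ha : a * a = -a) (hb : b * b = -b)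
    (h : a * b * a = b * a * b) {m : ℕ} (hm : m ≠ 1) (hm2 : m = 2 → a * b = b * a) :
    altProd a b m = altProd b a m := by
  match m, hm, hm2 with
  | 0, _, _ => rfl
  | 2, _, h2 => simpa [altProd, List.range_succ] using h2 rfl
  | m + 3, _, _ => rw [altProd_eq_of_braid ha hb h, altProd_eq_of_braid hb ha h.symm, h]

end altProd

namespace Hecke0

variable {k : Type} [Field k] {B : Type} {M : CoxeterMatrix B}

/-- The presentation map. -/
def mkAlg (k : Type) [Field k] {B : Type} (M : CoxeterMatrix B) : FreeAlgebra k B →ₐ[k] Hecke0 k M :=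
  RingQuot.mkAlgHom k (heckeRel k M)

/-- The standard generators. -/
def gen (k : Type) [Field k] {B : Type} (M : CoxeterMatrix B) (i : B) : Hecke0 k M :=
  mkAlg k M (FreeAlgebra.ι k i)

lemma gen_mul_self (i : B) : gen k M i * gen k M i = - gen k M i := by
  have := RingQuot.mkAlgHom_rel k (s := heckeRel k M) (Or.inl ⟨i, rfl, rfl⟩)
  rw [map_mul, map_neg] at this
  exact this

lemma gen_braid (i j : B) :
    altProd (gen k M i) (gen k M j) (M i j) = altProd (gen k M j) (gen k M i) (M i j) := by
  have := RingQuot.mkAlgHom_rel k (s := heckeRel k M) (Or.inr ⟨i, j, rfl, rfl⟩)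
  have h := map_altProd (mkAlg k M : FreeAlgebra k B →* Hecke0 k M)
  exact (h _ _ _).symm.trans (Eq.trans this (h _ _ _))

lemma adjoin_gen : Algebra.adjoin k (Set.range (gen k M)) = ⊤ := by
  have h1 : (mkAlg k M).range = ⊤ :=
    (AlgHom.range_eq_top _).2 (RingQuot.mkAlgHom_surjective k (heckeRel k M))
  have h2 : Set.range (gen k M) = mkAlg k M '' Set.range (FreeAlgebra.ι k) := by
    rw [← Set.range_comp]; rfl
  rw [h2, ← AlgHom.map_adjoin, FreeAlgebra.adjoin_range_ι, Algebra.map_top, h1]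

/-- The universal property. -/
lemma exists_lift {C : Type} [Ring C] [Algebra k C] (t : B → C) (h1 : ∀ i, t i * t i = - t i)
    (h2 : ∀ i j, altProd (t i) (t j) (M i j) = altProd (t j) (t i) (M i j)) :
    ∃ φ : Hecke0 k M →ₐ[k] C, ∀ i, φ (gen k M i) = t i := by
  have h : ∀ ⦃x y : FreeAlgebra k B⦄, heckeRel k M x y →
      FreeAlgebra.lift k t x = FreeAlgebra.lift k t y := by
    rintro x y (⟨i, rfl, rfl⟩ | ⟨i, j, rfl, rfl⟩)
    · simp [h1]
    · have := map_altProd (FreeAlgebra.lift k t : FreeAlgebra k B →* C)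
      refine (this _ _ _).trans (Eq.trans ?_ (this _ _ _).symm)
      simpa using h2 i j
  refine ⟨RingQuot.liftAlgHom k ⟨FreeAlgebra.lift k t, h⟩, fun i => ?_⟩
  exact (RingQuot.liftAlgHom_mkAlgHom_apply k (FreeAlgebra.lift k t) h (FreeAlgebra.ι k i)).trans
    (by simp)

end Hecke0

namespace FinMod

section hecke

variable {k : Type} [Field k] {B : Type} {M : CoxeterMatrix B}

/-- Right modules over the 0-Hecke algebra from families of idempotents. -/
lemma exists_heckeModule {d : Type} [Fintype d] [DecidableEq d] (a : B → Matrix d d k)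
    (h1 : ∀ i, a i * a i = a i)
    (h2 : ∀ i j, i ≠ j → (a i * a j = a j * a i) ∨
      M i j ≠ 2 ∧ a i * a j * a i = a j * a i * a j) :
    ∃ (V : FinMod k (Hecke0 k M)ᵐᵒᵖ) (e : V ≃ₗ[k] (d → k)),
      ∀ i v, e (op (Hecke0.gen k M i) • v) = -(a i).mulVec (e v) := by
  obtain ⟨φ, hφ⟩ := Hecke0.exists_lift (k := k) (M := M) (C := (Matrix d d k)ᵐᵒᵖ)
    (fun i => op (-(a i))) (fun i => by rw [← op_mul, neg_mul_neg, h1, MulOpposite.op_neg, neg_neg])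
    (fun i j => by
      rcases eq_or_ne i j with rfl | hij
      · rfl
      · refine altProd_comm_of_braid (by rw [← op_mul, neg_mul_neg, h1, MulOpposite.op_neg, neg_neg])
          (by rw [← op_mul, neg_mul_neg, h1, MulOpposite.op_neg, neg_neg]) ?_ (M.off_diagonal i j hij) ?_
        · simp only [← op_mul, mul_neg, neg_mul, neg_neg]
          congr 2
          rcases h2 i j hij with h | ⟨-, h⟩
          · rw [← h, ← mul_assoc, h1, h, ← mul_assoc, h1]
          · rw [← mul_assoc, ← mul_assoc, h]
        · intro hm
          rcases h2 i j hij with h | ⟨h, -⟩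
          · rw [← op_mul, ← op_mul, neg_mul_neg, neg_mul_neg, h]
          · exact absurd hm h)
  let Φ : (Hecke0 k M)ᵐᵒᵖ →ₐ[k] Module.End k (d → k) :=
    (Matrix.toLinAlgEquiv' : Matrix d d k ≃ₐ[k] _).toAlgHom.comp (AlgHom.opComm φ)
  let _ : Module (Hecke0 k M)ᵐᵒᵖ (d → k) := Module.compHom (d → k) Φ.toRingHom
  have _ : IsScalarTower k (Hecke0 k M)ᵐᵒᵖ (d → k) := ⟨fun c r x => by
    show Φ (c • r) x = c • (Φ r x)
    rw [map_smul]; rfl⟩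
  refine ⟨{ carrier := d → k }, LinearEquiv.refl k _, fun i v => ?_⟩
  show Φ (op (Hecke0.gen k M i)) v = -(a i).mulVec v
  have : Φ (op (Hecke0.gen k M i)) = Matrix.toLin' (-(a i)) := by
    show Matrix.toLin' (unop (φ (Hecke0.gen k M i))) = _
    rw [hφ]; rfl
  rw [this, Matrix.toLin'_apply, Matrix.neg_mulVec]

/-- Linear maps commuting with the generators are maps of modules. -/
lemma map_smul_of_gen {V W : FinMod k (Hecke0 k M)ᵐᵒᵖ} (f : V →ₗ[k] W)
    (hf : ∀ i v, f (op (Hecke0.gen k M i) • v) = op (Hecke0.gen k M i) • f v)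
    (h : (Hecke0 k M)ᵐᵒᵖ) (v : V) : f (h • v) = h • f v := by
  have key : ∀ x ∈ Algebra.adjoin k (Set.range (Hecke0.gen k M)), ∀ v, f (op x • v) = op x • f v := by
    intro x hx
    induction hx using Algebra.adjoin_induction with
    | mem x hx => obtain ⟨i, rfl⟩ := hx; exact hf i
    | algebraMap c =>
      intro v
      have : op (algebraMap k (Hecke0 k M) c) = algebraMap k (Hecke0 k M)ᵐᵒᵖ c := rfl
      rw [this, algebraMap_smul, algebraMap_smul, map_smul]
    | add x y _ _ hx hy => intro v; rw [MulOpposite.op_add, add_smul, add_smul, map_add, hx, hy]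
    | mul x y _ _ hx hy => intro v; rw [op_mul, mul_smul, mul_smul, hy, hx]
  exact key (unop h) (by rw [Hecke0.adjoin_gen]; trivial) v

end hecke

end FinMod

namespace FinMod

section families

variable {k : Type} [Field k] {B : Type} {M : CoxeterMatrix B}

lemma not_tauTiltingFinite_of_matrices [Infinite k] [Module.Finite k (Hecke0 k M)] {d : Type}
    [Fintype d] [DecidableEq d] [Nonempty d] (a : k → B → Matrix d d k)
    (h1 : ∀ l i, a l i * a l i = a l i)
    (h2 : ∀ l i j, i ≠ j → (a l i * a l j = a l j * a l i) ∨
      M i j ≠ 2 ∧ a l i * a l j * a l i = a l j * a l i * a l j)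
    (horth : ∀ l m, l ≠ m → ∀ F : Matrix d d k, (∀ i, F * a l i = a m i * F) → F = 0) :
    ¬ TauTiltingFinite k (Hecke0 k M) := by
  choose S e he using fun l => exists_heckeModule (M := M) (a l) (h1 l) (h2 l)
  refine not_tauTiltingFinite S (fun l => (e l).toEquiv.nontrivial) fun l m hlm f => ?_
  let f' : (d → k) →ₗ[k] (d → k) :=
    (e m).toLinearMap ∘ₗ (f.restrictScalars k) ∘ₗ (e l).symm.toLinearMap
  have hf : ∀ v, f' (e l v) = e m (f v) := fun v => by simp [f']
  have h0 := horth l m hlm (LinearMap.toMatrix' f') fun i => by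
    apply Matrix.toLin'.injective
    rw [Matrix.toLin'_mul, Matrix.toLin'_mul, Matrix.toLin'_toMatrix']
    refine LinearMap.ext fun x => ?_
    obtain ⟨v, rfl⟩ : ∃ v, e l v = x := (e l).surjective _
    have h3 : f' (-(a l i).mulVec (e l v)) = -(a m i).mulVec (f' (e l v)) := by
      rw [← he, hf, hf, map_smul, he]
    rw [map_neg, neg_inj] at h3
    simpa using h3
  have h0' : f' = 0 := by
    rw [← Matrix.toLin'_toMatrix' f', h0, map_zero]
  ext v
  apply (e m).injective
  rw [← hf, h0']; simp

/-- Three matrices, the outer two commuting. -/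
def pathFst (k : Type) [Field k] : Matrix (Fin 8) (Fin 8) k :=
  Matrix.diagonal ![0, 0, 1, 0, 1, 1, 1, 0]

def pathSnd {k : Type} [Field k] (l : k) : Matrix (Fin 8) (Fin 8) k :=
  !![1, 0, 0, 0, 1, 0, 1, l;
     0, 1, 0, 0, 0, 1, -1, -1;
     0, 0, 1, 0, 1, 0, 0, 0;
     0, 0, 0, 1, 0, 1, 0, 0;
     0, 0, 0, 0, 0, 0, 0, 0;
     0, 0, 0, 0, 0, 0, 0, 0;
     0, 0, 0, 0, 0, 0, 0, 0;
     0, 0, 0, 0, 0, 0, 0, 0]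

def pathTrd (k : Type) [Field k] : Matrix (Fin 8) (Fin 8) k :=
  Matrix.diagonal ![0, 0, 0, 1, 1, 1, 0, 1]

lemma pathFst_sq : pathFst k * pathFst k = pathFst k := by
  rw [pathFst, Matrix.diagonal_mul_diagonal]; congr 1; ext p; fin_cases p <;> simp

lemma pathTrd_sq : pathTrd k * pathTrd k = pathTrd k := by
  rw [pathTrd, Matrix.diagonal_mul_diagonal]; congr 1; ext p; fin_cases p <;> simp

lemma pathFst_mul_pathTrd : pathFst k * pathTrd k = pathTrd k * pathFst k := by
  rw [pathFst, pathTrd, Matrix.diagonal_mul_diagonal, Matrix.diagonal_mul_diagonal]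
  congr 1; ext p; exact mul_comm _ _

lemma pathSnd_sq (l : k) : pathSnd l * pathSnd l = pathSnd l := by
  ext p q; fin_cases p <;> fin_cases q <;> simp [pathSnd, Matrix.mul_apply, Fin.sum_univ_succ]

lemma pathFst_braid (l : k) :
    pathFst k * pathSnd l * pathFst k = pathSnd l * pathFst k * pathSnd l := by
  ext p q
  rw [pathFst, Matrix.mul_diagonal, Matrix.diagonal_mul, Matrix.mul_apply]
  simp only [Matrix.mul_diagonal]
  fin_cases p <;> fin_cases q <;> simp [pathSnd, Fin.sum_univ_succ]

lemma pathTrd_braid (l : k) :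
    pathTrd k * pathSnd l * pathTrd k = pathSnd l * pathTrd k * pathSnd l := by
  ext p q
  rw [pathTrd, Matrix.mul_diagonal, Matrix.diagonal_mul, Matrix.mul_apply]
  simp only [Matrix.mul_diagonal]
  fin_cases p <;> fin_cases q <;> simp [pathSnd, Fin.sum_univ_succ]

lemma path_orthogonal {l m : k} (hlm : l ≠ m) (F : Matrix (Fin 8) (Fin 8) k)
    (h1 : F * pathFst k = pathFst k * F) (h2 : F * pathSnd l = pathSnd m * F)
    (h3 : F * pathTrd k = pathTrd k * F) : F = 0 := by
  have e1 : ∀ p q, _ := fun p q => congrFun (congrFun h1 p) q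
  have e3 : ∀ p q, _ := fun p q => congrFun (congrFun h3 p) q
  have e2 : ∀ p q, _ := fun p q => congrFun (congrFun h2 p) q
  simp only [pathFst, pathTrd, Matrix.mul_diagonal, Matrix.diagonal_mul] at e1 e3
  simp only [Matrix.mul_apply, Fin.sum_univ_succ] at e2
  simp [Fin.forall_fin_succ, pathSnd] at e1 e2 e3
  obtain ⟨⟨f02, f04, f05, f06⟩, ⟨f12, f14, f15, f16⟩, ⟨f20, f21, f23, f27⟩, ⟨f32, f34, f35, f36⟩,
    ⟨f40, f41, f43, f47⟩, ⟨f50, f51, f53, f57⟩, ⟨f60, f61, f63, f67⟩, f72, f74, f75, f76⟩ := e1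
  obtain ⟨⟨f03, -, -, f07⟩, ⟨f13, -, -, f17⟩, ⟨-, f24, f25, -⟩, ⟨f30, f31, -, -⟩,
    ⟨-, -, f42, f46⟩, ⟨-, -, f52, f56⟩, ⟨-, f64, f65, -⟩, f70, f71, -, -⟩ := e3
  simp only [f02, f04, f05, f06, f12, f14, f15, f16, f20, f21, f23, f27, f32, f34, f35, f36, f40,
    f41, f43, f47, f50, f51, f53, f57, f60, f61, f63, f67, f72, f74, f75, f76, f03, f07, f13, f17,
    f24, f25, f30, f31, f42, f46, f52, f56, f64, f65, f70, f71, add_zero, zero_add, mul_zero,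
    neg_zero, zero_mul, true_and, and_true] at e2
  obtain ⟨⟨-, -, a3, a4, a5, a6⟩, ⟨-, -, b3, b4, b5, b6⟩, ⟨c1, c2, c3⟩, ⟨d1, d2, d3⟩, ⟨d4, -⟩,
    d5, -⟩ := e2
  have f01 : F 0 1 = 0 := a4.trans c2.symm
  have f10 : F 1 0 = 0 := b3.trans d1.symm
  have f11 : F 1 1 = F 0 0 := by linear_combination f10 - a5 - f01 - b5
  have f77 : F 7 7 = F 0 0 := by linear_combination b6 - l * f10 + f11
  have f00 : F 0 0 = 0 := by
    have h : F 0 0 * (l - m) = 0 := by linear_combination a6 + f01 + m * f77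
    exact (mul_eq_zero.1 h).resolve_right (sub_ne_zero.2 hlm)
  rw [f00] at f11 f77 a3 a5
  rw [f11] at b4
  rw [f01, neg_zero, add_zero] at a5
  rw [← a3] at c1
  rw [← b4] at d2
  have hF : ∀ p q, F p q = 0 := by
    simp only [Fin.forall_fin_succ]
    simp [f02, f04, f05, f06, f12, f14, f15, f16, f20, f21, f23, f27, f32, f34, f35, f36, f40,
      f41, f43, f47, f50, f51, f53, f57, f60, f61, f63, f67, f72, f74, f75, f76, f03, f07, f13,
      f17, f24, f25, f30, f31, f42, f46, f52, f56, f64, f65, f70, f71, f00, f01, f10, f11, f77,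
      ← a3, ← a4, ← a5, ← b3, ← b4, c1, ← c3, d2, ← d3, d4, d5]
  exact Matrix.ext hF

/-- Four matrices, those of the first pair commuting with those of the second. -/
def cycleFst {k : Type} [Field k] (l : k) : Matrix (Fin 4) (Fin 4) k :=
  !![1, 0, 0, 0; 0, 0, 0, 0; 0, 0, 1, 0; l, 0, 0, 0]

def cycleSnd (k : Type) [Field k] : Matrix (Fin 4) (Fin 4) k :=
  !![0, 0, 0, 0; 0, 1, 0, 0; 0, 1, 0, 0; 0, 0, 0, 1]

def cycleTrd (k : Type) [Field k] : Matrix (Fin 4) (Fin 4) k :=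
  !![1, 0, 0, 0; 0, 0, 0, 0; 1, 0, 0, 0; 0, 0, 0, 1]

def cycleFth (k : Type) [Field k] : Matrix (Fin 4) (Fin 4) k :=
  !![0, 0, 0, 0; 0, 1, 0, 0; 0, 0, 1, 0; 0, 1, 0, 0]

lemma cycle_sq (l : k) : cycleFst l * cycleFst l = cycleFst l ∧
    cycleSnd k * cycleSnd k = cycleSnd k ∧ cycleTrd k * cycleTrd k = cycleTrd k ∧
    cycleFth k * cycleFth k = cycleFth k := by
  refine ⟨?_, ?_, ?_, ?_⟩ <;>
    (simp [cycleFst, cycleSnd, cycleTrd, cycleFth]; try (ext x; fin_cases x <;> rfl))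

lemma cycle_comm (l : k) : cycleFst l * cycleTrd k = cycleTrd k * cycleFst l ∧
    cycleFst l * cycleFth k = cycleFth k * cycleFst l ∧
    cycleSnd k * cycleTrd k = cycleTrd k * cycleSnd k ∧
    cycleSnd k * cycleFth k = cycleFth k * cycleSnd k := by
  refine ⟨?_, ?_, ?_, ?_⟩ <;>
    (simp [cycleFst, cycleSnd, cycleTrd, cycleFth]; try (ext x; fin_cases x <;> rfl))

lemma cycle_braid (l : k) :
    cycleFst l * cycleSnd k * cycleFst l = cycleSnd k * cycleFst l * cycleSnd k ∧
    cycleTrd k * cycleFth k * cycleTrd k = cycleFth k * cycleTrd k * cycleFth k := by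
  refine ⟨?_, ?_⟩ <;>
    (simp [cycleFst, cycleSnd, cycleTrd, cycleFth]; try (ext x; fin_cases x <;> rfl))

lemma cycle_orthogonal {l m : k} (hlm : l ≠ m) (F : Matrix (Fin 4) (Fin 4) k)
    (h1 : F * cycleFst l = cycleFst m * F) (h2 : F * cycleSnd k = cycleSnd k * F)
    (h3 : F * cycleTrd k = cycleTrd k * F) (h4 : F * cycleFth k = cycleFth k * F) : F = 0 := by
  have e1 : ∀ p q, _ := fun p q => congrFun (congrFun h1 p) q
  have e2 : ∀ p q, _ := fun p q => congrFun (congrFun h2 p) q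
  have e3 : ∀ p q, _ := fun p q => congrFun (congrFun h3 p) q
  have e4 : ∀ p q, _ := fun p q => congrFun (congrFun h4 p) q
  simp only [Matrix.mul_apply, Fin.sum_univ_succ] at e1 e2 e3 e4
  simp [Fin.forall_fin_succ, cycleFst, cycleSnd, cycleTrd, cycleFth] at e1 e2 e3 e4
  have f00 : F 0 0 = 0 := by
    have h : F 0 0 * (l - m) = 0 := by grind
    exact (mul_eq_zero.1 h).resolve_right (sub_ne_zero.2 hlm)
  ext p q
  fin_cases p <;> fin_cases q <;> simp <;> grind

lemma not_tauTiltingFinite_of_path [Infinite k] [Module.Finite k (Hecke0 k M)] {i j p : B}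
    (hij : i ≠ j) (hjp : j ≠ p) (hip : i ≠ p) (h1 : M i j ≠ 2) (h2 : M j p ≠ 2) :
    ¬ TauTiltingFinite k (Hecke0 k M) := by
  classical
  refine not_tauTiltingFinite_of_matrices (M := M) (fun l x =>
    if x = i then pathFst k else if x = j then pathSnd l else if x = p then pathTrd k else 0)
    (fun l x => ?_) (fun l x y hxy => ?_) fun l m hlm F hF => ?_
  · split_ifs
    exacts [pathFst_sq, pathSnd_sq l, pathTrd_sq, mul_zero _]
  · have h1' := M.symmetric i j
    have h2' := M.symmetric j p
    split_ifs <;> subst_vars <;>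
      simp_all [pathFst_mul_pathTrd, pathFst_braid, pathTrd_braid, -mul_eq_mul_left_iff]
  · have e1 := hF i
    have e2 := hF j
    have e3 := hF p
    simp only [hij.symm, hjp.symm, hip.symm, if_true, if_false] at e1 e2 e3
    exact path_orthogonal hlm F e1 e2 e3

lemma not_tauTiltingFinite_of_disjoint [Infinite k] [Module.Finite k (Hecke0 k M)] {i j p q : B}
    (hij : i ≠ j) (hpq : p ≠ q) (hip : i ≠ p) (hiq : i ≠ q) (hjp : j ≠ p) (hjq : j ≠ q)
    (h1 : M i j ≠ 2) (h2 : M p q ≠ 2) :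
    ¬ TauTiltingFinite k (Hecke0 k M) := by
  classical
  refine not_tauTiltingFinite_of_matrices (M := M) (fun l x =>
    if x = i then cycleFst l else if x = j then cycleSnd k else if x = p then cycleTrd k else
      if x = q then cycleFth k else 0)
    (fun l x => ?_) (fun l x y hxy => ?_) fun l m hlm F hF => ?_
  · obtain ⟨a, b, c, d⟩ := cycle_sq l
    split_ifs
    exacts [a, b, c, d, mul_zero _]
  · have h1' := M.symmetric i j
    have h2' := M.symmetric p q
    obtain ⟨a, b, c, d⟩ := cycle_comm l
    obtain ⟨e, f⟩ := cycle_braid l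
    split_ifs <;> subst_vars <;> simp_all
  · have e1 := hF i
    have e2 := hF j
    have e3 := hF p
    have e4 := hF q
    simp only [hij.symm, hpq.symm, hip.symm, hiq.symm, hjp.symm, hjq.symm, if_true, if_false]
      at e1 e2 e3 e4
    exact cycle_orthogonal hlm F e1 e2 e3 e4

/-- Two edges of the Coxeter diagram force infinitely many support τ-tilting modules. -/
theorem not_tauTiltingFinite_of_two_edges [Infinite k] [Module.Finite k (Hecke0 k M)]
    {i j p q : B} (hij : i ≠ j) (hpq : p ≠ q) (h1 : M i j ≠ 2) (h2 : M p q ≠ 2)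
    (hne : ¬ (p = i ∧ q = j)) (hne' : ¬ (p = j ∧ q = i)) :
    ¬ TauTiltingFinite k (Hecke0 k M) := by
  have h1' : M j i ≠ 2 := by rwa [M.symmetric]
  have h2' : M q p ≠ 2 := by rwa [M.symmetric]
  by_cases hip : i = p
  · subst hip
    exact not_tauTiltingFinite_of_path hij.symm hpq (fun h => hne ⟨rfl, h.symm⟩) h1' h2
  by_cases hiq : i = q
  · subst hiq
    exact not_tauTiltingFinite_of_path hij.symm hpq.symm (fun h => hne' ⟨h.symm, rfl⟩) h1' h2'
  by_cases hjp : j = p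
  · subst hjp
    exact not_tauTiltingFinite_of_path hij hpq (fun h => hiq h) h1 h2
  by_cases hjq : j = q
  · subst hjq
    exact not_tauTiltingFinite_of_path hij hpq.symm (fun h => hip h) h1 h2'
  exact not_tauTiltingFinite_of_disjoint hij hpq hip hiq hjp hjq h1 h2

end families

end FinMod

namespace CoxeterMatrix

variable {B : Type} (M : CoxeterMatrix B)

open Polynomial.Chebyshev

/-- The coefficients of the geometric representation; an infinite label contributes `-2`, by the
convention for division by zero. -/
def geomCoeff (i j : B) : ℝ := -2 * Real.cos (Real.pi / M i j)

/-- The simple coroots of the geometric representation. -/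
def coroot (i : B) : Module.Dual ℝ (B →₀ ℝ) := Finsupp.linearCombination ℝ (M.geomCoeff i)

lemma coroot_single (i j : B) : M.coroot i (Finsupp.single j 1) = M.geomCoeff i j := by
  simp [coroot]

lemma coroot_self (i : B) : M.coroot i (Finsupp.single i 1) = 2 := by
  simp [coroot_single, geomCoeff]

lemma geomCoeff_comm (i j : B) : M.geomCoeff i j = M.geomCoeff j i := by
  rw [geomCoeff, M.symmetric, geomCoeff]

/-- The simple reflections of the geometric representation. -/
def geomReflection (i : B) : (B →₀ ℝ) ≃ₗ[ℝ] (B →₀ ℝ) := Module.reflection (M.coroot_self i)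

lemma geomCoeff_mul_self (i j : B) :
    M.geomCoeff i j * M.geomCoeff j i - 2 = 2 * Real.cos (2 * (Real.pi / M i j)) := by
  rw [M.geomCoeff_comm j i, geomCoeff, Real.cos_two_mul]; ring

lemma sin_pos_of_three_le {m : ℕ} (hm : 3 ≤ m) : 0 < Real.sin (2 * (Real.pi / m)) := by
  have h : (3 : ℝ) ≤ m := by exact_mod_cast hm
  have hp := Real.pi_pos
  apply Real.sin_pos_of_pos_of_lt_pi
  · positivity
  · rw [← mul_div_assoc, div_lt_iff₀ (by linarith)]
    nlinarith

lemma geomReflection_pow (i j : B) :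
    (M.geomReflection i * M.geomReflection j) ^ (M i j) = 1 := by
  rcases eq_or_ne i j with rfl | hij
  · rw [M.diagonal, pow_one]
    ext1 v
    exact Module.involutive_reflection (M.coroot_self i) v
  ext1 z
  rw [geomReflection, geomReflection, Module.reflection_mul_reflection_pow_apply _ _ _ z
    (2 * Real.cos (2 * (Real.pi / M i j)))
    (by rw [coroot_single, coroot_single, geomCoeff_mul_self])]
  rw [coroot_single, coroot_single]
  rcases Nat.lt_or_ge (M i j) 3 with h | h
  · have h1 := M.off_diagonal i j hij
    obtain h0 | h2 : M i j = 0 ∨ M i j = 2 := by omega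
    · rw [h0]; simp
    · have hc : M.geomCoeff i j = 0 := by rw [geomCoeff, h2]; simp
      have hc' : M.geomCoeff j i = 0 := by rw [geomCoeff_comm, hc]
      have ht : 2 * Real.cos (2 * (Real.pi / ((2 : ℕ) : ℝ))) = -2 := by
        rw [Nat.cast_ofNat, mul_div_cancel₀ _ (two_ne_zero), Real.cos_pi]; ring
      rw [hc, hc', h2, ht]
      norm_num
      module
  · have hs := (sin_pos_of_three_le h).ne'
    set θ := 2 * (Real.pi / M i j) with hθ
    have hm : (M i j : ℝ) * θ = 2 * Real.pi := by
      rw [hθ]; field_simp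
    have hS : ∀ n : ℤ, (S ℝ n).eval (2 * Real.cos θ) = Real.sin ((n + 1) * θ) / Real.sin θ :=
      fun n => by rw [eq_div_iff hs, S_two_mul_real_cos]
    rcases Nat.even_or_odd' (M i j) with ⟨p, hp | hp⟩
    · have e1 : ((M i j : ℤ) - 2) / 2 = p - 1 := by omega
      have e2 : ((M i j : ℤ) - 1) / 2 = p - 1 := by omega
      have e3 : Real.sin (((((p : ℤ) - 1 : ℤ) : ℝ) + 1) * θ) = 0 := by
        have : ((((p : ℤ) - 1 : ℤ) : ℝ) + 1) * θ = Real.pi := by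
          rw [hp] at hm; push_cast at hm ⊢; linarith
        rw [this, Real.sin_pi]
      rw [e1, e2, hS (p - 1), e3]
      simp
    · have e1 : ((M i j : ℤ) - 2) / 2 = p - 1 := by omega
      have e2 : ((M i j : ℤ) - 1) / 2 = p := by omega
      have e4 : ((M i j : ℤ) - 3) / 2 = p - 1 := by omega
      have e5 : ((M i j : ℤ)) / 2 = p := by omega
      have e3 : Real.sin ((((p : ℤ) : ℝ) + 1) * θ) =
          - Real.sin (((((p : ℤ) - 1 : ℤ) : ℝ) + 1) * θ) := by
        have : (((p : ℤ) : ℝ) + 1) * θ = 2 * Real.pi - ((((p : ℤ) - 1 : ℤ) : ℝ) + 1) * θ := by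
          rw [hp] at hm; push_cast at hm ⊢; linarith
        rw [this, Real.sin_two_pi_sub]
      rw [e1, e2, e4, e5, hS (p - 1), hS p, e3, neg_div, neg_add_cancel, mul_zero, mul_zero,
        zero_smul, zero_smul, add_zero, add_zero]
      rfl

lemma dvd_of_geomReflection_pow (i j : B) (n : ℕ)
    (h : (M.geomReflection i * M.geomReflection j) ^ n = 1) : M i j ∣ n := by
  rcases eq_or_ne i j with rfl | hij
  · rw [M.diagonal]; exact one_dvd n
  have h0 := LinearEquiv.congr_fun h (Finsupp.single i 1)
  rw [geomReflection, geomReflection, Module.reflection_mul_reflection_pow_apply_self _ _ _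
    (2 * Real.cos (2 * (Real.pi / M i j)))
    (by rw [coroot_single, coroot_single, geomCoeff_mul_self])] at h0
  have hg := M.coroot_single j i
  rw [hg] at h0
  have hi := DFunLike.congr_fun h0 i
  have hj := DFunLike.congr_fun h0 j
  simp [hij, hij.symm] at hi hj
  rcases Nat.lt_or_ge (M i j) 3 with h | h
  · have h1 := M.off_diagonal i j hij
    obtain h0 | h2 : M i j = 0 ∨ M i j = 2 := by omega
    · simp [h0, M.symmetric j i, geomCoeff, S_eval_two] at hj
      simp [h0, hj]
    · have ht : 2 * Real.cos (2 * (Real.pi / ((2 : ℕ) : ℝ))) = -2 := by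
        rw [Nat.cast_ofNat, mul_div_cancel₀ _ (two_ne_zero), Real.cos_pi]; ring
      rw [h2, ht, S_eval_neg_two, S_eval_neg_two] at hi
      rw [h2]
      by_contra hn
      have ho : Odd n := by rwa [← Nat.not_even_iff_odd, even_iff_two_dvd]
      rw [Int.negOnePow_sub, Int.negOnePow_odd n (by exact_mod_cast ho)] at hi
      norm_num at hi
  · have hs := (sin_pos_of_three_le h).ne'
    have hc : M.geomCoeff j i ≠ 0 := by
      intro hc
      have := M.geomCoeff_mul_self i j
      rw [hc, mul_zero] at this
      have h2 := Real.sin_sq_add_cos_sq (2 * (Real.pi / M i j))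
      have : Real.cos (2 * (Real.pi / M i j)) = -1 := by linarith
      rw [this] at h2
      exact hs (by nlinarith)
    have hj' := hj.resolve_right hc
    set θ := 2 * (Real.pi / M i j) with hθ
    have hm : (M i j : ℝ) * θ = 2 * Real.pi := by
      rw [hθ]; field_simp
    have hS : ∀ n : ℤ, (S ℝ n).eval (2 * Real.cos θ) = Real.sin ((n + 1) * θ) / Real.sin θ :=
      fun n => by rw [eq_div_iff hs, S_two_mul_real_cos]
    rw [hj', add_zero, hS, div_eq_one_iff_eq hs] at hi
    rw [hS, div_eq_zero_iff, or_iff_left hs] at hj'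
    push_cast at hi hj'
    rw [sub_add_cancel] at hj'
    rw [add_mul, one_mul, Real.sin_add, hj', zero_mul, zero_add, mul_eq_right₀ hs,
      Real.cos_eq_one_iff] at hi
    obtain ⟨q, hq⟩ := hi
    have : (n : ℝ) = M i j * q := by
      have hp := Real.pi_pos.ne'
      have h3 : (n : ℝ) * (2 * Real.pi) = M i j * q * (2 * Real.pi) := by
        rw [mul_assoc (M i j : ℝ), hq, ← hm]; ring
      exact mul_right_cancel₀ (by positivity) h3
    exact Int.natCast_dvd_natCast.1 ⟨q, by exact_mod_cast this⟩

end CoxeterMatrix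

namespace CoxeterSystem

variable {B W : Type} {M : CoxeterMatrix B} [Group W] (cs : CoxeterSystem M W)

lemma dvd_of_simple_mul_simple_pow {i j : B} {n : ℕ} (h : (cs.simple i * cs.simple j) ^ n = 1) :
    M i j ∣ n := by
  apply M.dvd_of_geomReflection_pow
  have hl : M.IsLiftable M.geomReflection := M.geomReflection_pow
  have h2 := congrArg (cs.lift ⟨M.geomReflection, hl⟩) h
  rwa [map_pow, map_mul, cs.lift_apply_simple hl, cs.lift_apply_simple hl, map_one] at h2

include cs in
lemma coxeterMatrix_ne_zero [Finite W] (i j : B) : M i j ≠ 0 := by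
  intro h
  obtain ⟨n, hn, hn'⟩ := isOfFinOrder_iff_pow_eq_one.1
    (isOfFinOrder_of_finite (cs.simple i * cs.simple j))
  have := cs.dvd_of_simple_mul_simple_pow hn'
  rw [h, zero_dvd_iff] at this
  omega

lemma simple_injective : Function.Injective cs.simple := by
  intro i j h
  by_contra hij
  have := cs.dvd_of_simple_mul_simple_pow (i := i) (j := j) (n := 1) (by rw [h]; simp)
  exact M.off_diagonal i j hij (Nat.dvd_one.1 this)

end CoxeterSystem

namespace CoxeterSystem

variable {B W : Type} {M : CoxeterMatrix B} [Group W] (cs : CoxeterSystem M W)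

open Classical in
/-- The action of a simple reflection on pairs of a group element and a sign. -/
def signedConj (i : B) : Equiv.Perm (W × ZMod 2) :=
  Function.Involutive.toPerm (fun x => (cs.simple i * x.1 * cs.simple i,
    x.2 + if x.1 = cs.simple i then 1 else 0)) (by
    rintro ⟨t, e⟩
    have h : cs.simple i * t * cs.simple i = cs.simple i ↔ t = cs.simple i := by
      constructor
      · intro h
        have := mul_eq_right.1 h
        rw [mul_eq_one_iff_inv_eq, inv_simple] at this
        exact this.symm
      · rintro rfl; simp
    ext
    · simp [mul_assoc]
    · simp only [h]
      split_ifs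
      · rw [add_assoc, CharTwo.add_self_eq_zero, add_zero]
      · simp)

open Classical in
lemma signedConj_apply (i : B) (t : W) (e : ZMod 2) :
    cs.signedConj i (t, e) = (cs.simple i * t * cs.simple i,
      e + if t = cs.simple i then 1 else 0) := rfl

lemma pow_inv_mul_simple (i j : B) (n : ℕ) :
    ((cs.simple i * cs.simple j) ^ n)⁻¹ * cs.simple j =
      cs.simple j * (cs.simple i * cs.simple j) ^ n := by
  have h : (cs.simple i * cs.simple j)⁻¹ =
      cs.simple j * (cs.simple i * cs.simple j) * (cs.simple j)⁻¹ := by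
    simp [mul_assoc]
  rw [← inv_pow, h, conj_pow]
  group

lemma pow_mul_mul_pow_inv_eq_iff (i j : B) (n : ℕ) (t x : W) :
    (cs.simple i * cs.simple j) ^ n * t * ((cs.simple i * cs.simple j) ^ n)⁻¹ = cs.simple j * x ↔
      t = cs.simple j * (cs.simple i * cs.simple j) ^ n * x * (cs.simple i * cs.simple j) ^ n := by
  rw [← pow_inv_mul_simple, mul_inv_eq_iff_eq_mul, ← eq_inv_mul_iff_mul_eq]
  simp only [mul_assoc]

open Classical in
lemma signedConj_pow (i j : B) (n : ℕ) (t : W) (e : ZMod 2) :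
    ((cs.signedConj i * cs.signedConj j) ^ n) (t, e) =
      ((cs.simple i * cs.simple j) ^ n * t * ((cs.simple i * cs.simple j) ^ n)⁻¹,
        e + ∑ q ∈ Finset.range (2 * n),
          if t = cs.simple j * (cs.simple i * cs.simple j) ^ q then 1 else 0) := by
  induction n with
  | zero => simp
  | succ n ih =>
    rw [pow_succ', Equiv.Perm.mul_apply, ih, Equiv.Perm.mul_apply, signedConj_apply,
      signedConj_apply]
    have h1 := cs.pow_mul_mul_pow_inv_eq_iff i j n t 1
    have h2 := cs.pow_mul_mul_pow_inv_eq_iff i j n t (cs.simple i * cs.simple j)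
    have h3 : cs.simple j * ((cs.simple i * cs.simple j) ^ n * t *
          ((cs.simple i * cs.simple j) ^ n)⁻¹) * cs.simple j = cs.simple i ↔
        (cs.simple i * cs.simple j) ^ n * t * ((cs.simple i * cs.simple j) ^ n)⁻¹ =
          cs.simple j * (cs.simple i * cs.simple j) := by
      generalize (cs.simple i * cs.simple j) ^ n * t * ((cs.simple i * cs.simple j) ^ n)⁻¹ = x
      constructor
      · intro h
        rw [← h]; simp [mul_assoc]
      · intro h
        rw [h]; simp [mul_assoc]
    have e1 : cs.simple j * (cs.simple i * cs.simple j) ^ n * 1 * (cs.simple i * cs.simple j) ^ n =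
        cs.simple j * (cs.simple i * cs.simple j) ^ (2 * n) := by
      rw [mul_one, mul_assoc, ← pow_add, two_mul]
    have e2 : cs.simple j * (cs.simple i * cs.simple j) ^ n * (cs.simple i * cs.simple j) *
        (cs.simple i * cs.simple j) ^ n =
        cs.simple j * (cs.simple i * cs.simple j) ^ (2 * n + 1) := by
      rw [mul_assoc, mul_assoc, ← pow_succ', ← pow_add]
      congr 2; ring
    rw [mul_one, e1] at h1
    rw [e2] at h2
    rw [show 2 * (n + 1) = 2 * n + 1 + 1 by ring, Finset.sum_range_succ, Finset.sum_range_succ]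
    simp only [h3, h2, h1]
    ext
    · rw [pow_succ' _ n]; simp [mul_assoc]
    · simp only [add_assoc]

lemma signedConj_liftable : M.IsLiftable cs.signedConj := by
  classical
  intro i j
  ext1 ⟨t, e⟩
  rw [signedConj_pow, simple_mul_simple_pow]
  have : ∑ q ∈ Finset.range (2 * M i j), (if t = cs.simple j * (cs.simple i * cs.simple j) ^ q
      then (1 : ZMod 2) else 0) = 0 := by
    rw [two_mul, Finset.sum_range_add]
    simp only [pow_add, simple_mul_simple_pow, one_mul]
    exact CharTwo.add_self_eq_zero _
  rw [this]; simp

open Classical in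
lemma lift_signedConj (ω : List B) (t : W) (e : ZMod 2) :
    cs.lift ⟨cs.signedConj, cs.signedConj_liftable⟩ (cs.wordProd ω) (t, e) =
      (cs.wordProd ω * t * (cs.wordProd ω)⁻¹, e + (cs.rightInvSeq ω).count t) := by
  induction ω with
  | nil => simp
  | cons i ω ih =>
    rw [wordProd_cons, map_mul, Equiv.Perm.mul_apply, ih,
      cs.lift_apply_simple cs.signedConj_liftable, signedConj_apply, rightInvSeq, List.count_cons]
    ext
    · simp [mul_assoc]
    · have : cs.wordProd ω * t * (cs.wordProd ω)⁻¹ = cs.simple i ↔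
          (cs.wordProd ω)⁻¹ * cs.simple i * cs.wordProd ω = t := by
        constructor
        · intro h; rw [← h]; group
        · rintro rfl; group
      simp only [this, beq_iff_eq]
      split_ifs <;> simp [add_assoc]

open Classical in
lemma count_rightInvSeq_eq {ω ω' : List B} (h : cs.wordProd ω = cs.wordProd ω') (t : W) :
    ((cs.rightInvSeq ω).count t : ZMod 2) = (cs.rightInvSeq ω').count t := by
  have h1 := cs.lift_signedConj ω t 0
  rw [h, lift_signedConj] at h1
  simpa using (congrArg Prod.snd h1).symm

lemma IsReduced.mem_rightInvSeq {cs : CoxeterSystem M W} {ω ω' : List B}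
    (hω : (cs.rightInvSeq ω).Nodup)
    (h : cs.wordProd ω = cs.wordProd ω') {t : W} (ht : t ∈ cs.rightInvSeq ω) :
    t ∈ cs.rightInvSeq ω' := by
  classical
  have h1 := cs.count_rightInvSeq_eq h t
  rw [List.count_eq_one_of_mem hω ht] at h1
  by_contra h2
  rw [List.count_eq_zero_of_not_mem h2] at h1
  simp at h1

lemma isReduced_of_nodup {ω : List B} (hω : (cs.rightInvSeq ω).Nodup) : cs.IsReduced ω := by
  obtain ⟨ω', h1, h2⟩ := cs.exists_isReduced (cs.wordProd ω)
  refine le_antisymm (cs.length_wordProd_le ω) ?_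
  rw [h2, h1.eq]
  have := hω.length_le_of_subset (fun t ht => IsReduced.mem_rightInvSeq hω h2 ht)
  simpa using this

lemma exists_isReduced_concat {w : W} {i : B} (h : cs.IsRightDescent w i) :
    ∃ ω : List B, cs.IsReduced (ω.concat i) ∧ w = cs.wordProd (ω.concat i) := by
  obtain ⟨ω, h1, h2⟩ := cs.exists_isReduced (w * cs.simple i)
  have h3 : w = cs.wordProd (ω.concat i) := by rw [wordProd_concat, ← h2]; simp
  refine ⟨ω, ?_, h3⟩
  have h4 := (cs.isRightDescent_iff).1 h
  rw [IsReduced, ← h3, List.length_concat, ← h1.eq, ← h2, h4]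

/-- The exchange condition. -/
lemma exchange {w : W} {i : B} (h : cs.IsRightDescent w i) {ω : List B} (hω : cs.wordProd ω = w) :
    ∃ q < ω.length, w * cs.simple i = cs.wordProd (ω.eraseIdx q) := by
  obtain ⟨ω', h1, h2⟩ := cs.exists_isReduced_concat h
  have h3 : cs.simple i ∈ cs.rightInvSeq (ω'.concat i) := by
    rw [rightInvSeq_concat]; simp
  have h4 := IsReduced.mem_rightInvSeq h1.nodup_rightInvSeq (h2.symm.trans hω.symm) h3
  obtain ⟨q, hq, h5⟩ := List.getElem_of_mem h4
  rw [length_rightInvSeq] at hq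
  refine ⟨q, hq, ?_⟩
  rw [← wordProd_mul_getD_rightInvSeq, hω, List.getD_eq_getElem _ _ (by simpa using hq), h5]

lemma rightInvSeq_alternatingWord (i j : B) (p : ℕ) :
    cs.rightInvSeq (alternatingWord i j p) =
      ((List.range p).map fun q => cs.simple j * (cs.simple i * cs.simple j) ^ q).reverse := by
  induction p with
  | zero => simp [alternatingWord]
  | succ p ih =>
    rw [alternatingWord_succ', rightInvSeq, ih, List.range_succ, List.map_append, List.reverse_append]
    simp only [List.map_cons, List.map_nil, List.reverse_cons, List.reverse_nil, List.nil_append,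
      List.singleton_append, List.cons.injEq, and_true]
    rw [prod_alternatingWord_eq_mul_pow]
    obtain ⟨r, rfl | rfl⟩ := Nat.even_or_odd' p
    · rw [if_pos (even_two_mul r), if_pos (even_two_mul r), one_mul,
        Nat.mul_div_cancel_left _ two_pos, pow_inv_mul_simple, mul_assoc, ← pow_add, two_mul]
    · have h : ¬ Even (2 * r + 1) := by simp
      rw [if_neg h, if_neg h, show (2 * r + 1) / 2 = r by omega, mul_inv_rev, inv_simple,
        pow_inv_mul_simple, show 2 * r + 1 = r + (1 + r) by ring, pow_add, pow_add, pow_one]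
      simp only [mul_assoc]

lemma isReduced_alternatingWord {i j : B} {p : ℕ} (hp : p ≤ M i j) :
    cs.IsReduced (alternatingWord i j p) := by
  apply cs.isReduced_of_nodup
  rw [rightInvSeq_alternatingWord, List.nodup_reverse]
  refine List.Nodup.map_on ?_ List.nodup_range
  intro a ha b hb h
  rw [List.mem_range] at ha hb
  have h1 := mul_left_cancel h
  wlog hab : a ≤ b generalizing a b
  · exact (this b hb a ha h.symm h1.symm (by omega)).symm
  obtain ⟨c, rfl⟩ := Nat.exists_eq_add_of_le hab
  rw [pow_add, left_eq_mul] at h1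
  have := cs.dvd_of_simple_mul_simple_pow h1
  rcases Nat.eq_zero_or_pos c with rfl | hc
  · rfl
  · have := Nat.le_of_dvd hc this; omega

lemma exists_alternating_tail {w : W} (p : ℕ) : ∀ {i j : B}, cs.IsRightDescent w i →
    cs.IsRightDescent w j → p ≤ M i j →
    ∃ γ, cs.IsReduced (γ ++ alternatingWord i j p) ∧
      w = cs.wordProd (γ ++ alternatingWord i j p) := by
  induction p with
  | zero =>
    intro i j _ _ _
    obtain ⟨ω, h1, h2⟩ := cs.exists_isReduced w
    exact ⟨ω, by simpa [alternatingWord] using h1, by simpa [alternatingWord] using h2⟩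
  | succ p ih =>
    intro i j hi hj hp
    obtain ⟨γ, h1, h2⟩ := ih hj hi (by rw [M.symmetric]; omega)
    obtain ⟨q, hq, h3⟩ := cs.exchange hj h2.symm
    have h4 := (cs.isRightDescent_iff).1 hj
    have h5 := h1.eq
    rw [← h2] at h5
    rcases lt_or_ge q γ.length with hqγ | hqγ
    · rw [List.eraseIdx_append_of_lt_length hqγ] at h3
      have h6 : w = cs.wordProd (γ.eraseIdx q ++ alternatingWord i j (p + 1)) := by
        rw [alternatingWord_succ, List.concat_eq_append, ← List.append_assoc,
          ← List.concat_eq_append, wordProd_concat, ← h3]; simp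
      refine ⟨γ.eraseIdx q, ?_, h6⟩
      rw [IsReduced, ← h6, h5]
      simp [List.length_eraseIdx_of_lt hqγ]
      omega
    · exfalso
      rw [List.eraseIdx_append_of_length_le hqγ, h2, wordProd_append, wordProd_append, mul_assoc,
        mul_left_cancel_iff, ← wordProd_concat, ← alternatingWord_succ] at h3
      have h7 := (cs.isReduced_alternatingWord hp).eq
      have h8 := cs.length_wordProd_le ((alternatingWord j i p).eraseIdx (q - γ.length))
      rw [← h3, h7] at h8
      have h9 := List.length_eraseIdx_le (alternatingWord j i p) (q - γ.length)
      simp at h8 h9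
      omega

/-- Matsumoto's theorem. -/
theorem matsumoto {R : Type} [Monoid R] (t : B → R) (hM : ∀ i j, M i j ≠ 0)
    (ht : ∀ i j, ((alternatingWord i j (M i j)).map t).prod =
      ((alternatingWord j i (M i j)).map t).prod) (n : ℕ) :
    ∀ ω ω' : List B, ω.length = n → cs.IsReduced ω → cs.IsReduced ω' →
      cs.wordProd ω = cs.wordProd ω' → (ω.map t).prod = (ω'.map t).prod := by
  induction n with
  | zero =>
    intro ω ω' hn h1 h2 h
    have h3 := h1.eq
    rw [h, h2.eq, hn] at h3
    rw [List.length_eq_zero_iff.1 hn, List.length_eq_zero_iff.1 h3]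
  | succ n ih =>
    have key : ∀ (i : B) (α β : List B), (α.concat i).length = n + 1 → cs.IsReduced (α.concat i) →
        cs.IsReduced (β.concat i) → cs.wordProd (α.concat i) = cs.wordProd (β.concat i) →
        ((α.concat i).map t).prod = ((β.concat i).map t).prod := by
      intro i α β hn h1 h2 h
      rw [wordProd_concat, wordProd_concat, mul_right_cancel_iff] at h
      have h3 : cs.IsReduced α := by simpa using h1.take α.length
      have h4 : cs.IsReduced β := by simpa using h2.take β.length
      have := ih α β (by simpa using hn) h3 h4 h
      simp [this]
    intro ω ω' hn h1 h2 h
    have hlen : ω'.length = n + 1 := by rw [← h2.eq, ← h, h1.eq, hn]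
    obtain rfl | ⟨α, i, rfl⟩ := ω.eq_nil_or_concat
    · simp at hn
    obtain rfl | ⟨β, j, rfl⟩ := ω'.eq_nil_or_concat
    · simp at hlen
    rcases eq_or_ne i j with rfl | hij
    · exact key i α β hn h1 h2 h
    have desc : ∀ (l : B) (δ : List B), cs.IsReduced (δ.concat l) →
        cs.IsRightDescent (cs.wordProd (δ.concat l)) l := by
      intro l δ hδ
      rw [IsRightDescent, hδ.eq, wordProd_concat, simple_mul_simple_cancel_right,
        List.length_concat]
      exact Nat.lt_succ_of_le (cs.length_wordProd_le δ)
    have hi := desc i α h1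
    have hj := h ▸ desc j β h2
    obtain ⟨γ, h3, h4⟩ := cs.exists_alternating_tail _ hi hj le_rfl
    have happ : ∀ (δ ε : List B) (l : B), δ ++ ε.concat l = (δ ++ ε).concat l := by simp
    obtain ⟨m, hm⟩ := Nat.exists_eq_succ_of_ne_zero (hM i j)
    have e1 : cs.wordProd (alternatingWord i j (M i j)) = cs.wordProd (alternatingWord j i (M i j)) := by
      have := cs.wordProd_braidWord_eq i j
      rwa [braidWord, braidWord, M.symmetric j i] at this
    have e2 : cs.wordProd (α.concat i) = cs.wordProd (γ ++ alternatingWord j i (M i j)) := by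
      rw [h4, wordProd_append, wordProd_append, e1]
    have e3 : cs.IsReduced (γ ++ alternatingWord j i (M i j)) := by
      have := h3.eq
      rw [IsReduced, ← e2, h4, this]; simp
    have e4 : ((γ ++ alternatingWord i j (M i j)).map t).prod =
        ((γ ++ alternatingWord j i (M i j)).map t).prod := by
      simp [ht i j]
    rw [hm, Nat.succ_eq_add_one, alternatingWord_succ, alternatingWord_succ, happ, happ] at e4
    rw [hm, Nat.succ_eq_add_one, alternatingWord_succ, happ] at h3 h4 e2 e3
    have e5 := key i _ _ hn h1 e3 e2
    have e6 := key j _ _ hlen h2 h3 (h.symm.trans h4)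
    rw [e5, e6, e4]

end CoxeterSystem

lemma altProd_eq_alternatingWord {B R : Type} [Monoid R] (t : B → R) (i j : B) (m : ℕ) :
    altProd (t i) (t j) m = ((if m % 2 = 0 then CoxeterSystem.alternatingWord i j m
      else CoxeterSystem.alternatingWord j i m).map t).prod := by
  induction m with
  | zero => simp [CoxeterSystem.alternatingWord]
  | succ m ih =>
    rw [altProd_succ, ih]
    rcases Nat.mod_two_eq_zero_or_one m with h | h
    · simp [h, Nat.succ_mod_two_eq_one_iff.2 h, CoxeterSystem.alternatingWord_succ]
    · simp [h, Nat.succ_mod_two_eq_zero_iff.2 h, CoxeterSystem.alternatingWord_succ]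

namespace Hecke0

variable {k : Type} [Field k] {B W : Type} {M : CoxeterMatrix B} [Group W]

lemma prod_gen_alternatingWord (i j : B) :
    ((CoxeterSystem.alternatingWord i j (M i j)).map (gen k M)).prod =
      ((CoxeterSystem.alternatingWord j i (M i j)).map (gen k M)).prod := by
  have h := gen_braid (k := k) (M := M) i j
  rw [altProd_eq_alternatingWord, altProd_eq_alternatingWord] at h
  split_ifs at h
  · exact h
  · exact h.symm

/-- The 0-Hecke algebra of a finite Coxeter group is finite-dimensional. -/
lemma finite (k : Type) [Field k] (cs : CoxeterSystem M W) [Finite W] :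
    Module.Finite k (Hecke0 k M) := by
  have hM := cs.coxeterMatrix_ne_zero
  have mat : ∀ {ω ω' : List B}, cs.IsReduced ω → cs.IsReduced ω' →
      cs.wordProd ω = cs.wordProd ω' → (ω.map (gen k M)).prod = (ω'.map (gen k M)).prod :=
    fun h h' he => cs.matsumoto (gen k M) hM prod_gen_alternatingWord _ _ _ rfl h h' he
  choose r hr hr' using cs.exists_isReduced
  let T : W → Hecke0 k M := fun w => ((r w).map (gen k M)).prod
  have hT : ∀ {ω : List B}, cs.IsReduced ω → (ω.map (gen k M)).prod = T (cs.wordProd ω) :=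
    fun h => mat h (hr _) (hr' _)
  have hmul : ∀ w i, T w * gen k M i = T (w * cs.simple i) ∨ T w * gen k M i = - T w := by
    intro w i
    by_cases h : cs.IsRightDescent w i
    · obtain ⟨ω, h1, h2⟩ := cs.exists_isReduced_concat h
      right
      rw [h2, ← hT h1, List.concat_eq_append, List.map_append, List.prod_append]
      simp [mul_assoc, gen_mul_self]
    · left
      have h1 := (cs.not_isRightDescent_iff).1 h
      have h2 : cs.wordProd ((r w).concat i) = w * cs.simple i := by
        rw [CoxeterSystem.wordProd_concat, ← hr' w]
      have h3 : cs.IsReduced ((r w).concat i) := by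
        rw [CoxeterSystem.IsReduced, h2, h1, List.length_concat, ← (hr w).eq, ← hr' w]
      rw [← h2, ← hT h3]
      simp [T]
  let S : Submodule k (Hecke0 k M) := Submodule.span k (Set.range T)
  have hS : ∀ x ∈ Algebra.adjoin k (Set.range (gen k M)), ∀ y ∈ S, y * x ∈ S := by
    intro x hx
    induction hx using Algebra.adjoin_induction with
    | mem x hx =>
      obtain ⟨i, rfl⟩ := hx
      intro y hy
      induction hy using Submodule.span_induction with
      | mem y hy =>
        obtain ⟨w, rfl⟩ := hy
        rcases hmul w i with h | h
        · rw [h]; exact Submodule.subset_span ⟨_, rfl⟩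
        · rw [h]; exact S.neg_mem (Submodule.subset_span ⟨_, rfl⟩)
      | zero => rw [zero_mul]; exact S.zero_mem
      | add y z _ _ hy hz => rw [add_mul]; exact S.add_mem hy hz
      | smul c y _ hy => rw [smul_mul_assoc]; exact S.smul_mem c hy
    | algebraMap c =>
      intro y hy
      rw [← Algebra.commutes, ← Algebra.smul_def]
      exact S.smul_mem c hy
    | add x y _ _ hx hy => intro z hz; rw [mul_add]; exact S.add_mem (hx z hz) (hy z hz)
    | mul x y _ _ hx hy => intro z hz; rw [← mul_assoc]; exact hy _ (hx z hz)
  have h1 : (1 : Hecke0 k M) ∈ S := by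
    have h : cs.IsReduced ([] : List B) := by simp [CoxeterSystem.IsReduced]
    have := hT h
    simp only [List.map_nil, List.prod_nil] at this
    rw [this]
    exact Submodule.subset_span ⟨_, rfl⟩
  have htop : S = ⊤ := by
    rw [eq_top_iff]
    intro x _
    have := hS x (by rw [adjoin_gen]; trivial) 1 h1
    rwa [one_mul] at this
  exact ⟨htop ▸ Submodule.fg_span (Set.finite_range T)⟩

end Hecke0

section idempotents

lemma braid_pow {R : Type} [Ring R] {a b : R} (ha : a * a = -a) (hb : b * b = -b) (r : ℕ) :
    altProd a b (2 * r + 1) = a * (1 + a + b + a * b + b * a) ^ r ∧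
      altProd a b (2 * r + 2) = a * b * (1 + a + b + a * b + b * a) ^ r := by
  have h1 : b * (1 + a + b + a * b + b * a) = b * a * b := by
    simp only [mul_add, mul_one, ← mul_assoc, hb, neg_mul]; abel
  have h2 : (1 + a + b + a * b + b * a) * b = b * a * b := by
    simp only [add_mul, one_mul, mul_assoc, hb, mul_neg]; abel
  have h3 : a * (1 + a + b + a * b + b * a) = a * b * a := by
    simp only [mul_add, mul_one, ← mul_assoc, ha, neg_mul]; abel
  have h4 : (1 + a + b + a * b + b * a) * a = a * b * a := by
    simp only [add_mul, one_mul, mul_assoc, ha, mul_neg]; abel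
  have hc : Commute b (1 + a + b + a * b + b * a) := h1.trans h2.symm
  have hc' : Commute a (1 + a + b + a * b + b * a) := h3.trans h4.symm
  generalize 1 + a + b + a * b + b * a = N at *
  have step : ∀ r, altProd a b (2 * r + 1) = a * N ^ r →
      altProd a b (2 * r + 2) = a * b * N ^ r := by
    intro r h
    rw [altProd_succ, h, if_neg (by omega), mul_assoc, ← (hc.pow_right r).eq, mul_assoc]
  have main : ∀ r, altProd a b (2 * r + 1) = a * N ^ r := by
    intro r
    induction r with
    | zero => simp [altProd]
    | succ r ih =>
      rw [show 2 * (r + 1) + 1 = 2 * r + 2 + 1 by ring, altProd_succ, step r ih, if_pos (by omega),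
        mul_assoc, ← (hc'.pow_right r).eq, ← mul_assoc, ← h3, pow_succ', mul_assoc]
  exact ⟨main r, step r (main r)⟩

lemma braid_commutator {R : Type} [Ring R] {a b : R} (ha : a * a = -a) (hb : b * b = -b) {m : ℕ}
    (hm : m ≠ 0) (h : altProd a b m = altProd b a m) :
    ∃ r, (a * b - b * a) * (1 + a + b + a * b + b * a) ^ r = 0 := by
  have hN : 1 + b + a + b * a + a * b = 1 + a + b + a * b + b * a := by abel
  obtain ⟨r, rfl | rfl⟩ := Nat.even_or_odd' m
  · obtain ⟨r, rfl⟩ := Nat.exists_eq_succ_of_ne_zero (show r ≠ 0 by omega)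
    rw [show 2 * r.succ = 2 * r + 2 by rw [Nat.succ_eq_add_one]; ring, (braid_pow ha hb r).2,
      (braid_pow hb ha r).2, hN] at h
    exact ⟨r, by rw [sub_mul, h, sub_self]⟩
  · rw [(braid_pow ha hb r).1, (braid_pow hb ha r).1, hN] at h
    refine ⟨r, ?_⟩
    have h1 : a * b * (1 + a + b + a * b + b * a) ^ r = -(a * (1 + a + b + a * b + b * a) ^ r) := by
      rw [mul_assoc, ← h, ← mul_assoc, ha, neg_mul]
    have h2 : b * a * (1 + a + b + a * b + b * a) ^ r = -(b * (1 + a + b + a * b + b * a) ^ r) := by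
      rw [mul_assoc, h, ← mul_assoc, hb, neg_mul]
    rw [sub_mul, h1, h2, h, sub_self]

variable {k V : Type} [Field k] [AddCommGroup V] [Module k V]

lemma linearIndependent_pow_apply {D : Module.End k V} {v : V} {d : ℕ} (h0 : (D ^ (d + 1)) v = 0)
    (h1 : (D ^ d) v ≠ 0) : LinearIndependent k (fun t : Fin (d + 1) => (D ^ (t : ℕ)) v) := by
  rw [Fintype.linearIndependent_iff]
  intro c hc
  have hz : ∀ s, d < s → (D ^ s) v = 0 := by
    intro s hs
    obtain ⟨x, rfl⟩ := Nat.exists_eq_add_of_le (Nat.succ_le_of_lt hs)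
    rw [add_comm, pow_add, Module.End.mul_apply, h0, map_zero]
  have key : ∀ n, ∀ t : Fin (d + 1), (t : ℕ) = n → c t = 0 := by
    intro n
    induction n using Nat.strong_induction_on with
    | _ n ih =>
      rintro t rfl
      have h := congrArg (D ^ (d - t)) hc
      rw [map_sum, map_zero, Finset.sum_eq_single t] at h
      · rw [map_smul, ← Module.End.mul_apply, ← pow_add, Nat.sub_add_cancel (by omega)] at h
        exact (smul_eq_zero.1 h).resolve_right h1
      · intro s _ hst
        rcases lt_or_gt_of_ne hst with h' | h'
        · rw [ih s h' s rfl, zero_smul, map_zero]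
        · rw [map_smul, ← Module.End.mul_apply, ← pow_add, hz, smul_zero]
          have : (t : ℕ) < s := h'
          omega
      · simp
  exact fun t => key t t rfl

/-- Two idempotents whose anticommutator-type operator `p + q - 1` is nilpotent and which do not
decompose the space act along a single string. -/
lemma span_string {p q : Module.End k V} (hp : p * p = p) (hq : q * q = q)
    (hind : ∀ f : Module.End k V, Commute f p → Commute f q →
      IsNilpotent f ∨ Function.Bijective f) {d : ℕ} (h0 : (p + q - 1) ^ (d + 1) = 0) {v : V}
    (hv : p v = v) (h1 : ((p + q - 1) ^ d) v ≠ 0) :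
    ⊤ ≤ Submodule.span k (Set.range fun t : Fin (d + 1) => ((p + q - 1) ^ (t : ℕ)) v) := by
  set D := p + q - 1 with hD
  have hDp : D * p = q * D := by rw [hD]; simp only [mul_add, mul_sub, add_mul, sub_mul, hp, hq]; simp
  have hDq : D * q = p * D := by rw [hD]; simp only [mul_add, mul_sub, add_mul, sub_mul, hp, hq]; simp
  have hDq' : D * q = p * q := by rw [hD]; simp only [add_mul, sub_mul, hq]; simp
  have hDp' : D * p = q * p := by rw [hD]; simp only [add_mul, sub_mul, hp]; simp
  let E : ℕ → Module.End k V := fun t => if t % 2 = 0 then p else q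
  have hE0 : ∀ {s t : ℕ}, s % 2 = t % 2 → E s = E t := fun h => by simp only [E, h]
  have hEE : ∀ t, E t * E t = E t := by intro t; simp only [E]; split_ifs <;> assumption
  have hDE1 : ∀ t, D * E t = E (t + 1) * D := by
    intro t
    rcases Nat.mod_two_eq_zero_or_one t with h | h
    · simp [E, h, Nat.succ_mod_two_eq_one_iff.2 h, hDp]
    · simp [E, h, Nat.succ_mod_two_eq_zero_iff.2 h, hDq]
  have hDE : ∀ s t, D ^ s * E t = E (t + s) * D ^ s := by
    intro s t
    induction s with
    | zero => simp
    | succ s ih => rw [pow_succ', mul_assoc, ih, ← mul_assoc, hDE1, mul_assoc, add_assoc]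
  have hDE' : ∀ s t x, (D ^ s) (E t x) = E (t + s) ((D ^ s) x) := fun s t x =>
    LinearMap.congr_fun (hDE s t) x
  have hEE' : ∀ t x, E t (E t x) = E t x := fun t x => LinearMap.congr_fun (hEE t) x
  have hvE : ∀ s, (D ^ s) v = E s ((D ^ s) v) := by
    intro s
    have := hDE' s 0 v
    rwa [show E 0 v = v by simp [E, hv], zero_add] at this
  have hdisj : ∀ x, p x = x → q x = x → x = 0 := by
    intro x hpx hqx
    have : ∀ s, (D ^ s) x = x := by
      intro s
      induction s with
      | zero => simp
      | succ s ih => rw [pow_succ', Module.End.mul_apply, ih, hD]; simp [hpx, hqx]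
    rw [← this (d + 1), h0]; rfl
  have hdisjE : ∀ t x, E t x = x → E (t + 1) x = x → x = 0 := by
    intro t x
    rcases Nat.mod_two_eq_zero_or_one t with h | h
    · simp only [E, h, Nat.succ_mod_two_eq_one_iff.2 h]; simpa using hdisj x
    · simp only [E, h, Nat.succ_mod_two_eq_zero_iff.2 h]; simpa using fun h1 h2 => hdisj x h2 h1
  have hsurj : ∀ x, ∃ y, x = p y - q y := by
    have hu : (p - q) * (p - q) = 1 - D * D := by
      rw [hD]; simp only [mul_add, mul_sub, add_mul, sub_mul, hp, hq, mul_one, one_mul]; abel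
    have hnil : IsNilpotent (D * D) := ⟨d + 1, by rw [← pow_two, ← pow_mul, mul_comm, pow_mul, h0, zero_pow two_ne_zero]⟩
    obtain ⟨g, hg, -⟩ := isUnit_iff_exists.1 hnil.isUnit_one_sub
    intro x
    refine ⟨(p - q) (g x), ?_⟩
    have := LinearMap.congr_fun hg x
    rw [← hu] at this
    exact this.symm
  have hnot : (D ^ d) v ∉ LinearMap.range (E (d + 1)) := by
    rintro ⟨y, hy⟩
    exact h1 (hdisjE d _ (hvE d).symm (by rw [← hy, hEE']))
  obtain ⟨φ₀, hφ₀, hφ₁⟩ := Submodule.exists_le_ker_of_notMem hnot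
  let φ : V →ₗ[k] k := (φ₀ ((D ^ d) v))⁻¹ • φ₀
  have hφ : φ ((D ^ d) v) = 1 := by simp [φ, hφ₀]
  have hφE : ∀ x, φ (E (d + 1) x) = 0 := by
    intro x
    have : φ₀ (E (d + 1) x) = 0 := hφ₁ ⟨x, rfl⟩
    simp [φ, this]
  let r : Module.End k V := ∑ t ∈ Finset.range (d + 1), (φ ∘ₗ (D ^ (d - t))).smulRight ((D ^ t) v)
  have hr : ∀ x, r x = ∑ t ∈ Finset.range (d + 1), φ ((D ^ (d - t)) x) • (D ^ t) v := by
    intro x; simp [r]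
  have hz : ∀ s, d < s → D ^ s = 0 := fun s hs => pow_eq_zero_of_le hs h0
  have hrD : ∀ x, r (D x) = D (r x) := by
    intro x
    rw [hr, hr, map_sum, Finset.sum_range_succ', Finset.sum_range_succ]
    simp only [map_smul, ← Module.End.mul_apply, ← pow_succ, ← pow_succ', h0, Nat.sub_zero,
      LinearMap.zero_apply, map_zero, zero_smul, smul_zero, add_zero]
    refine Finset.sum_congr rfl fun t ht => ?_
    rw [Finset.mem_range] at ht
    rw [show d - (t + 1) + 1 = d - t by omega]
  have hrE : ∀ s x, E s (r (E s x)) = r (E s x) := by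
    intro s x
    rw [hr, map_sum]
    refine Finset.sum_congr rfl fun t ht => ?_
    rw [Finset.mem_range] at ht
    rw [map_smul]
    rcases Nat.mod_two_eq_zero_or_one (s + t) with h | h
    · rw [hE0 (show s % 2 = t % 2 by omega), ← hvE t]
    · rw [hDE', hE0 (show (s + (d - t)) % 2 = (d + 1) % 2 by omega), hφE, zero_smul, zero_smul]
  have hE0' : E 0 = p := rfl
  have hE1' : E 1 = q := rfl
  have hrp : Commute r p := by
    ext x
    obtain ⟨y, rfl⟩ := hsurj x
    have e1 := hrE 0 y
    have e2 := hrE 1 y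
    rw [hE0'] at e1
    rw [hE1'] at e2
    have e3 : p (q y) = D (q y) := (LinearMap.congr_fun hDq' y).symm
    have e4 : p (r (q y)) = D (r (q y)) := by
      rw [← e2]; exact (LinearMap.congr_fun hDq' _).symm
    have e5 : p (p y) = p y := LinearMap.congr_fun hp y
    simp only [Module.End.mul_apply, map_sub, e1, e5, e3, e4, hrD]
  have hrq : Commute r q := by
    ext x
    obtain ⟨y, rfl⟩ := hsurj x
    have e1 := hrE 0 y
    have e2 := hrE 1 y
    rw [hE0'] at e1
    rw [hE1'] at e2
    have e3 : q (p y) = D (p y) := (LinearMap.congr_fun hDp' y).symm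
    have e4 : q (r (p y)) = D (r (p y)) := by
      rw [← e1]; exact (LinearMap.congr_fun hDp' _).symm
    have e5 : q (q y) = q y := LinearMap.congr_fun hq y
    simp only [Module.End.mul_apply, map_sub, e2, e5, e3, e4, hrD]
  have hrv : r ((D ^ d) v) = (D ^ d) v := by
    rw [hr, Finset.sum_eq_single d]
    · simp [hφ]
    · intro t ht hne
      rw [Finset.mem_range] at ht
      rw [← Module.End.mul_apply, ← pow_add, hz _ (by omega)]
      simp
    · simp
  rcases hind r hrp hrq with ⟨n, hn⟩ | hb
  · exfalso
    have : ∀ n, (r ^ n) ((D ^ d) v) = (D ^ d) v := by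
      intro n
      induction n with
      | zero => simp
      | succ n ih => rw [pow_succ', Module.End.mul_apply, ih, hrv]
    apply h1
    rw [← this n, hn]; rfl
  · intro x _
    obtain ⟨y, rfl⟩ := hb.2 x
    rw [hr]
    exact Submodule.sum_mem _ fun t ht => Submodule.smul_mem _ _
      (Submodule.subset_span ⟨⟨t, Finset.mem_range.1 ht⟩, rfl⟩)

lemma exists_string [Nontrivial V] {p q : Module.End k V} (hp : p * p = p) (hq : q * q = q)
    (hind : ∀ f : Module.End k V, Commute f p → Commute f q →
      IsNilpotent f ∨ Function.Bijective f) (hn : IsNilpotent (p + q - 1)) {s : ℕ}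
    (hs : (p * q - q * p) * (p + q - 1) ^ s = 0) :
    ∃ d ≤ s, ∃ v : V, (p v = v ∨ q v = v) ∧ ((p + q - 1) ^ (d + 1)) v = 0 ∧
      LinearIndependent k (fun t : Fin (d + 1) => ((p + q - 1) ^ (t : ℕ)) v) ∧
      ⊤ ≤ Submodule.span k (Set.range fun t : Fin (d + 1) => ((p + q - 1) ^ (t : ℕ)) v) := by
  classical
  have hswap : q + p - 1 = p + q - 1 := by rw [add_comm]
  have hu : (p - q) * (p - q) = 1 - (p + q - 1) * (p + q - 1) := by
    simp only [mul_add, mul_sub, add_mul, sub_mul, hp, hq, mul_one, one_mul]; abel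
  have hnil : IsNilpotent ((p + q - 1) * (p + q - 1)) := by
    rw [← pow_two]; exact hn.pow_of_pos two_ne_zero
  have hunit : IsUnit (p - q) := by
    have h := hnil.isUnit_one_sub
    rw [← hu, ← pow_two] at h
    exact (isUnit_pow_iff two_ne_zero).1 h
  obtain ⟨n, hn0, hn1⟩ : ∃ n, (p + q - 1) ^ (n + 1) = 0 ∧ (p + q - 1) ^ n ≠ 0 := by
    have h0 : Nat.find hn ≠ 0 := by
      intro h
      have := Nat.find_spec hn
      rw [h, pow_zero] at this
      exact one_ne_zero this
    obtain ⟨n, h⟩ := Nat.exists_eq_succ_of_ne_zero h0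
    refine ⟨n, ?_, Nat.find_min hn (by omega)⟩
    have := Nat.find_spec hn
    rwa [h] at this
  have hle : n ≤ s := by
    by_contra hlt
    rw [not_le] at hlt
    have h2 : (p - q) * (p + q - 1) = p * q - q * p := by
      simp only [mul_add, mul_sub, sub_mul, hp, hq, mul_one]; abel
    rw [← h2, mul_assoc, ← pow_succ', hunit.mul_right_eq_zero] at hs
    exact hn1 (pow_eq_zero_of_le hlt hs)
  obtain ⟨x, hx⟩ : ∃ x, ((p + q - 1) ^ n) x ≠ 0 := by
    by_contra! h
    exact hn1 (LinearMap.ext h)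
  obtain ⟨g, hg, -⟩ := isUnit_iff_exists.1 hunit
  have hx' : x = p (g x) - q (g x) := (LinearMap.congr_fun hg x).symm
  rcases eq_or_ne (((p + q - 1) ^ n) (p (g x))) 0 with h | h
  · have h1 : ((p + q - 1) ^ n) (q (g x)) ≠ 0 := by
      intro h'
      rw [hx', map_sub, h, h', sub_zero] at hx
      exact hx rfl
    have h2 : q (q (g x)) = q (g x) := LinearMap.congr_fun hq _
    refine ⟨n, hle, q (g x), Or.inr h2, by rw [hn0]; rfl,
      linearIndependent_pow_apply (by rw [hn0]; rfl) h1, ?_⟩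
    have := span_string hq hp (fun f h h' => hind f h' h) (d := n) (v := q (g x))
      (by rw [hswap]; exact hn0) h2 (by rw [hswap]; exact h1)
    rwa [hswap] at this
  · have h2 : p (p (g x)) = p (g x) := LinearMap.congr_fun hp _
    exact ⟨n, hle, p (g x), Or.inl h2, by rw [hn0]; rfl,
      linearIndependent_pow_apply (by rw [hn0]; rfl) h, span_string hp hq hind hn0 h2 h⟩

end idempotents

lemma string_apply {k V : Type} [Field k] [AddCommGroup V] [Module k V] {p q : Module.End k V}
    (hp : p * p = p) (hq : q * q = q) {v : V} (hv : p v = v) (t : ℕ) :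
    p (((p + q - 1) ^ t) v) = (if !t.bodd then ((p + q - 1) ^ t) v else 0) +
        (if t.bodd then ((p + q - 1) ^ (t + 1)) v else 0) ∧
      q (((p + q - 1) ^ t) v) = (if t.bodd then ((p + q - 1) ^ t) v else 0) +
        (if !t.bodd then ((p + q - 1) ^ (t + 1)) v else 0) := by
  have hp' : ∀ x, p (p x) = p x := fun x => LinearMap.congr_fun hp x
  have hq' : ∀ x, q (q x) = q x := fun x => LinearMap.congr_fun hq x
  have key : (t.bodd = false → p (((p + q - 1) ^ t) v) = ((p + q - 1) ^ t) v) ∧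
      (t.bodd = true → q (((p + q - 1) ^ t) v) = ((p + q - 1) ^ t) v) := by
    induction t with
    | zero => simpa using hv
    | succ t ih =>
      rw [pow_succ', Module.End.mul_apply, Nat.bodd_succ]
      generalize ((p + q - 1) ^ t) v = x at *
      constructor
      · intro h
        have h1 := ih.2 (by simpa using h)
        simp [h1, hp']
      · intro h
        have h1 := ih.1 (by simpa using h)
        simp [h1, hq']
  rw [pow_succ', Module.End.mul_apply]
  generalize ((p + q - 1) ^ t) v = x at *
  cases h : t.bodd
  · have h1 := key.1 h
    simp [h1]
  · have h1 := key.2 h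
    simp [h1]

namespace FinMod

variable {k : Type} [Field k] {B : Type} {M : CoxeterMatrix B}

/-- The module has a basis `e 0, …, e (d - 1)` such that each generator sends `e t` to a linear
combination of `e t` and `e (t + 1)` with coefficients `0` or `-1` depending only on the parity
of `t`. -/
def IsString (V : FinMod k (Hecke0 k M)ᵐᵒᵖ) (d : ℕ) (α β : B → Bool → Bool) : Prop :=
  ∃ e : ℕ → V, (∀ t, d ≤ t → e t = 0) ∧ LinearIndependent k (fun t : Fin d => e t) ∧
    ⊤ ≤ Submodule.span k (Set.range fun t : Fin d => e t) ∧
    ∀ l t, op (Hecke0.gen k M l) • e t =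
      -((if α l t.bodd then e t else 0) + if β l t.bodd then e (t + 1) else 0)

lemma IsString.equiv {V W : FinMod k (Hecke0 k M)ᵐᵒᵖ} {d : ℕ} {α β : B → Bool → Bool}
    (hV : IsString V d α β) (hW : IsString W d α β) :
    Nonempty (V ≃ₗ[(Hecke0 k M)ᵐᵒᵖ] W) := by
  obtain ⟨e, he0, he1, he2, he⟩ := hV
  obtain ⟨f, hf0, hf1, hf2, hf⟩ := hW
  let b := Module.Basis.mk he1 he2
  let c := Module.Basis.mk hf1 hf2
  let φ : V ≃ₗ[k] W := b.equiv c (Equiv.refl _)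
  have hφ : ∀ t, φ (e t) = f t := by
    intro t
    rcases lt_or_ge t d with h | h
    · have h1 : b ⟨t, h⟩ = e t := by simp [b]
      have h2 : c ⟨t, h⟩ = f t := by simp [c]
      rw [← h1, Module.Basis.equiv_apply, Equiv.refl_apply, h2]
    · rw [he0 t h, hf0 t h, map_zero]
  have hgen : ∀ l v, φ.toLinearMap (op (Hecke0.gen k M l) • v) =
      op (Hecke0.gen k M l) • φ.toLinearMap v := by
    intro l v
    have hv : v ∈ Submodule.span k (Set.range fun t : Fin d => e t) := he2 trivial
    induction hv using Submodule.span_induction with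
    | mem v hv =>
      obtain ⟨t, rfl⟩ := hv
      show φ _ = _ • φ _
      rw [he, hφ, hf, map_neg, map_add]
      split_ifs <;> simp [hφ]
    | zero => simp
    | add x y _ _ hx hy => rw [smul_add, map_add, hx, hy, map_add, smul_add]
    | smul a x _ hx => rw [smul_comm, map_smul, hx, map_smul, smul_comm]
  exact ⟨{ φ with map_smul' := map_smul_of_gen φ.toLinearMap hgen }⟩

lemma representationFinite_of_isString [Finite B] [Module.Finite k (Hecke0 k M)] (D : ℕ)
    (h : ∀ V : FinMod k (Hecke0 k M)ᵐᵒᵖ, Indec V → ∃ d ≤ D, ∃ α β, IsString V d α β) :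
    RepresentationFinite (Hecke0 k M) := by
  classical
  have _ : Module.Finite k (Hecke0 k M)ᵐᵒᵖ := Module.Finite.equiv (MulOpposite.opLinearEquiv k)
  let J := Fin (D + 1) × (B → Bool → Bool) × (B → Bool → Bool)
  let P : J → FinMod k (Hecke0 k M)ᵐᵒᵖ → Prop := fun x V => IsString V x.1 x.2.1 x.2.2
  obtain ⟨n, ⟨E⟩⟩ := Finite.exists_equiv_fin J
  let R : J → FinMod k (Hecke0 k M)ᵐᵒᵖ := fun x => if hx : ∃ V, P x V then hx.choose else zero _ _
  refine ⟨n, fun y => toCat (R (E.symm y)), fun V hV hi => ?_⟩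
  have hi' : Indec (ofFinite k (R := (Hecke0 k M)ᵐᵒᵖ) V) := indec_of_indecomposable hi
  obtain ⟨d, hd, α, β, hs⟩ := h _ hi'
  let x : J := (⟨d, Nat.lt_succ_of_le hd⟩, α, β)
  have hx : ∃ V, P x V := ⟨_, hs⟩
  have hR : P x (R x) := by
    simp only [R, dif_pos hx]
    exact hx.choose_spec
  refine ⟨E x, ?_⟩
  show Nonempty (V ≃ₗ[(Hecke0 k M)ᵐᵒᵖ] R (E.symm (E x)))
  rw [E.symm_apply_apply]
  exact IsString.equiv hs hR

lemma Indec.nilpotent_or_bijective {V : FinMod k (Hecke0 k M)ᵐᵒᵖ} (hV : Indec V)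
    (f : Module.End k V)
    (hf : ∀ i v, f (op (Hecke0.gen k M i) • v) = op (Hecke0.gen k M i) • f v) :
    IsNilpotent f ∨ Function.Bijective f := by
  let g : V →ₗ[(Hecke0 k M)ᵐᵒᵖ] V := { f with map_smul' := map_smul_of_gen f hf }
  rcases hV.2 g with ⟨n, hn⟩ | h
  · left
    refine ⟨n, LinearMap.ext fun x => ?_⟩
    have : ∀ n, (f ^ n) x = (g ^ n) x := by
      intro n
      induction n with
      | zero => rfl
      | succ n ih => rw [pow_succ', pow_succ', Module.End.mul_apply, Module.End.mul_apply, ih]; rfl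
    rw [this, hn]; rfl
  · exact Or.inr h

/-- A generator acting centrally on an indecomposable module acts by a scalar. -/
lemma Indec.gen_smul {V : FinMod k (Hecke0 k M)ᵐᵒᵖ} (hV : Indec V) {l : B}
    (h : ∀ i (v : V), op (Hecke0.gen k M l) • op (Hecke0.gen k M i) • v =
      op (Hecke0.gen k M i) • op (Hecke0.gen k M l) • v) :
    (∀ v : V, op (Hecke0.gen k M l) • v = 0) ∨ ∀ v : V, op (Hecke0.gen k M l) • v = -v := by
  have hsq : ∀ v : V, op (Hecke0.gen k M l) • op (Hecke0.gen k M l) • v =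
      -(op (Hecke0.gen k M l) • v) := by
    intro v
    rw [← mul_smul, ← op_mul, Hecke0.gen_mul_self, MulOpposite.op_neg, neg_smul]
  rcases hV.nilpotent_or_bijective (Algebra.lsmul k k V (op (Hecke0.gen k M l))) h with ⟨n, hn⟩ | hb
  · left
    have key : ∀ (n : ℕ) (v : V), ((Algebra.lsmul k k V (op (Hecke0.gen k M l)) : Module.End k V) ^ (n + 1)) v =
        (-1 : ℤ) ^ n • (op (Hecke0.gen k M l) • v) := by
      intro n v
      induction n with
      | zero => simp
      | succ n ih =>
        rw [pow_succ', Module.End.mul_apply, ih, map_zsmul, pow_succ, mul_smul, neg_one_smul, ← hsq]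
        rfl
    intro v
    have h1 := key n v
    rw [pow_succ', hn, mul_zero, LinearMap.zero_apply] at h1
    rcases neg_one_pow_eq_or ℤ n with h2 | h2 <;> rw [h2] at h1 <;> simpa using h1.symm
  · right
    intro v
    obtain ⟨w, hw⟩ := hb.2 v
    have hw' : op (Hecke0.gen k M l) • w = v := hw
    rw [← hw', hsq]

lemma isString_of_scalar {V : FinMod k (Hecke0 k M)ᵐᵒᵖ} (hV : Indec V)
    (h : ∀ l, (∀ v : V, op (Hecke0.gen k M l) • v = 0) ∨ ∀ v : V, op (Hecke0.gen k M l) • v = -v) :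
    ∃ α β, IsString V 1 α β := by
  classical
  have := hV.1
  obtain ⟨v, hv⟩ := exists_ne (0 : V)
  obtain ⟨φ, hφ⟩ : ∃ φ : V →ₗ[k] k, φ v = 1 := by
    obtain ⟨φ, hφ, -⟩ := Submodule.exists_le_ker_of_notMem (p := (⊥ : Submodule k V)) (v := v)
      (by simpa using hv)
    exact ⟨(φ v)⁻¹ • φ, by simp [hφ]⟩
  have hspan : ∀ x : V, ∃ c : k, x = c • v := by
    rcases hV.nilpotent_or_bijective (φ.smulRight v) (fun l x => by
      rcases h l with h | h <;> simp [h]) with ⟨n, hn⟩ | hb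
    · exfalso
      have : ∀ n : ℕ, ((φ.smulRight v : Module.End k V) ^ n) v = v := by
        intro n
        induction n with
        | zero => rfl
        | succ n ih => rw [pow_succ', Module.End.mul_apply, ih]; simp [hφ]
      apply hv
      rw [← this n, hn]; rfl
    · intro x
      obtain ⟨y, rfl⟩ := hb.2 x
      exact ⟨φ y, rfl⟩
  refine ⟨fun l _ => decide (∀ v : V, op (Hecke0.gen k M l) • v = -v), fun _ _ => false,
    fun t => if t = 0 then v else 0, fun t ht => if_neg (by omega), ?_, ?_, fun l t => ?_⟩
  · exact linearIndependent_unique_iff.2 (by simpa using hv)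
  · intro x _
    obtain ⟨c, rfl⟩ := hspan x
    exact Submodule.smul_mem _ _ (Submodule.subset_span ⟨0, by simp⟩)
  · by_cases hl : ∀ v : V, op (Hecke0.gen k M l) • v = -v
    · simp [hl]
    · have := (h l).resolve_right hl
      rw [this, if_neg (by rw [decide_eq_true_eq]; exact hl)]
      simp

/-- If the generators commute then the 0-Hecke algebra is representation-finite. -/
lemma representationFinite_of_commute [Finite B] [Module.Finite k (Hecke0 k M)]
    (h : ∀ l i, Commute (Hecke0.gen k M l) (Hecke0.gen k M i)) :
    RepresentationFinite (Hecke0 k M) := by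
  refine representationFinite_of_isString 1 fun V hV => ⟨1, le_rfl, ?_⟩
  refine isString_of_scalar hV fun l => hV.gen_smul fun i v => ?_
  rw [← mul_smul, ← mul_smul, ← op_mul, ← op_mul, (h l i).eq]

lemma isString_of_edge {V : FinMod k (Hecke0 k M)ᵐᵒᵖ} {i j : B} (hij : i ≠ j)
    (h : ∀ l, l ≠ i → l ≠ j →
      (∀ v : V, op (Hecke0.gen k M l) • v = 0) ∨ ∀ v : V, op (Hecke0.gen k M l) • v = -v)
    {d : ℕ} {e : ℕ → V} (h0 : ∀ t, d ≤ t → e t = 0) (h1 : LinearIndependent k (fun t : Fin d => e t))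
    (h2 : ⊤ ≤ Submodule.span k (Set.range fun t : Fin d => e t))
    (hi : ∀ t, op (Hecke0.gen k M i) • e t =
      -((if !t.bodd then e t else 0) + if t.bodd then e (t + 1) else 0))
    (hj : ∀ t, op (Hecke0.gen k M j) • e t =
      -((if t.bodd then e t else 0) + if !t.bodd then e (t + 1) else 0)) :
    ∃ α β, IsString V d α β := by
  classical
  refine ⟨fun l τ => if l = i then !τ else if l = j then τ else
      decide (∀ v : V, op (Hecke0.gen k M l) • v = -v),
    fun l τ => if l = i then τ else if l = j then !τ else false, e, h0, h1, h2, fun l t => ?_⟩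
  by_cases hli : l = i
  · subst hli
    simp only [if_true, hi]
  by_cases hlj : l = j
  · subst hlj
    simp only [if_true, hij.symm, if_false, hj]
  simp only [hli, hlj, if_false]
  by_cases hl : ∀ v : V, op (Hecke0.gen k M l) • v = -v
  · simp [hl]
  · have := (h l hli hlj).resolve_right hl
    rw [this, if_neg (by rw [decide_eq_true_eq]; exact hl)]
    simp

/-- If the Coxeter diagram has a single edge then the 0-Hecke algebra is representation-finite. -/
lemma representationFinite_of_edge [Finite B] [Module.Finite k (Hecke0 k M)] {i j : B}
    (hij : i ≠ j) (hM : M i j ≠ 0)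
    (h : ∀ l, l ≠ i → l ≠ j → ∀ l', Commute (Hecke0.gen k M l) (Hecke0.gen k M l')) :
    RepresentationFinite (Hecke0 k M) := by
  obtain ⟨r, hr⟩ := braid_commutator (Hecke0.gen_mul_self (k := k) i) (Hecke0.gen_mul_self j) hM
    (Hecke0.gen_braid i j)
  refine representationFinite_of_isString (2 * r + 1) fun V hV => ?_
  have := hV.1
  have hl : ∀ l, l ≠ i → l ≠ j → (∀ v : V, op (Hecke0.gen k M l) • v = 0) ∨
      ∀ v : V, op (Hecke0.gen k M l) • v = -v := by
    intro l h1 h2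
    refine hV.gen_smul fun i v => ?_
    rw [← mul_smul, ← mul_smul, ← op_mul, ← op_mul, (h l h1 h2 i).eq]
  let ρ : (Hecke0 k M)ᵐᵒᵖ →ₐ[k] Module.End k V := Algebra.lsmul k k V
  obtain ⟨p, hpdef⟩ : ∃ p, p = -ρ (op (Hecke0.gen k M i)) := ⟨_, rfl⟩
  obtain ⟨q, hqdef⟩ : ∃ q, q = -ρ (op (Hecke0.gen k M j)) := ⟨_, rfl⟩
  have hpv : ∀ v : V, op (Hecke0.gen k M i) • v = -(p v) := by
    intro v; rw [hpdef, LinearMap.neg_apply, neg_neg]; rfl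
  have hqv : ∀ v : V, op (Hecke0.gen k M j) • v = -(q v) := by
    intro v; rw [hqdef, LinearMap.neg_apply, neg_neg]; rfl
  have hp : p * p = p := by
    rw [hpdef, neg_mul_neg, ← map_mul, ← op_mul, Hecke0.gen_mul_self, MulOpposite.op_neg, map_neg]
  have hq : q * q = q := by
    rw [hqdef, neg_mul_neg, ← map_mul, ← op_mul, Hecke0.gen_mul_self, MulOpposite.op_neg, map_neg]
  have hend : ∀ f : Module.End k V, Commute f p → Commute f q →
      IsNilpotent f ∨ Function.Bijective f := by
    intro f h1 h2
    refine hV.nilpotent_or_bijective f fun l v => ?_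
    by_cases hli : l = i
    · subst hli
      rw [hpv, hpv, map_neg]
      exact congrArg Neg.neg (LinearMap.congr_fun h1.eq v)
    by_cases hlj : l = j
    · subst hlj
      rw [hqv, hqv, map_neg]
      exact congrArg Neg.neg (LinearMap.congr_fun h2.eq v)
    rcases hl l hli hlj with h | h <;> simp [h]
  have hDD : (p + q - 1) * (p + q - 1) = 1 - p - q + p * q + q * p := by
    simp only [mul_add, mul_sub, add_mul, sub_mul, hp, hq, mul_one, one_mul]; abel
  have hcp : Commute ((p + q - 1) * (p + q - 1)) p := by
    rw [hDD]
    show _ * _ = _ * _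
    simp only [mul_add, mul_sub, add_mul, sub_mul, ← mul_assoc, hp, mul_one, one_mul]
    rw [mul_assoc q p p, hp]; abel
  have hcq : Commute ((p + q - 1) * (p + q - 1)) q := by
    rw [hDD]
    show _ * _ = _ * _
    simp only [mul_add, mul_sub, add_mul, sub_mul, ← mul_assoc, hq, mul_one, one_mul]
    rw [mul_assoc p q q, hq]; abel
  have hρ : ((p + q - 1) * (p + q - 1)) ^ r * (p * q - q * p) = 0 := by
    have h1 := congrArg (fun x => ρ (op x)) hr
    simp only [op_mul, op_pow, MulOpposite.op_add, MulOpposite.op_sub, MulOpposite.op_one, map_mul, map_add, map_sub,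
      map_one, map_pow, MulOpposite.op_zero, map_zero] at h1
    rw [hDD, hpdef, hqdef]
    rw [← neg_eq_zero, ← h1]
    simp only [neg_mul_neg, sub_neg_eq_add]
    rw [← mul_neg, neg_sub]
    congr 2
    abel
  have hcomm : (p * q - q * p) * (p + q - 1) ^ (2 * r) = 0 := by
    rw [pow_mul, pow_two, ← hρ]
    exact (((hcp.mul_right hcq).sub_right (hcq.mul_right hcp)).pow_left r).symm.eq
  rcases hend _ hcp hcq with hn | hb
  · have hn' : IsNilpotent (p + q - 1) := by
      obtain ⟨n, hn⟩ := hn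
      exact ⟨2 * n, by rw [pow_mul, pow_two, hn]⟩
    obtain ⟨d, hd, v, hv, h0, h1, h2⟩ := exists_string hp hq hend hn' hcomm
    refine ⟨d + 1, by omega, ?_⟩
    have hz : ∀ t, d + 1 ≤ t → ((p + q - 1) ^ t) v = 0 := by
      intro t ht
      obtain ⟨x, rfl⟩ := Nat.exists_eq_add_of_le ht
      rw [add_comm (d + 1) x, pow_add, Module.End.mul_apply, h0, map_zero]
    rcases hv with hv | hv
    · exact isString_of_edge hij hl hz h1 h2 (fun t => by rw [hpv, (string_apply hp hq hv t).1])
        fun t => by rw [hqv, (string_apply hp hq hv t).2]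
    · refine isString_of_edge hij.symm (fun l a b => hl l b a) hz h1 h2 (fun t => ?_) fun t => ?_
      · have := (string_apply hq hp hv t).1
        rw [add_comm q p] at this
        rw [hqv, this]
      · have := (string_apply hq hp hv t).2
        rw [add_comm q p] at this
        rw [hpv, this]
  · refine ⟨1, by omega, isString_of_scalar hV fun l => ?_⟩
    have hpq : p * q = q * p := by
      have : IsUnit (((p + q - 1) * (p + q - 1)) ^ r) := ((Module.End.isUnit_iff _).2 hb).pow r
      exact sub_eq_zero.1 (this.mul_right_eq_zero.1 hρ)
    have hpq' : ∀ v, p (q v) = q (p v) := fun v => LinearMap.congr_fun hpq v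
    refine hV.gen_smul fun l' v => ?_
    by_cases h1 : l ≠ i ∧ l ≠ j
    · rw [← mul_smul, ← mul_smul, ← op_mul, ← op_mul, (h l h1.1 h1.2 l').eq]
    by_cases h2 : l' ≠ i ∧ l' ≠ j
    · rw [← mul_smul, ← mul_smul, ← op_mul, ← op_mul, (h l' h2.1 h2.2 l).eq]
    have h1' : l = i ∨ l = j := by tauto
    have h2' : l' = i ∨ l' = j := by tauto
    rcases h1' with rfl | rfl <;> rcases h2' with rfl | rfl <;> simp [hpv, hqv, hpq']

end FinMod

lemma Hecke0.commute_gen_of_eq_two {k : Type} [Field k] {B : Type} {M : CoxeterMatrix B} {l i : B}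
    (h : M l i = 2) : Commute (gen k M l) (gen k M i) := by
  have := gen_braid (k := k) (M := M) l i
  rw [h] at this
  show _ * _ = _ * _
  simpa [altProd, List.range_succ] using this

/-- For an arbitrary finite Coxeter group `W`, the 0-Hecke algebra `H_0(W)` is τ-tilting
finite iff it is representation-finite. -/
theorem statement5 (k : Type) [Field k] [IsAlgClosed k]
    {B W : Type} (M : CoxeterMatrix B) [Group W] (cs : CoxeterSystem M W) [Finite W] :
    TauTiltingFinite k (Hecke0 k M) ↔ RepresentationFinite (Hecke0 k M) := by
  have := Hecke0.finite k cs
  have _ : Infinite k := IsAlgClosed.instInfinite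
  have _ : Finite B := Finite.of_injective cs.simple cs.simple_injective
  refine ⟨fun h => ?_, FinMod.tauTiltingFinite_of_representationFinite⟩
  by_cases he : ∃ i j, i ≠ j ∧ M i j ≠ 2
  · obtain ⟨i, j, hij, h1⟩ := he
    have hedge : ∀ p q, p ≠ q → M p q ≠ 2 → (p = i ∧ q = j) ∨ (p = j ∧ q = i) := by
      intro p q hpq h2
      by_contra! hne
      exact FinMod.not_tauTiltingFinite_of_two_edges hij hpq h1 h2 (fun h => hne.1 h.1 h.2)
        (fun h => hne.2 h.1 h.2) h
    refine FinMod.representationFinite_of_edge hij (cs.coxeterMatrix_ne_zero i j)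
      fun l hi hj l' => ?_
    rcases eq_or_ne l l' with rfl | hl
    · exact Commute.refl _
    · apply Hecke0.commute_gen_of_eq_two
      by_contra h2
      rcases hedge l l' hl h2 with h3 | h3
      · exact hi h3.1
      · exact hj h3.1
  · push Not at he
    refine FinMod.representationFinite_of_commute fun l i => ?_
    rcases eq_or_ne l i with rfl | hl
    · exact Commute.refl _
    · exact Hecke0.commute_gen_of_eq_two (he l i hl)

end
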